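/- For all integers s ≥ 1 and t ≥ 6, dim_{F_2}(QP_4)_{2^{s+t}+2^{s}−2} equals 125 if s = 1, equals 175 if s = 2, equals 255 if s = 3, equals 300 if s = 4, and equals 315 if s ≥ 5. -/

import Mathlib

open MvPolynomial

/-- The total Steenrod square on `P_k = F_2[x_1,…,x_k]`, the algebra map with
`Sq(x_j) = x_j + x_j^2`. -/
noncomputable def SqTotal (k : ℕ) :
    MvPolynomial (Fin k) (ZMod 2) →ₐ[ZMod 2] MvPolynomial (Fin k) (ZMod 2) :=
  aeval fun j => X j + X j ^ 2

/-- The Steenrod square `Sq^i : P_k → P_k`, sending a homogeneous polynomial `f` of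
degree `d` to the degree-`d + i` homogeneous component of `Sq(f)`, extended additively. -/
noncomputable def SqOp (k i : ℕ) (f : MvPolynomial (Fin k) (ZMod 2)) :
    MvPolynomial (Fin k) (ZMod 2) :=
  ∑ d ∈ Finset.range (f.totalDegree + 1),
    homogeneousComponent (d + i) (SqTotal k (homogeneousComponent d f))

/-- The space of hit polynomials: finite sums of `Sq^i (f_i)` with `i > 0`. -/
noncomputable def hitSubmodule (k : ℕ) :
    Submodule (ZMod 2) (MvPolynomial (Fin k) (ZMod 2)) :=
  Submodule.span (ZMod 2) {g | ∃ i f, 0 < i ∧ g = SqOp k i f}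

/-- A polynomial is hit if it is a finite sum of `Sq^i (f_i)` with `i > 0`. -/
def IsHit (k : ℕ) (f : MvPolynomial (Fin k) (ZMod 2)) : Prop := f ∈ hitSubmodule k

/-- `(QP_k)_n`: the space of homogeneous polynomials of degree `n` modulo hit polynomials. -/
abbrev QP (k n : ℕ) :=
  ↥(homogeneousSubmodule (Fin k) (ZMod 2) n) ⧸
    ((hitSubmodule k).comap (homogeneousSubmodule (Fin k) (ZMod 2) n).subtype)

namespace HitProblem

/-- The polynomial algebra `P_k` over `F_2`. -/
abbrev Pol (k : ℕ) := MvPolynomial (Fin k) (ZMod 2)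

section Steenrod

variable {k : ℕ}

/-- The Steenrod squares assembled into a ring homomorphism `f ↦ ∑ Sq^i(f) T^i`. -/
noncomputable def sqSeries (k : ℕ) : Pol k →ₐ[ZMod 2] Polynomial (Pol k) :=
  aeval fun j => Polynomial.C (X j) + Polynomial.C (X j ^ 2) * Polynomial.X

/-- The Steenrod square `Sq^i` as a linear map. -/
noncomputable def sq (i : ℕ) : Pol k →ₗ[ZMod 2] Pol k where
  toFun f := (sqSeries k f).coeff i
  map_add' f g := by simp
  map_smul' a f := by simp

lemma sq_apply (i : ℕ) (f : Pol k) : sq i f = (sqSeries k f).coeff i := rfl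

lemma sqSeries_X (j : Fin k) :
    sqSeries k (X j) = Polynomial.C (X j) + Polynomial.C (X j ^ 2) * Polynomial.X := by
  simp [sqSeries]

lemma eval_one_sqSeries (f : Pol k) : (sqSeries k f).eval 1 = SqTotal k f := by
  have h : (Polynomial.evalRingHom (1 : Pol k)).comp (sqSeries k).toRingHom =
      (SqTotal k).toRingHom := by
    apply MvPolynomial.ringHom_ext
    · intro r
      have h1 : C r = algebraMap (ZMod 2) (Pol k) r := rfl
      simp only [h1, AlgHom.toRingHom_eq_coe, RingHom.coe_comp, RingHom.coe_coe,
        Function.comp_apply, AlgHom.commutes]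
      simp [Polynomial.algebraMap_apply]
    · intro j
      simp [sqSeries, SqTotal]
  exact congrArg (fun φ : Pol k →+* Pol k => φ f) h

lemma sq_isHomogeneous {f : Pol k} {d : ℕ} (hf : f.IsHomogeneous d) (i : ℕ) :
    (sq i f).IsHomogeneous (d + i) := by
  have key : ∀ e : Fin k →₀ ℕ, ∀ i,
      (sq i (monomial e (1 : ZMod 2))).IsHomogeneous (e.degree + i) := by
    intro e
    induction e using Finsupp.induction_linear with
    | zero =>
      intro i
      have h1 : monomial (0 : Fin k →₀ ℕ) (1 : ZMod 2) = 1 := rfl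
      rw [h1, sq_apply, map_one, Polynomial.coeff_one]
      split_ifs with h
      · subst h; simpa using isHomogeneous_one (Fin k) (ZMod 2)
      · exact isHomogeneous_zero _ _ _
    | add e e' he he' =>
      intro i
      have h1 : monomial (e + e') (1 : ZMod 2) = monomial e 1 * monomial e' 1 := by
        simp [monomial_mul]
      rw [h1, sq_apply, map_mul, Polynomial.coeff_mul]
      apply IsHomogeneous.sum
      rintro ⟨a, b⟩ hab
      have hab : a + b = i := Finset.HasAntidiagonal.mem_antidiagonal.mp hab
      have hd : (e + e').degree + i = e.degree + a + (e'.degree + b) := by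
        rw [map_add]; omega
      rw [hd]
      exact (he a).mul (he' b)
    | single j n =>
      have hX : ∀ i, (sq i (X j : Pol k)).IsHomogeneous (1 + i) := by
        intro i
        rw [sq_apply, sqSeries_X, Polynomial.coeff_add, Polynomial.coeff_C_mul,
          Polynomial.coeff_C, Polynomial.coeff_X]
        match i with
        | 0 => simpa using isHomogeneous_X (ZMod 2) j
        | 1 => simpa using (isHomogeneous_X (ZMod 2) j).pow 2
        | i + 2 => simpa using isHomogeneous_zero _ _ _
      have h1 : monomial (Finsupp.single j n) (1 : ZMod 2) = X j ^ n := by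
        rw [X_pow_eq_monomial]
      rw [h1, Finsupp.degree_single]
      induction n with
      | zero =>
        intro i
        rw [sq_apply, pow_zero, map_one, Polynomial.coeff_one]
        split_ifs with h
        · subst h; simpa using isHomogeneous_one (Fin k) (ZMod 2)
        · exact isHomogeneous_zero _ _ _
      | succ n ih =>
        intro i
        have ih := ih (by rw [X_pow_eq_monomial])
        rw [pow_succ, sq_apply, map_mul, Polynomial.coeff_mul]
        apply IsHomogeneous.sum
        rintro ⟨a, b⟩ hab
        have hab : a + b = i := Finset.HasAntidiagonal.mem_antidiagonal.mp hab
        have hd : n + 1 + i = n + a + (1 + b) := by omega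
        rw [hd]
        exact (ih a).mul (hX b)
  rw [f.as_sum, map_sum]
  apply IsHomogeneous.sum
  intro e he
  have h1 : monomial e (coeff e f) = coeff e f • monomial e (1 : ZMod 2) := by
    rw [smul_monomial]; simp
  have h2 : e.degree = d := by
    have := hf (mem_support_iff.mp he)
    rwa [Finsupp.degree_eq_weight_one]
  rw [h1, map_smul, ← h2]
  exact (homogeneousSubmodule (Fin k) (ZMod 2) _).smul_mem _ (key e i)

lemma homogeneousComponent_SqTotal {f : Pol k} {d : ℕ} (hf : f.IsHomogeneous d) (i : ℕ) :
    homogeneousComponent (d + i) (SqTotal k f) = sq i f := by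
  rw [← eval_one_sqSeries, Polynomial.eval_eq_sum_range' (n := (sqSeries k f).natDegree + i + 1)
    (by omega), map_sum, Finset.sum_eq_single i]
  · rw [one_pow, mul_one, ← sq_apply, homogeneousComponent_of_mem (sq_isHomogeneous hf i),
      if_pos rfl]
  · intro j _ hj
    rw [one_pow, mul_one, ← sq_apply, homogeneousComponent_of_mem (sq_isHomogeneous hf j),
      if_neg (by omega)]
  · intro h; simp at h

lemma SqOp_eq (i : ℕ) (f : Pol k) : SqOp k i f = sq i f := by
  conv_rhs => rw [← sum_homogeneousComponent f]
  rw [SqOp, map_sum]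
  exact Finset.sum_congr rfl fun d _ =>
    homogeneousComponent_SqTotal (homogeneousComponent_isHomogeneous d f) i

lemma sq_mem_hit {i : ℕ} (hi : 0 < i) (f : Pol k) : sq i f ∈ hitSubmodule k :=
  Submodule.subset_span ⟨i, f, hi, (SqOp_eq i f).symm⟩

lemma hit_induction {p : Submodule (ZMod 2) (Pol k)}
    (h : ∀ i f, 0 < i → sq i f ∈ p) : hitSubmodule k ≤ p := by
  refine Submodule.span_le.mpr ?_
  rintro _ ⟨i, f, hi, rfl⟩
  rw [SqOp_eq]
  exact h i f hi

lemma homogeneousComponent_mem_hit {f : Pol k} (hf : f ∈ hitSubmodule k) (n : ℕ) :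
    homogeneousComponent n f ∈ hitSubmodule k := by
  refine hit_induction (p := (hitSubmodule k).comap (homogeneousComponent n)) ?_ hf
  intro i f hi
  rw [Submodule.mem_comap, ← sum_homogeneousComponent f, map_sum, map_sum]
  refine Submodule.sum_mem _ fun d _ => ?_
  rw [homogeneousComponent_of_mem (sq_isHomogeneous (homogeneousComponent_isHomogeneous d f) i)]
  split_ifs
  · exact sq_mem_hit hi _
  · exact zero_mem _

lemma sq_zero (f : Pol k) : sq 0 f = f := by
  have h : (Polynomial.constantCoeff).comp (sqSeries k).toRingHom = RingHom.id (Pol k) := by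
    apply MvPolynomial.ringHom_ext
    · intro r
      have h1 : C r = algebraMap (ZMod 2) (Pol k) r := rfl
      simp only [h1, AlgHom.toRingHom_eq_coe, RingHom.coe_comp, RingHom.coe_coe,
        Function.comp_apply, AlgHom.commutes]
      simp [Polynomial.algebraMap_apply]
    · intro j
      simp [sqSeries]
  exact congrArg (fun φ : Pol k →+* Pol k => φ f) h

lemma coeff_pow_two (p : Polynomial (Pol k)) (n : ℕ) :
    (p ^ 2).coeff n = if 2 ∣ n then p.coeff (n / 2) ^ 2 else 0 := by
  rw [← Polynomial.map_frobenius_expand 2 p, Polynomial.coeff_map,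
    Polynomial.coeff_expand (by norm_num)]
  split_ifs <;> simp [frobenius_def]

/-- The squarefree monomial with the given set of variables. -/
noncomputable def sqfree (c : Finset (Fin k)) : Pol k := ∏ j ∈ c, X j

lemma sqSeries_sqfree (c : Finset (Fin k)) :
    sqSeries k (sqfree c) = ∑ T ∈ c.powerset,
      Polynomial.C (sqfree (c \ T) * sqfree T ^ 2) * Polynomial.X ^ T.card := by
  rw [sqfree, map_prod]
  simp_rw [sqSeries_X, add_comm (Polynomial.C (X _))]
  rw [Finset.prod_add]
  refine Finset.sum_congr rfl fun T _ => ?_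
  rw [Finset.prod_mul_distrib, Finset.prod_const, ← map_prod, ← map_prod, map_mul, sqfree, sqfree,
    Finset.prod_pow]
  ring

/-- The Cartan formula for a squarefree monomial times a square. -/
lemma sq_sqfree_mul (c : Finset (Fin k)) (g : Pol k) (n : ℕ) :
    sq n (sqfree c * g ^ 2) = ∑ T ∈ c.powerset, sqfree (c \ T) * sqfree T ^ 2 *
      (if T.card ≤ n ∧ 2 ∣ n - T.card then sq ((n - T.card) / 2) g ^ 2 else 0) := by
  rw [sq_apply, map_mul, map_pow, sqSeries_sqfree, Finset.sum_mul, Polynomial.finsetSum_coeff]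
  refine Finset.sum_congr rfl fun T _ => ?_
  rw [mul_assoc, Polynomial.coeff_C_mul, Polynomial.coeff_X_pow_mul']
  congr 1
  rw [coeff_pow_two, ite_and]
  rfl

/-- `Sq^1` of a squarefree monomial times a square is hit. -/
lemma sq_one_rule (c : Finset (Fin k)) (g : Pol k) :
    ∑ j ∈ c, sqfree (c \ {j}) * (X j * g) ^ 2 ∈ hitSubmodule k := by
  have h := sq_mem_hit (k := k) one_pos (sqfree c * g ^ 2)
  rw [sq_sqfree_mul] at h
  have h2 : ∀ T ∈ c.powerset, T ∉ c.powersetCard 1 → sqfree (c \ T) * sqfree T ^ 2 *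
      (if T.card ≤ 1 ∧ 2 ∣ 1 - T.card then sq ((1 - T.card) / 2) g ^ 2 else 0) = 0 := by
    intro T hT hT1
    rw [if_neg, mul_zero]
    rintro ⟨h1, h2⟩
    have : T.card ≠ 1 := fun h => hT1 (Finset.mem_powersetCard.mpr ⟨Finset.mem_powerset.mp hT, h⟩)
    have h0 : T.card = 0 := by omega
    rw [h0] at h2
    norm_num at h2
  rw [← Finset.sum_subset (fun T hT => Finset.mem_powerset.mpr (Finset.mem_powersetCard.mp hT).1) h2,
    Finset.powersetCard_one, Finset.sum_map] at h
  convert h using 2 with j hj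
  simp [sq_zero, sqfree]
  ring

/-- `Sq^2` of a squarefree monomial times a fourth power is hit. -/
lemma sq_two_rule (c : Finset (Fin k)) (g : Pol k) :
    ∑ T ∈ c.powersetCard 2, sqfree (c \ T) * (sqfree T * g ^ 2) ^ 2 ∈ hitSubmodule k := by
  have h := sq_mem_hit (k := k) two_pos (sqfree c * (g ^ 2) ^ 2)
  rw [sq_sqfree_mul] at h
  have h0 : sq 1 (g ^ 2) = 0 := by
    rw [sq_apply, map_pow, coeff_pow_two]; norm_num
  have h2 : ∀ T ∈ c.powerset, T ∉ c.powersetCard 2 → sqfree (c \ T) * sqfree T ^ 2 *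
      (if T.card ≤ 2 ∧ 2 ∣ 2 - T.card then sq ((2 - T.card) / 2) (g ^ 2) ^ 2 else 0) = 0 := by
    intro T hT hT1
    have : T.card ≠ 2 := fun h => hT1 (Finset.mem_powersetCard.mpr ⟨Finset.mem_powerset.mp hT, h⟩)
    split_ifs with h12
    · have h0' : T.card = 0 := by omega
      rw [h0']
      norm_num [h0]
    · rw [mul_zero]
  rw [← Finset.sum_subset (fun T hT => Finset.mem_powerset.mpr (Finset.mem_powersetCard.mp hT).1) h2]
    at h
  convert h using 2 with T hT
  rw [(Finset.mem_powersetCard.mp hT).2]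
  simp [sq_zero]
  ring

/-- The square of a monomial of positive degree is hit. -/
lemma monomial_sq_mem_hit {e : Fin k →₀ ℕ} (he : 0 < e.degree) :
    monomial e (1 : ZMod 2) ^ 2 ∈ hitSubmodule k := by
  have key : ∀ e : Fin k →₀ ℕ, (sqSeries k (monomial e (1 : ZMod 2))).natDegree ≤ e.degree ∧
      (sqSeries k (monomial e (1 : ZMod 2))).coeff e.degree = monomial e 1 ^ 2 := by
    intro e
    induction e using Finsupp.induction_linear with
    | zero =>
      have h1 : monomial (0 : Fin k →₀ ℕ) (1 : ZMod 2) = 1 := rfl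
      simp [h1]
    | add e e' he he' =>
      have h1 : monomial (e + e') (1 : ZMod 2) = monomial e 1 * monomial e' 1 := by
        simp [monomial_mul]
      rw [h1, map_mul, map_add]
      refine ⟨Polynomial.natDegree_mul_le_of_le he.1 he'.1, ?_⟩
      rw [Polynomial.coeff_mul_add_eq_of_natDegree_le he.1 he'.1, he.2, he'.2, mul_pow]
    | single j n =>
      have h1 : monomial (Finsupp.single j n) (1 : ZMod 2) = X j ^ n := by
        rw [X_pow_eq_monomial]
      have h2 : (sqSeries k (X j)).natDegree ≤ 1 := by
        rw [sqSeries_X]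
        compute_degree
      rw [h1, Finsupp.degree_single, map_pow]
      refine ⟨by simpa using Polynomial.natDegree_pow_le_of_le n h2, ?_⟩
      have := Polynomial.coeff_pow_of_natDegree_le (m := n) h2
      rw [mul_one] at this
      rw [this, sqSeries_X, Polynomial.coeff_add, Polynomial.coeff_C_mul,
          Polynomial.coeff_C, Polynomial.coeff_X]
      simp
      ring
  have := sq_mem_hit he (monomial e (1 : ZMod 2))
  rwa [sq_apply, (key e).2] at this

end Steenrod

section Words

variable {k : ℕ}

/-- The additive operation `g ↦ x_c g^2`, where `x_c` is the squarefree monomial on `c`. -/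
noncomputable def cons (c : Finset (Fin k)) : Pol k →ₗ[ZMod 2] Pol k where
  toFun g := sqfree c * g ^ 2
  map_add' f g := by rw [CharTwo.add_sq, mul_add]
  map_smul' a f := by
    have h : a ^ 2 = a := ZMod.pow_card a
    rw [smul_pow, h, mul_smul_comm]
    rfl

lemma cons_apply (c : Finset (Fin k)) (g : Pol k) : cons c g = sqfree c * g ^ 2 := rfl

/-- Iterated `cons`: the word `c_0 c_1 …` followed by the polynomial `g`. -/
noncomputable def cat : List (Finset (Fin k)) → Pol k →ₗ[ZMod 2] Pol k
  | [] => LinearMap.id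
  | c :: w => cons c ∘ₗ cat w

@[simp] lemma cat_nil (g : Pol k) : cat [] g = g := rfl

@[simp] lemma cat_cons (c : Finset (Fin k)) (w : List (Finset (Fin k))) (g : Pol k) :
    cat (c :: w) g = cons c (cat w g) := rfl

lemma cat_append (w w' : List (Finset (Fin k))) (g : Pol k) :
    cat (w ++ w') g = cat w (cat w' g) := by
  induction w with
  | nil => rfl
  | cons c w ih => simp [ih]

/-- The weight of a word. -/
def wt (w : List (Finset (Fin k))) : List ℕ := w.map Finset.card

@[simp] lemma wt_nil : wt ([] : List (Finset (Fin k))) = [] := rfl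

@[simp] lemma wt_cons (c : Finset (Fin k)) (w : List (Finset (Fin k))) :
    wt (c :: w) = c.card :: wt w := rfl

lemma wt_append (w w' : List (Finset (Fin k))) : wt (w ++ w') = wt w ++ wt w' :=
  List.map_append

/-- Polynomials all of whose monomials have weight vector lexicographically below `τ`. -/
inductive Low : List ℕ → Pol k → Prop
  | head {a : ℕ} {τ : List ℕ} {c : Finset (Fin k)} (h : c.card < a) (g : Pol k) :
      Low (a :: τ) (cons c g)
  | tail {τ : List ℕ} (c : Finset (Fin k)) {g : Pol k} (h : Low τ g) :
      Low (c.card :: τ) (cons c g)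

/-- Hit polynomials plus polynomials of lower weight. -/
noncomputable def N (k : ℕ) (τ : List ℕ) : Submodule (ZMod 2) (Pol k) :=
  hitSubmodule k ⊔ Submodule.span (ZMod 2) {f | Low τ f}

lemma hit_le_N (τ : List ℕ) : hitSubmodule k ≤ N k τ := le_sup_left

lemma Low.mem_N {τ : List ℕ} {f : Pol k} (h : Low τ f) : f ∈ N k τ :=
  (le_sup_right : _ ≤ N k τ) (Submodule.subset_span h)

lemma cons_mem_N_of_lt {a : ℕ} {τ : List ℕ} {c : Finset (Fin k)} (h : c.card < a) (g : Pol k) :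
    cons c g ∈ N k (a :: τ) := (Low.head h g).mem_N

lemma Low.append {τ : List ℕ} {f : Pol k} (h : Low τ f) (σ : List ℕ) : Low (τ ++ σ) f := by
  induction h with
  | head h g => exact Low.head h g
  | tail c _ ih => exact Low.tail c ih

lemma N_le_append (τ σ : List ℕ) : N k τ ≤ N k (τ ++ σ) :=
  sup_le (hit_le_N _) (Submodule.span_le.mpr fun _ h => (Low.append h σ).mem_N)

lemma cons_mem_N {τ : List ℕ} {f : Pol k} (c : Finset (Fin k)) (hf : f ∈ N k τ) :
    cons c f ∈ N k (c.card :: τ) := by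
  suffices h : N k τ ≤ (N k (c.card :: τ)).comap (cons c) from h hf
  refine sup_le (hit_induction fun i h hi => ?_)
    (Submodule.span_le.mpr fun f hf => (Low.tail c hf).mem_N)
  have h1 := sq_sqfree_mul c h (2 * i)
  rw [← Finset.add_sum_erase _ _ (Finset.empty_mem_powerset c)] at h1
  have h2 : cons c (sq i h) = sq (2 * i) (sqfree c * h ^ 2) -
      ∑ T ∈ c.powerset.erase ∅, sqfree (c \ T) * sqfree T ^ 2 *
      (if T.card ≤ 2 * i ∧ 2 ∣ 2 * i - T.card then sq ((2 * i - T.card) / 2) h ^ 2 else 0) := by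
    rw [h1, cons_apply]
    simp [sqfree]
  rw [Submodule.mem_comap, h2]
  refine Submodule.sub_mem _ (hit_le_N _ (sq_mem_hit (by omega) _))
    (Submodule.sum_mem _ fun T hT => ?_)
  rw [Finset.mem_erase, Finset.mem_powerset] at hT
  split_ifs
  · rw [mul_assoc, ← mul_pow]
    refine cons_mem_N_of_lt (c := c \ T) (Finset.card_lt_card ?_) _
    refine (Finset.ssubset_iff_subset_ne).mpr ⟨Finset.sdiff_subset, fun h => hT.1 ?_⟩
    rw [Finset.sdiff_eq_self_iff_disjoint] at h
    exact Finset.disjoint_self_iff_empty T |>.mp (h.mono_left hT.2)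
  · simp

lemma cat_mem_N {τ : List ℕ} {f : Pol k} (w : List (Finset (Fin k))) (hf : f ∈ N k τ) :
    cat w f ∈ N k (wt w ++ τ) := by
  induction w with
  | nil => exact hf
  | cons c w ih => exact cons_mem_N c ih

/-- The value of a weight vector in base `k + 1`, most significant entry first. -/
def val (k : ℕ) : List ℕ → ℕ
  | [] => 0
  | a :: τ => a * (k + 1) ^ τ.length + val k τ

/-- The set of variables with odd exponent. -/
def oddPart (e : Fin k →₀ ℕ) : Finset (Fin k) := Finset.univ.filter fun j => e j % 2 = 1

/-- The exponent vector halved (rounding down). -/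
noncomputable def half (e : Fin k →₀ ℕ) : Fin k →₀ ℕ := e.mapRange (· / 2) rfl

/-- The first `L` letters of the word of a monomial. -/
noncomputable def wordOf : ℕ → (Fin k →₀ ℕ) → List (Finset (Fin k))
  | 0, _ => []
  | L + 1, e => oddPart e :: wordOf L (half e)

lemma length_wordOf (L : ℕ) (e : Fin k →₀ ℕ) : (wordOf L e).length = L := by
  induction L generalizing e with
  | zero => rfl
  | succ L ih => simp [wordOf, ih]

lemma sqfree_eq_monomial (c : Finset (Fin k)) :
    sqfree c = monomial (∑ j ∈ c, Finsupp.single j 1) (1 : ZMod 2) := by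
  rw [sqfree, monomial_sum_one]
  rfl

lemma cons_monomial (c : Finset (Fin k)) (e : Fin k →₀ ℕ) :
    cons c (monomial e 1) = monomial ((∑ j ∈ c, Finsupp.single j 1) + 2 • e) (1 : ZMod 2) := by
  rw [cons_apply, sqfree_eq_monomial, monomial_pow, monomial_mul]
  simp

lemma sum_single_apply (c : Finset (Fin k)) (i : Fin k) :
    (∑ j ∈ c, Finsupp.single j 1 : Fin k →₀ ℕ) i = if i ∈ c then 1 else 0 := by
  rw [Finsupp.finsetSum_apply]
  simp [Finsupp.single_apply]

lemma oddPart_cons (c : Finset (Fin k)) (e : Fin k →₀ ℕ) :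
    oddPart ((∑ j ∈ c, Finsupp.single j 1) + 2 • e) = c := by
  ext i
  simp only [oddPart, Finset.mem_filter, Finset.mem_univ, true_and, Finsupp.add_apply,
    sum_single_apply, Finsupp.smul_apply, smul_eq_mul]
  split_ifs with h <;> simp [h, Nat.add_mod]

lemma half_cons (c : Finset (Fin k)) (e : Fin k →₀ ℕ) :
    half ((∑ j ∈ c, Finsupp.single j 1) + 2 • e) = e := by
  ext i
  simp only [half, Finsupp.mapRange_apply, Finsupp.add_apply, sum_single_apply,
    Finsupp.smul_apply, smul_eq_mul]
  split_ifs <;> omega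

lemma cons_oddPart_half (e : Fin k →₀ ℕ) :
    (∑ j ∈ oddPart e, Finsupp.single j 1) + 2 • half e = e := by
  ext i
  simp only [half, oddPart, Finsupp.mapRange_apply, Finsupp.add_apply, sum_single_apply,
    Finsupp.smul_apply, smul_eq_mul, Finset.mem_filter, Finset.mem_univ, true_and]
  split_ifs <;> omega

lemma degree_cons (c : Finset (Fin k)) (e : Fin k →₀ ℕ) :
    ((∑ j ∈ c, Finsupp.single j 1) + 2 • e).degree = c.card + 2 * e.degree := by
  simp [map_add, map_sum]

lemma val_lt (τ : List ℕ) (h : ∀ a ∈ τ, a ≤ k) : val k τ < (k + 1) ^ τ.length := by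
  induction τ with
  | nil => simp [val]
  | cons a τ ih =>
    have h1 := ih fun b hb => h b (by simp [hb])
    have h2 := h a (by simp)
    simp only [val, List.length_cons, pow_succ]
    nlinarith [pow_pos (Nat.succ_pos k) τ.length]

lemma val_wordOf_lt (L : ℕ) (e : Fin k →₀ ℕ) : val k (wt (wordOf L e)) < (k + 1) ^ L := by
  have := val_lt (k := k) (wt (wordOf L e)) (by
    intro a ha
    obtain ⟨c, -, rfl⟩ := List.mem_map.mp ha
    simpa using Finset.card_le_univ c)
  simpa [wt, length_wordOf] using this

/-- The span of the monomials whose weight has value less than `v`. -/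
noncomputable def lowSpan (k L v : ℕ) : Submodule (ZMod 2) (Pol k) :=
  Submodule.span (ZMod 2) ((fun e => monomial e 1) '' {e | val k (wt (wordOf L e)) < v})

lemma monomial_induction {p : Submodule (ZMod 2) (Pol k)} (h : ∀ e, monomial e 1 ∈ p)
    (f : Pol k) : f ∈ p := by
  rw [f.as_sum]
  refine Submodule.sum_mem _ fun e _ => ?_
  have h1 : monomial e (coeff e f) = coeff e f • monomial e (1 : ZMod 2) := by
    rw [smul_monomial]; simp
  rw [h1]
  exact p.smul_mem _ (h e)

lemma Low.mem_lowSpan {τ : List ℕ} {f : Pol k} (h : Low τ f) :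
    f ∈ lowSpan k τ.length (val k τ) := by
  induction h with
  | @head a τ c h g =>
    refine monomial_induction (p := (lowSpan k _ _).comap (cons c)) (fun e => ?_) g
    rw [Submodule.mem_comap, cons_monomial]
    refine Submodule.subset_span ⟨_, ?_, rfl⟩
    have := val_wordOf_lt τ.length e
    simp only [List.length_cons, Set.mem_ofPred_eq, wordOf, oddPart_cons, half_cons, wt_cons, val]
    simp only [wt, List.length_map, length_wordOf] at this ⊢
    nlinarith
  | @tail τ c g _ ih =>
    suffices h : lowSpan k τ.length (val k τ) ≤ (lowSpan k _ _).comap (cons c) from h ih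
    refine Submodule.span_le.mpr ?_
    rintro _ ⟨e, he, rfl⟩
    rw [SetLike.mem_coe, Submodule.mem_comap, cons_monomial]
    refine Submodule.subset_span ⟨_, ?_, rfl⟩
    simp only [List.length_cons, Set.mem_ofPred_eq, wordOf, oddPart_cons, half_cons, wt_cons, val]
    simp only [wt, List.length_map, length_wordOf, Set.mem_ofPred_eq] at he ⊢
    omega

/-- The degree of a word. -/
def ev : List ℕ → ℕ
  | [] => 0
  | a :: τ => a + 2 * ev τ

lemma cat_wordOf {L : ℕ} {e : Fin k →₀ ℕ} (h : e.degree < 2 ^ L) :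
    cat (wordOf L e) 1 = monomial e (1 : ZMod 2) ∧ ev (wt (wordOf L e)) = e.degree := by
  induction L generalizing e with
  | zero =>
    have h0 : e.degree = 0 := by simpa using h
    have h1 : e = 0 := (Finsupp.degree_eq_zero_iff e).mp h0
    subst h1
    simp [wordOf, ev]
  | succ L ih =>
    have hd := degree_cons (oddPart e) (half e)
    rw [cons_oddPart_half] at hd
    obtain ⟨h1, h2⟩ := ih (e := half e) (by rw [pow_succ] at h; omega)
    refine ⟨?_, ?_⟩
    · rw [wordOf, cat_cons, h1, cons_monomial, cons_oddPart_half]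
    · rw [wordOf, wt_cons, ev, h2, hd]

/-- If every word of degree `n` reduces to `G` modulo hits and lower weights, then every
polynomial of degree `n` reduces to `G` modulo hits. -/
lemma mem_of_words {L n : ℕ} (hn : n < 2 ^ L) {G : Submodule (ZMod 2) (Pol k)}
    (hG : G ≤ homogeneousSubmodule (Fin k) (ZMod 2) n)
    (h : ∀ w : List (Finset (Fin k)), w.length = L → ev (wt w) = n →
      cat w 1 ∈ N k (wt w) ⊔ G)
    {f : Pol k} (hf : f.IsHomogeneous n) : f ∈ hitSubmodule k ⊔ G := by
  have key : ∀ v, ∀ e : Fin k →₀ ℕ, e.degree = n → val k (wt (wordOf L e)) = v →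
      monomial e 1 ∈ hitSubmodule k ⊔ G := by
    intro v
    induction v using Nat.strong_induction_on with
    | _ v ih =>
      intro e he hv
      obtain ⟨h1, h2⟩ := cat_wordOf (L := L) (e := e) (he ▸ hn)
      have h3 := h _ (length_wordOf L e) (h2.trans he)
      rw [h1] at h3
      have h4 : ∀ f ∈ N k (wt (wordOf L e)) ⊔ G,
          homogeneousComponent n f ∈ hitSubmodule k ⊔ G := by
        suffices hs : N k (wt (wordOf L e)) ⊔ G ≤
          (hitSubmodule k ⊔ G).comap (homogeneousComponent n) from fun f hf => hs hf
        refine sup_le (sup_le (fun f hf => ?_) (Submodule.span_le.mpr fun f hf => ?_))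
          (fun f hf => ?_)
        · exact (le_sup_left : _ ≤ hitSubmodule k ⊔ G) (homogeneousComponent_mem_hit hf n)
        · have hl := Low.mem_lowSpan hf
          simp only [wt, List.length_map, length_wordOf] at hl
          change f ∈ (hitSubmodule k ⊔ G).comap (homogeneousComponent n)
          suffices hs : lowSpan k L _ ≤
            (hitSubmodule k ⊔ G).comap (homogeneousComponent n) from hs hl
          refine Submodule.span_le.mpr ?_
          rintro _ ⟨e', he', rfl⟩
          rw [SetLike.mem_coe, Submodule.mem_comap,
            homogeneousComponent_of_mem (isHomogeneous_monomial (n := e'.degree) _ rfl)]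
          split_ifs with hd
          · exact ih _ (hv ▸ he') e' hd.symm rfl
          · exact zero_mem _
        · rw [Submodule.mem_comap, homogeneousComponent_of_mem (hG hf), if_pos rfl]
          exact (le_sup_right : _ ≤ hitSubmodule k ⊔ G) hf
      have h5 := h4 _ h3
      rwa [homogeneousComponent_of_mem (isHomogeneous_monomial (n := n) _ he), if_pos rfl] at h5
  rw [f.as_sum]
  refine Submodule.sum_mem _ fun e he => ?_
  have h1 : monomial e (coeff e f) = coeff e f • monomial e (1 : ZMod 2) := by
    rw [smul_monomial]; simp
  have h2 : e.degree = n := by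
    have := hf (mem_support_iff.mp he)
    rwa [Finsupp.degree_eq_weight_one]
  rw [h1]
  exact Submodule.smul_mem _ _ (key _ e h2 rfl)

lemma cons_isHomogeneous (c : Finset (Fin k)) {g : Pol k} {d : ℕ} (hg : g.IsHomogeneous d) :
    (cons c g).IsHomogeneous (c.card + 2 * d) := by
  rw [cons_apply, mul_comm 2 d]
  refine IsHomogeneous.mul ?_ (hg.pow 2)
  rw [sqfree, Finset.card_eq_sum_ones]
  exact IsHomogeneous.prod _ _ _ fun j _ => isHomogeneous_X _ _

lemma cat_isHomogeneous (w : List (Finset (Fin k))) : (cat w 1).IsHomogeneous (ev (wt w)) := by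
  induction w with
  | nil => exact isHomogeneous_one _ _
  | cons c w ih => exact cons_isHomogeneous c ih

end Words

section Rules

variable {k : ℕ}

lemma mem_of_functional {p : Submodule (ZMod 2) (Pol k)} {x : Pol k}
    (h : ∀ ψ : Pol k →ₗ[ZMod 2] ZMod 2, (∀ y ∈ p, ψ y = 0) → ψ x = 0) : x ∈ p := by
  by_contra hx
  obtain ⟨ψ, h1, h2⟩ := Submodule.exists_le_ker_of_notMem hx
  exact h1 (h ψ fun y hy => h2 hy)

lemma X_mul_cat_replicate {C : Finset (Fin k)} {j : Fin k} (hj : j ∈ C) (m : ℕ) (f : Pol k) :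
    X j * cat (List.replicate m C) f = cat (List.replicate m (C.erase j)) (X j * f) := by
  induction m with
  | zero => rfl
  | succ m ih =>
    rw [List.replicate_succ, List.replicate_succ, cat_cons, cat_cons, ← ih, cons_apply,
      cons_apply, sqfree, sqfree, ← Finset.mul_prod_erase C X hj]
    ring

/-- The relation coming from `Sq^1`. -/
lemma sq_one_mem (m : ℕ) (C D : Finset (Fin k)) (g : Pol k) :
    ∑ j ∈ C \ D, cat (List.replicate (m + 1) (C.erase j)) (cons (insert j D) g) ∈
      N k (List.replicate (m + 1) (C.card - 1) ++ [D.card + 1]) := by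
  have h1 : ∀ j ∈ C, sqfree (C \ {j}) * (X j * cat (List.replicate m C) (cons D g)) ^ 2 =
      cat (List.replicate (m + 1) (C.erase j)) (X j * cons D g) := by
    intro j hj
    rw [X_mul_cat_replicate hj, Finset.sdiff_singleton_eq_erase, List.replicate_succ]
    rfl
  have h := sq_one_rule C (cat (List.replicate m C) (cons D g))
  rw [Finset.sum_congr rfl h1,
    ← Finset.sum_sdiff (Finset.inter_subset_left : C ∩ D ⊆ C)] at h
  have h2 : ∑ j ∈ C ∩ D, cat (List.replicate (m + 1) (C.erase j)) (X j * cons D g) ∈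
      N k (List.replicate (m + 1) (C.card - 1) ++ [D.card + 1]) := by
    refine Submodule.sum_mem _ fun j hj => ?_
    obtain ⟨hC, hD⟩ := Finset.mem_inter.mp hj
    have h3 : X j * cons D g = cons (D.erase j) (X j * g) := by
      rw [cons_apply, cons_apply, sqfree, sqfree, ← Finset.mul_prod_erase D X hD]
      ring
    have h5 : (D.erase j).card < D.card + 1 := by
      rw [Finset.card_erase_of_mem hD]; omega
    have h4 := cat_mem_N (List.replicate (m + 1) (C.erase j))
      (cons_mem_N_of_lt (τ := []) h5 (X j * g))
    rw [h3]
    rwa [wt, List.map_replicate, Finset.card_erase_of_mem hC] at h4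
  have h6 := Submodule.sub_mem _ (hit_le_N _ h) h2
  rw [add_sub_cancel_right, Finset.sdiff_inter_self_left] at h6
  convert h6 using 2 with j hj
  congr 1
  rw [cons_apply, cons_apply, sqfree, sqfree, Finset.prod_insert (Finset.mem_sdiff.mp hj).2]
  ring

/-- The relation coming from `Sq^2`. -/
lemma sq_two_mem (C : Finset (Fin k)) (τ : List ℕ) (g : Pol k) :
    ∑ T ∈ C.powersetCard 2, cat [C \ T, T] g ∈ N k τ :=
  hit_le_N _ (sq_two_rule C g)

end Rules

section Four

lemma adjacent_or_opposite : ∀ c d : Finset (Fin 4), c.card = d.card → c ≠ d →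
    (∃ a b, a ≠ b ∧ a ∉ c ∩ d ∧ b ∉ c ∩ d ∧ c = insert a (c ∩ d) ∧ d = insert b (c ∩ d)) ∨
      (c.card = 2 ∧ d = cᶜ) := by
  decide +kernel

/-- A functional vanishing on hits and on lower weights. -/
def Kills (ψ : Pol 4 →ₗ[ZMod 2] ZMod 2) (τ : List ℕ) : Prop := ∀ f ∈ N 4 τ, ψ f = 0

variable {ψ : Pol 4 →ₗ[ZMod 2] ZMod 2} {τ : List ℕ}

lemma Kills.sq_one (C D : Finset (Fin 4)) (h : Kills ψ [C.card - 1, D.card + 1]) (g : Pol 4) :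
    ∑ j ∈ C \ D, ψ (cat [C.erase j, insert j D] g) = 0 := by
  rw [← map_sum]
  exact h _ (sq_one_mem 0 C D g)

lemma Kills.sq_two (C : Finset (Fin 4)) (h : Kills ψ τ) (g : Pol 4) :
    ∑ T ∈ C.powersetCard 2, ψ (cat [C \ T, T] g) = 0 := by
  rw [← map_sum]
  exact h _ (sq_two_mem C τ g)

lemma Kills.of_append {σ : List ℕ} (h : Kills ψ (τ ++ σ)) : Kills ψ τ :=
  fun f hf => h f (N_le_append τ σ hf)

lemma Kills.comp_cat {w : List (Finset (Fin 4))} (h : Kills ψ (wt w ++ τ)) :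
    Kills (ψ ∘ₗ cat w) τ :=
  fun _ hf => h _ (cat_mem_N w hf)

/-- Adjacent letters commute. -/
lemma Kills.comm_adjacent {a b : Fin 4} {I : Finset (Fin 4)} (hab : a ≠ b) (ha : a ∉ I)
    (hb : b ∉ I) (h : Kills ψ [I.card + 1, I.card + 1]) (g : Pol 4) :
    ψ (cat [insert a I, insert b I] g) = ψ (cat [insert b I, insert a I] g) := by
  have h1 : (insert a (insert b I)).card = I.card + 2 := by
    rw [Finset.card_insert_of_notMem (by simp [hab, ha]), Finset.card_insert_of_notMem hb]
  have h2 := Kills.sq_one (insert a (insert b I)) I (by rw [h1]; exact h) g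
  have h3 : insert a (insert b I) \ I = {a, b} := by
    ext x; simp only [Finset.mem_sdiff, Finset.mem_insert, Finset.mem_singleton]
    constructor
    · tauto
    · rintro (rfl | rfl) <;> tauto
  have h4 : (insert a (insert b I)).erase b = insert a I := by
    rw [Finset.insert_comm, Finset.erase_insert (by simp [hab.symm, hb])]
  rw [h3, Finset.sum_pair hab, Finset.erase_insert (by simp [hab, ha]), h4] at h2
  grind

lemma compl_pair_relations (h : Kills ψ [2, 2]) (g : Pol 4) :
    (∀ c : Finset (Fin 4), c.card = 2 → ψ (cat [c, cᶜ] g) = ψ (cat [cᶜ, c] g)) ∧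
    ψ (cat [{0, 1}, {2, 3}] g) + ψ (cat [{0, 2}, {1, 3}] g) + ψ (cat [{0, 3}, {1, 2}] g) = 0 := by
  have r0 := Kills.sq_one (ψ := ψ) {0, 1, 2} {3} h g
  have r1 := Kills.sq_one (ψ := ψ) {0, 1, 3} {2} h g
  have r2 := Kills.sq_one (ψ := ψ) {0, 2, 3} {1} h g
  have r3 := Kills.sq_one (ψ := ψ) {1, 2, 3} {0} h g
  have r4 := Kills.sq_two (Finset.univ : Finset (Fin 4)) h g
  rw [show ({0, 1, 2} : Finset (Fin 4)) \ {3} = {0, 1, 2} by decide,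
    Finset.sum_insert (by decide), Finset.sum_pair (by decide),
    show ({0, 1, 2} : Finset (Fin 4)).erase 0 = {1, 2} by decide,
    show ({0, 1, 2} : Finset (Fin 4)).erase 1 = {0, 2} by decide,
    show ({0, 1, 2} : Finset (Fin 4)).erase 2 = {0, 1} by decide] at r0
  rw [show ({0, 1, 3} : Finset (Fin 4)) \ {2} = {0, 1, 3} by decide,
    Finset.sum_insert (by decide), Finset.sum_pair (by decide),
    show ({0, 1, 3} : Finset (Fin 4)).erase 0 = {1, 3} by decide,
    show ({0, 1, 3} : Finset (Fin 4)).erase 1 = {0, 3} by decide,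
    show ({0, 1, 3} : Finset (Fin 4)).erase 3 = {0, 1} by decide,
    show ({3, 2} : Finset (Fin 4)) = {2, 3} by decide] at r1
  rw [show ({0, 2, 3} : Finset (Fin 4)) \ {1} = {0, 2, 3} by decide,
    Finset.sum_insert (by decide), Finset.sum_pair (by decide),
    show ({0, 2, 3} : Finset (Fin 4)).erase 0 = {2, 3} by decide,
    show ({0, 2, 3} : Finset (Fin 4)).erase 2 = {0, 3} by decide,
    show ({2, 1} : Finset (Fin 4)) = {1, 2} by decide,
    show ({0, 2, 3} : Finset (Fin 4)).erase 3 = {0, 2} by decide,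
    show ({3, 1} : Finset (Fin 4)) = {1, 3} by decide] at r2
  rw [show ({1, 2, 3} : Finset (Fin 4)) \ {0} = {1, 2, 3} by decide,
    Finset.sum_insert (by decide), Finset.sum_pair (by decide),
    show ({1, 2, 3} : Finset (Fin 4)).erase 1 = {2, 3} by decide,
    show ({1, 0} : Finset (Fin 4)) = {0, 1} by decide,
    show ({1, 2, 3} : Finset (Fin 4)).erase 2 = {1, 3} by decide,
    show ({2, 0} : Finset (Fin 4)) = {0, 2} by decide,
    show ({1, 2, 3} : Finset (Fin 4)).erase 3 = {1, 2} by decide,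
    show ({3, 0} : Finset (Fin 4)) = {0, 3} by decide] at r3
  rw [show (Finset.univ : Finset (Fin 4)).powersetCard 2 =
    {{0, 1}, {0, 2}, {0, 3}, {1, 2}, {1, 3}, {2, 3}} by decide,
    Finset.sum_insert (by decide), Finset.sum_insert (by decide), Finset.sum_insert (by decide),
    Finset.sum_insert (by decide), Finset.sum_pair (by decide),
    show (Finset.univ : Finset (Fin 4)) \ {0, 1} = {2, 3} by decide,
    show (Finset.univ : Finset (Fin 4)) \ {0, 2} = {1, 3} by decide,
    show (Finset.univ : Finset (Fin 4)) \ {0, 3} = {1, 2} by decide,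
    show (Finset.univ : Finset (Fin 4)) \ {1, 2} = {0, 3} by decide,
    show (Finset.univ : Finset (Fin 4)) \ {1, 3} = {0, 2} by decide,
    show (Finset.univ : Finset (Fin 4)) \ {2, 3} = {0, 1} by decide] at r4
  refine ⟨fun c hc => ?_, by grind⟩
  have hc' : c = {0, 1} ∨ c = {0, 2} ∨ c = {0, 3} ∨ c = {1, 2} ∨ c = {1, 3} ∨ c = {2, 3} := by
    revert c; decide
  rcases hc' with rfl | rfl | rfl | rfl | rfl | rfl
  · rw [show ({0, 1} : Finset (Fin 4))ᶜ = {2, 3} by decide]; grind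
  · rw [show ({0, 2} : Finset (Fin 4))ᶜ = {1, 3} by decide]; grind
  · rw [show ({0, 3} : Finset (Fin 4))ᶜ = {1, 2} by decide]; grind
  · rw [show ({1, 2} : Finset (Fin 4))ᶜ = {0, 3} by decide]; grind
  · rw [show ({1, 3} : Finset (Fin 4))ᶜ = {0, 2} by decide]; grind
  · rw [show ({2, 3} : Finset (Fin 4))ᶜ = {0, 1} by decide]; grind

/-- Letters of equal size commute. -/
lemma Kills.comm {c d : Finset (Fin 4)} (hcd : c.card = d.card) (h : Kills ψ [c.card, d.card])
    (g : Pol 4) : ψ (cat [c, d] g) = ψ (cat [d, c] g) := by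
  rcases eq_or_ne c d with rfl | hne
  · rfl
  rcases adjacent_or_opposite c d hcd hne with ⟨a, b, hab, ha, hb, hc, hd⟩ | ⟨h2, rfl⟩
  · have hc' : c.card = (c ∩ d).card + 1 := by
      conv_lhs => rw [hc]
      exact Finset.card_insert_of_notMem ha
    rw [← hcd, hc'] at h
    have := h.comm_adjacent hab ha hb g
    rwa [← hc, ← hd] at this
  · rw [← hcd, h2] at h
    exact (compl_pair_relations h g).1 c h2

lemma Kills.pluecker (h : Kills ψ [2, 2]) (g : Pol 4) :
    ψ (cat [{0, 1}, {2, 3}] g) + ψ (cat [{0, 2}, {1, 3}] g) + ψ (cat [{0, 3}, {1, 2}] g) = 0 :=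
  (compl_pair_relations h g).2

/-- A letter strictly contained in the next one gives zero. -/
lemma Kills.subset_eq_zero {c d : Finset (Fin 4)} (hcd : c ⊂ d) (h : Kills ψ [c.card, d.card])
    (g : Pol 4) : ψ (cat [c, d] g) = 0 := by
  have hs : c ⊆ d := hcd.1
  obtain ⟨j, hjd, hjc⟩ := Finset.exists_of_ssubset hcd
  have h1 : (insert j c).card - 1 = c.card := by rw [Finset.card_insert_of_notMem hjc]; rfl
  have h2 : (d.erase j).card + 1 = d.card := Finset.card_erase_add_one hjd
  have h3 := Kills.sq_one (insert j c) (d.erase j) (by rw [h1, h2]; exact h) g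
  have h4 : insert j c \ d.erase j = {j} := by
    ext x
    have := @hs x
    simp only [Finset.mem_sdiff, Finset.mem_insert, Finset.mem_erase, Finset.mem_singleton]
    tauto
  rwa [h4, Finset.sum_singleton, Finset.erase_insert hjc, Finset.insert_erase hjd] at h3

end Four

section Patterns

variable {ψ : Pol 4 →ₗ[ZMod 2] ZMod 2} {τ : List ℕ}

/-- The complement of a single variable. -/
def co (a : Fin 4) : Finset (Fin 4) := Finset.univ.erase a

lemma card_co (a : Fin 4) : (co a).card = 3 := by revert a; decide

lemma eq_co_of_card : ∀ c : Finset (Fin 4), c.card = 3 → ∃ a, c = co a := by decide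

lemma Kills.swap {C D : Finset (Fin 4)} {a b : Fin 4} (hab : a ≠ b) (hS : C \ D = {a, b})
    (h : Kills ψ [C.card - 1, D.card + 1]) (g : Pol 4) :
    ψ (cat [C.erase a, insert a D] g) = ψ (cat [C.erase b, insert b D] g) := by
  have := Kills.sq_one C D h g
  rw [hS, Finset.sum_pair hab] at this
  grind

/-- Adjacent letters are idempotent. -/
lemma Kills.idem_adjacent {a b : Fin 4} {I : Finset (Fin 4)} (hab : a ≠ b) (ha : a ∉ I)
    (hb : b ∉ I) (h : Kills ψ [I.card + 1, I.card + 1, I.card + 1]) (g : Pol 4) :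
    ψ (cat [insert a I, insert a I, insert b I] g) =
      ψ (cat [insert a I, insert b I, insert b I] g) := by
  have hca : (insert a I).card = I.card + 1 := Finset.card_insert_of_notMem ha
  have hcb : (insert b I).card = I.card + 1 := Finset.card_insert_of_notMem hb
  have h1 : (insert a (insert b I)).card = I.card + 2 := by
    rw [Finset.card_insert_of_notMem (by simp [hab, ha]), hcb]
  have h0 := sq_one_mem 1 (insert a (insert b I)) I g
  rw [h1] at h0
  have h2 := h _ h0
  have h3 : insert a (insert b I) \ I = {a, b} := by
    ext x; simp only [Finset.mem_sdiff, Finset.mem_insert, Finset.mem_singleton]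
    constructor
    · tauto
    · rintro (rfl | rfl) <;> tauto
  have h4 : (insert a (insert b I)).erase b = insert a I := by
    rw [Finset.insert_comm, Finset.erase_insert (by simp [hab.symm, hb])]
  rw [h3, map_sum, Finset.sum_pair hab, Finset.erase_insert (by simp [hab, ha]), h4] at h2
  simp only [List.replicate_succ, List.replicate_zero, cat_cons, cat_nil] at h2
  have c1 := (Kills.comp_cat (w := [insert b I]) (τ := [I.card + 1, I.card + 1])
    (by simpa [hcb] using h)).comm_adjacent hab ha hb g
  have c2 := (Kills.of_append (τ := [I.card + 1, I.card + 1]) (σ := [I.card + 1])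
    h).comm_adjacent hab ha hb (cons (insert b I) g)
  simp only [LinearMap.comp_apply, cat_cons, cat_nil] at c1 c2 ⊢
  grind

lemma Kills.incidence_three_one (h : Kills ψ [3, 1]) (g : Pol 4) :
    ∑ e, ψ (cat [co e, {e}] g) = 0 := by
  simpa [co] using Kills.sq_one Finset.univ ∅ h g

lemma Kills.incidence_three_two (i : Fin 4) (h : Kills ψ [3, 2]) (g : Pol 4) :
    ∑ e ∈ Finset.univ.erase i, ψ (cat [co e, {e, i}] g) = 0 := by
  have := Kills.sq_one Finset.univ {i} h g
  rwa [Finset.sdiff_singleton_eq_erase] at this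

lemma Kills.incidence_two_one {a b c : Fin 4} (hab : a ≠ b) (hac : a ≠ c) (hbc : b ≠ c)
    (h : Kills ψ [2, 1]) (g : Pol 4) :
    ψ (cat [{b, c}, {a}] g) + ψ (cat [{a, c}, {b}] g) + ψ (cat [{a, b}, {c}] g) = 0 := by
  have sets : ∀ a b c : Fin 4, a ≠ b → a ≠ c → b ≠ c → ({a, b, c} : Finset (Fin 4)).card = 3 ∧
    ({a, b, c} : Finset (Fin 4)).erase a = {b, c} ∧ ({a, b, c} : Finset (Fin 4)).erase b = {a, c} ∧
    ({a, b, c} : Finset (Fin 4)).erase c = {a, b} := by decide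
  obtain ⟨e0, e1, e2, e3⟩  := sets a b c hab hac hbc
  have := Kills.sq_one {a, b, c} ∅ (by rw [e0]; exact h) g
  rw [Finset.sdiff_empty, Finset.sum_insert (by simp [hab, hac]), Finset.sum_pair hbc, e1, e2, e3]
    at this
  simpa [add_assoc] using this

lemma Kills.one_two {c d : Finset (Fin 4)} (hc : c.card = 1) (hd : d.card = 2)
    (h : Kills ψ [1, 2]) (g : Pol 4) : ψ (cat [c, d] g) = 0 := by
  obtain ⟨a, rfl⟩ := Finset.card_eq_one.mp hc
  obtain ⟨b, e, hbe, rfl⟩ := Finset.card_eq_two.mp hd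
  by_cases hs : a ∈ ({b, e} : Finset (Fin 4))
  · refine Kills.subset_eq_zero ?_ (by rw [hc, hd]; exact h) g
    rw [Finset.ssubset_iff_subset_ne]
    refine ⟨by simpa using hs, fun h => ?_⟩
    rw [h] at hc; omega
  have hab : a ≠ b := by rintro rfl; simp at hs
  have hae : a ≠ e := by rintro rfl; simp at hs
  have sets : ∀ a b e : Fin 4, a ≠ b → a ≠ e → b ≠ e →
      ({a, b} : Finset (Fin 4)) \ {e} = {a, b} ∧ ({a, b} : Finset (Fin 4)).erase a = {b} ∧
      ({a, b} : Finset (Fin 4)).erase b = {a} ∧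
      ({a, b, e} : Finset (Fin 4)).powersetCard 2 = {{b, e}, {a, e}, {a, b}} ∧
      ({a, b, e} : Finset (Fin 4)) \ {b, e} = {a} ∧ ({a, b, e} : Finset (Fin 4)) \ {a, e} = {b} ∧
      ({a, b, e} : Finset (Fin 4)) \ {a, b} = {e} ∧ ({e, b} : Finset (Fin 4)) = {b, e} ∧
      ({b, e} : Finset (Fin 4)) ∉ ({{a, e}, {a, b}} : Finset (Finset (Fin 4))) ∧
      ({a, e} : Finset (Fin 4)) ≠ {a, b} := by decide
  obtain ⟨x1, x2, x3, x4, x5, x6, x7, x8, x9, x10⟩  := sets a b e hab hae hbe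
  obtain ⟨y1, y2, y3, -, -, -, -, y8, -⟩  := sets a e b hae hab hbe.symm
  have r1 := Kills.swap hab x1 (by rw [Finset.card_pair hab]; exact h) g
  have r2 := Kills.swap hae y1 (by rw [Finset.card_pair hae]; exact h) g
  have r3 := Kills.sq_two {a, b, e} h g
  rw [x4, Finset.sum_insert x9, Finset.sum_pair x10, x5, x6, x7] at r3
  rw [x2, x3] at r1
  rw [y2, y3, ← y8] at r2
  grind

end Patterns

section DeadPatterns

variable {ψ : Pol 4 →ₗ[ZMod 2] ZMod 2} {τ : List ℕ}

lemma Kills.comp_cons {c : Finset (Fin 4)} {n : ℕ} (hc : c.card = n) (h : Kills ψ (n :: τ)) :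
    Kills (ψ ∘ₗ cons c) τ := by
  subst hc
  exact fun _ hf => h _ (cons_mem_N c hf)

lemma singleton_subset_or : ∀ (a b : Fin 4), {a} ⊂ co b ∨ a = b := by decide

lemma Kills.one_three_swap (a b : Fin 4) (h : Kills ψ [1, 3]) (g : Pol 4) :
    ψ (cat [{a}, co a] g) = ψ (cat [{b}, co b] g) := by
  rcases eq_or_ne a b with rfl | hab
  · rfl
  have sets : ∀ a b : Fin 4, a ≠ b → ({a, b} : Finset (Fin 4)) \ {a, b}ᶜ = {a, b} ∧
      ({a, b} : Finset (Fin 4))ᶜ.card = 2 ∧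
      ({a, b} : Finset (Fin 4)).erase a = {b} ∧ ({a, b} : Finset (Fin 4)).erase b = {a} ∧
      insert a ({a, b} : Finset (Fin 4))ᶜ = co b ∧
      insert b ({a, b} : Finset (Fin 4))ᶜ = co a := by decide
  obtain ⟨x1, x2, x3, x4, x5, x6⟩ := sets a b hab
  have r := Kills.swap hab x1 (by rw [Finset.card_pair hab, x2]; exact h) g
  rw [x3, x4, x5, x6] at r
  exact r.symm

lemma Kills.one_three_of_ne {a b : Fin 4} (hab : a ≠ b) (h : Kills ψ [1, 3]) (g : Pol 4) :
    ψ (cat [{a}, co b] g) = 0 :=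
  Kills.subset_eq_zero ((singleton_subset_or a b).resolve_right hab) (by rwa [card_co]) g

lemma Kills.one_one_three {c d e : Finset (Fin 4)} (hc : c.card = 1) (hd : d.card = 1)
    (he : e.card = 3) (h : Kills ψ [1, 1, 3]) (g : Pol 4) : ψ (cat [c, d, e] g) = 0 := by
  obtain ⟨a, rfl⟩ := Finset.card_eq_one.mp hc
  obtain ⟨b, rfl⟩ := Finset.card_eq_one.mp hd
  obtain ⟨z, rfl⟩ := eq_co_of_card e he
  have comm : ∀ a b z : Fin 4, ψ (cat [{a}, {b}, co z] g) = ψ (cat [{b}, {a}, co z] g) :=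
    fun a b z => Kills.comm (ψ := ψ) (c := {a}) (d := {b}) rfl
      (Kills.of_append (σ := [3]) h) (cons (co z) g)
  have dead : ∀ a b z : Fin 4, b ≠ z → ψ (cat [{a}, {b}, co z] g) = 0 := fun a b z hbz =>
    (Kills.comp_cons (c := {a}) (Finset.card_singleton a) h).one_three_of_ne hbz g
  by_cases hb : b = z
  · subst hb
    by_cases ha : a = b
    · subst ha
      obtain ⟨x, hx⟩ := exists_ne a
      have r : ψ (cat [{a}, {a}, co a] g) = ψ (cat [{a}, {x}, co x] g) :=
        (Kills.comp_cons (c := {a}) (Finset.card_singleton a) h).one_three_swap a x g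
      rw [r, comm]
      exact dead _ _ _ hx.symm
    · rw [comm]; exact dead _ _ _ ha
  · exact dead _ _ _ hb

lemma Kills.one_three_two {c d e : Finset (Fin 4)} (hc : c.card = 1) (hd : d.card = 3)
    (he : e.card = 2) (h : Kills ψ [1, 3, 2]) (g : Pol 4) : ψ (cat [c, d, e] g) = 0 := by
  obtain ⟨a, rfl⟩ := Finset.card_eq_one.mp hc
  obtain ⟨z, rfl⟩ := eq_co_of_card d hd
  obtain ⟨x, y, hxy, rfl⟩ := Finset.card_eq_two.mp he
  have h13 : Kills ψ [1, 3] := Kills.of_append (σ := [2]) h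
  by_cases haz : a = z
  · subst haz
    have r1 : ψ (cat [{a}, co a, {x, y}] g) = ψ (cat [{x}, co x, {x, y}] g) :=
      h13.one_three_swap a x (cons {x, y} g)
    rw [r1]
    have r2 := (Kills.comp_cons (c := {x}) (Finset.card_singleton x) h).incidence_three_two y g
    rw [Finset.sum_eq_single_of_mem x (by simp [hxy])] at r2
    · exact r2
    · intro b _ hb
      exact h13.one_three_of_ne hb.symm (cons {b, y} g)
  · exact h13.one_three_of_ne haz (cons {x, y} g)

lemma pair_subset_or : ∀ (a b z : Fin 4), a ≠ b → {a, b} ⊂ co z ∨ z = a ∨ z = b := by decide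

lemma Kills.two_three_eq_zero {a b z : Fin 4} (hab : a ≠ b) (hza : z ≠ a) (hzb : z ≠ b)
    (h : Kills ψ [2, 3]) (g : Pol 4) : ψ (cat [{a, b}, co z] g) = 0 := by
  refine Kills.subset_eq_zero ((pair_subset_or a b z hab).resolve_right (by tauto)) ?_ g
  rwa [card_co, Finset.card_pair hab]

lemma Kills.two_three_swap {a b g : Fin 4} (hag : a ≠ g) (hbg : b ≠ g)
    (h : Kills ψ [2, 3]) (f : Pol 4) :
    ψ (cat [{a, g}, co a] f) = ψ (cat [{b, g}, co b] f) := by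
  rcases eq_or_ne a b with rfl | hab
  · rfl
  have sets : ∀ a b g : Fin 4, a ≠ g → b ≠ g → a ≠ b →
      ({a, b, g} : Finset (Fin 4)) \ {a, b}ᶜ = {a, b} ∧
      ({a, b} : Finset (Fin 4))ᶜ.card = 2 ∧ ({a, b, g} : Finset (Fin 4)).card = 3 ∧
      ({a, b, g} : Finset (Fin 4)).erase a = {b, g} ∧
      ({a, b, g} : Finset (Fin 4)).erase b = {a, g} ∧
      insert a ({a, b} : Finset (Fin 4))ᶜ = co b ∧
      insert b ({a, b} : Finset (Fin 4))ᶜ = co a := by decide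
  obtain ⟨x1, x2, x3, x4, x5, x6, x7⟩ := sets a b g hag hbg hab
  have r := Kills.swap hab x1 (by rw [x3, x2]; exact h) f
  rw [x4, x5, x6, x7] at r
  exact r.symm

lemma Kills.two_three_two {g i : Fin 4} {a : Fin 4} (hag : a ≠ g) (hig : i ≠ g) (hia : i ≠ a)
    (h : Kills ψ [2, 3, 2]) (f : Pol 4) :
    ψ (cat [{a, g}, co a, {a, i}] f) = ψ (cat [{g, a}, co g, {g, i}] f) := by
  have h23 : Kills ψ [2, 3] := Kills.of_append (σ := [2]) h
  have r := (Kills.comp_cons (c := {a, g}) (Finset.card_pair hag) h).incidence_three_two i f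
  rw [← Finset.sum_subset (s₁ := {a, g})] at r
  · rw [Finset.sum_pair hag] at r
    rw [Finset.pair_comm g a]
    simp only [LinearMap.comp_apply, cat_cons] at r ⊢
    grind
  · intro x; simp only [Finset.mem_insert, Finset.mem_singleton, Finset.mem_erase]
    rintro (rfl | rfl) <;> simp [hig.symm, hia.symm]
  · intro x _ hx
    simp only [Finset.mem_insert, Finset.mem_singleton, not_or] at hx
    exact h23.two_three_eq_zero hag hx.1 hx.2 (cons {x, i} f)

lemma Kills.two_three_two_zero {x g : Fin 4} (hxg : x ≠ g)
    (h : Kills ψ [2, 3, 2]) (f : Pol 4) :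
    ψ (cat [{x, g}, co x, {x, g}] f) = 0 := by
  have h23 : Kills ψ [2, 3] := Kills.of_append (σ := [2]) h
  have r := (Kills.comp_cons (c := {x, g}) (Finset.card_pair hxg) h).incidence_three_two g f
  rw [Finset.sum_eq_single_of_mem x (by simp [hxg])] at r
  · exact r
  · intro b hb hbx
    exact h23.two_three_eq_zero hxg hbx (Finset.ne_of_mem_erase hb) (cons {b, g} f)

lemma Kills.two_three_two_two {c d e f : Finset (Fin 4)} (hc : c.card = 2) (hd : d.card = 3)
    (he : e.card = 2) (hf : f.card = 2) (h : Kills ψ [2, 3, 2, 2]) (p : Pol 4) :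
    ψ (cat [c, d, e, f] p) = 0 := by
  have h23 : Kills ψ [2, 3] := Kills.of_append (σ := [2, 2]) h
  have h232 : Kills ψ [2, 3, 2] := Kills.of_append (σ := [2]) h
  have meets : ∀ (g : Fin 4) (e : Finset (Fin 4)) (p : Pol 4) (a : Fin 4), e.card = 2 → a ≠ g →
      g ∈ e → ψ (cat [{a, g}, co a, e] p) = 0 := by
    intro g e p a he hag hge
    obtain ⟨x, hx, rfl⟩ : ∃ x, x ≠ g ∧ e = {x, g} := by
      have sets : ∀ (g : Fin 4) (e : Finset (Fin 4)), e.card = 2 → g ∈ e →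
        ∃ x, x ≠ g ∧ e = {x, g} := by decide
      exact sets g e he hge
    have := h23.two_three_swap hag hx (cons {x, g} p)
    simp only [cat_cons, cat_nil] at this ⊢
    rw [this]
    exact h232.two_three_two_zero hx p
  have comm : ∀ (a g : Fin 4) (e f : Finset (Fin 4)), a ≠ g → e.card = 2 → f.card = 2 →
      ψ (cat [{a, g}, co a, e, f] p) = ψ (cat [{a, g}, co a, f, e] p) := by
    intro a g e f hag he hf
    exact Kills.comm (he.trans hf.symm) (by
      rw [he, hf]; exact Kills.comp_cons (card_co a) (Kills.comp_cons (Finset.card_pair hag) h)) p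
  have key : ∀ z g : Fin 4, z ≠ g → ψ (cat [{z, g}, co z, e, f] p) = 0 := by
    intro z g hzg
    by_cases hge : g ∈ e
    · exact meets g e (cons f p) z he hzg hge
    by_cases hgf : g ∈ f
    · rw [comm z g e f hzg he hf]
      exact meets g f (cons e p) z hf hzg hgf
    have sets : ∀ (g : Fin 4) (e f : Finset (Fin 4)), e.card = 2 → f.card = 2 → g ∉ e → g ∉ f →
        ∃ x y, x ≠ g ∧ y ≠ g ∧ y ≠ x ∧ e = {x, y} ∧ x ∈ f := by decide +kernel
    obtain ⟨x, y, hxg, hyg, hyx, rfl, hxf⟩ := sets g e f he hf hge hgf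
    have r1 := h23.two_three_swap hzg hxg (cons {x, y} (cons f p))
    have r2 := h232.two_three_two hxg hyg hyx (cons f p)
    have r3 := comm g x {g, y} f hxg.symm (Finset.card_pair hyg.symm) hf
    have r4 := meets x f (cons {g, y} p) g hf hxg.symm hxf
    simp only [cat_cons, cat_nil] at r1 r2 r3 r4 ⊢
    rw [r1, r2, r3, r4]
  obtain ⟨u, v, huv, rfl⟩ := Finset.card_eq_two.mp hc
  obtain ⟨z, rfl⟩ := eq_co_of_card d hd
  by_cases hzu : z = u
  · subst hzu
    exact key z v huv
  by_cases hzv : z = v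
  · subst hzv
    rw [Finset.pair_comm]
    exact key z u hzu
  · exact h23.two_three_eq_zero huv hzu hzv _

end DeadPatterns

section DeadWords

variable {ψ : Pol 4 →ₗ[ZMod 2] ZMod 2} {τ : List ℕ}

/-- Weight vectors containing a pattern that forces every word of that weight to be
hit modulo words of smaller weight. -/
inductive Dead : List ℕ → Prop
  | zero {τ : List ℕ} {a : ℕ} : a ∈ τ → a ≠ 0 → Dead (0 :: τ)
  | one_two (τ : List ℕ) : Dead (1 :: 2 :: τ)
  | four {a : ℕ} (τ : List ℕ) : a < 4 → Dead (a :: 4 :: τ)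
  | one_one_three (τ : List ℕ) : Dead (1 :: 1 :: 3 :: τ)
  | one_three_two (τ : List ℕ) : Dead (1 :: 3 :: 2 :: τ)
  | two_three_two_two (τ : List ℕ) : Dead (2 :: 3 :: 2 :: 2 :: τ)
  | cons (a : ℕ) {τ : List ℕ} : Dead τ → Dead (a :: τ)

lemma wt_eq_cons {w : List (Finset (Fin 4))} {a : ℕ} (h : wt w = a :: τ) :
    ∃ c v, w = c :: v ∧ c.card = a ∧ wt v = τ := by
  cases w with
  | nil => simp at h
  | cons c v => exact ⟨c, v, rfl, by simpa using h⟩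

lemma ev_eq_zero {τ : List ℕ} (h : ev τ = 0) : ∀ a ∈ τ, a = 0 := by
  induction τ with
  | nil => simp
  | cons a τ ih =>
    simp only [ev] at h
    simp only [List.mem_cons, forall_eq_or_imp]
    exact ⟨by omega, ih (by omega)⟩

lemma exists_cat_one_eq_monomial (w : List (Finset (Fin 4))) :
    ∃ e, cat w (1 : Pol 4) = monomial e 1 := by
  induction w with
  | nil => exact ⟨0, rfl⟩
  | cons c w ih =>
    obtain ⟨e, he⟩ := ih
    rw [cat_cons, he, cons_monomial]
    exact ⟨_, rfl⟩

lemma Dead.eq_zero (hτ : Dead τ) {w : List (Finset (Fin 4))} (hw : wt w = τ) (h : Kills ψ τ) :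
    ψ (cat w 1) = 0 := by
  induction hτ generalizing w ψ with
  | @zero τ a ha ha0 =>
    obtain ⟨c, v, rfl, hc, hv⟩ := wt_eq_cons hw
    rw [Finset.card_eq_zero.mp hc]
    obtain ⟨e, he⟩ := exists_cat_one_eq_monomial v
    have hom := cat_isHomogeneous (k := 4) v
    have hdeg : e.degree = ev τ := by
      rw [he, hv] at hom
      rw [Finsupp.degree_eq_weight_one]
      exact hom (by simp)
    refine h _ (hit_le_N _ ?_)
    rw [cat_cons, he, cons_apply, show sqfree (∅ : Finset (Fin 4)) = 1 from Finset.prod_empty,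
      one_mul]
    refine monomial_sq_mem_hit (Nat.pos_of_ne_zero fun h0 => ha0 ?_)
    exact ev_eq_zero (hdeg.symm.trans h0) a ha
  | one_two τ =>
    obtain ⟨c, v, rfl, hc, hv⟩ := wt_eq_cons hw
    obtain ⟨d, v, rfl, hd, hv⟩ := wt_eq_cons hv
    simpa only [cat_cons, cat_nil] using
      Kills.one_two hc hd (Kills.of_append (σ := τ) h) (cat v 1)
  | @four a τ ha =>
    obtain ⟨c, v, rfl, hc, hv⟩ := wt_eq_cons hw
    obtain ⟨d, v, rfl, hd, hv⟩ := wt_eq_cons hv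
    obtain rfl := (Finset.card_eq_iff_eq_univ d).mp hd
    have hcd : c ⊂ Finset.univ := Finset.ssubset_univ_iff.mpr <| by
      rintro rfl; simp at hc; omega
    simpa only [cat_cons, cat_nil] using Kills.subset_eq_zero hcd
      (by rw [hc, hd]; exact Kills.of_append (σ := τ) h) (cat v 1)
  | one_one_three τ =>
    obtain ⟨c, v, rfl, hc, hv⟩ := wt_eq_cons hw
    obtain ⟨d, v, rfl, hd, hv⟩ := wt_eq_cons hv
    obtain ⟨e, v, rfl, he, hv⟩ := wt_eq_cons hv
    simpa only [cat_cons, cat_nil] using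
      Kills.one_one_three hc hd he (Kills.of_append (σ := τ) h) (cat v 1)
  | one_three_two τ =>
    obtain ⟨c, v, rfl, hc, hv⟩ := wt_eq_cons hw
    obtain ⟨d, v, rfl, hd, hv⟩ := wt_eq_cons hv
    obtain ⟨e, v, rfl, he, hv⟩ := wt_eq_cons hv
    simpa only [cat_cons, cat_nil] using
      Kills.one_three_two hc hd he (Kills.of_append (σ := τ) h) (cat v 1)
  | two_three_two_two τ =>
    obtain ⟨c, v, rfl, hc, hv⟩ := wt_eq_cons hw
    obtain ⟨d, v, rfl, hd, hv⟩ := wt_eq_cons hv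
    obtain ⟨e, v, rfl, he, hv⟩ := wt_eq_cons hv
    obtain ⟨f, v, rfl, hf, hv⟩ := wt_eq_cons hv
    simpa only [cat_cons, cat_nil] using
      Kills.two_three_two_two hc hd he hf (Kills.of_append (σ := τ) h) (cat v 1)
  | cons a hτ ih =>
    obtain ⟨c, v, rfl, hc, hv⟩ := wt_eq_cons hw
    exact ih (ψ := ψ ∘ₗ HitProblem.cons c) hv (h.comp_cons hc)

end DeadWords

section Weights

/-- Weight vectors with entries at most four that are not dead. -/
def Alive (τ : List ℕ) : Prop := (∀ a ∈ τ, a ≤ 4) ∧ ¬ Dead τ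

/-- `Padded τ ω` says that `ω` is `τ` followed by zeros. -/
def Padded (τ ω : List ℕ) : Prop := ∃ k, ω = τ ++ List.replicate k 0

variable {ω : List ℕ} {a b n : ℕ}

lemma Alive.tail (h : Alive (a :: ω)) : Alive ω :=
  ⟨fun b hb => h.1 b (List.mem_cons_of_mem a hb), fun hd => h.2 (hd.cons a)⟩

lemma Padded.cons {τ : List ℕ} (h : Padded τ ω) (a : ℕ) : Padded (a :: τ) (a :: ω) := by
  obtain ⟨k, rfl⟩ := h
  exact ⟨k, rfl⟩

lemma padded_nil (h : ev ω = 0) : Padded [] ω :=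
  ⟨ω.length, List.eq_replicate_of_mem (ev_eq_zero h)⟩

lemma Alive.even (h : Alive ω) (hn : ev ω = 2 * n) (hn0 : n ≠ 0) :
    (∃ σ, ω = 2 :: σ ∧ ev σ = n - 1) ∨ (∃ σ, ω = 4 :: σ ∧ ev σ = n - 2 ∧ 2 ≤ n) := by
  cases ω with
  | nil => simp only [ev] at hn; omega
  | cons a σ =>
    have ha := h.1 a List.mem_cons_self
    simp only [ev] at hn
    have : a = 0 ∨ a = 2 ∨ a = 4 := by omega
    rcases this with rfl | rfl | rfl
    · refine absurd ?_ h.2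
      have : ∃ b ∈ σ, b ≠ 0 := by
        by_contra hcon
        push Not at hcon
        have : ev σ = 0 := by
          have : ∀ σ : List ℕ, (∀ b ∈ σ, b = 0) → ev σ = 0 := by
            intro σ
            induction σ with
            | nil => simp [ev]
            | cons b σ ih =>
              intro hb
              rw [ev, hb b List.mem_cons_self, ih fun c hc => hb c (List.mem_cons_of_mem b hc)]
          exact this σ hcon
        omega
      obtain ⟨b, hb, hb0⟩ := this
      exact Dead.zero hb hb0
    · exact Or.inl ⟨σ, rfl, by omega⟩
    · exact Or.inr ⟨σ, rfl, by omega, by omega⟩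

lemma Alive.odd (h : Alive ω) (hn : ev ω = 2 * n + 1) :
    (∃ σ, ω = 1 :: σ ∧ ev σ = n) ∨ (∃ σ, ω = 3 :: σ ∧ ev σ = n - 1 ∧ 1 ≤ n) := by
  cases ω with
  | nil => simp only [ev] at hn; omega
  | cons a σ =>
    have ha := h.1 a List.mem_cons_self
    simp only [ev] at hn
    have : a = 1 ∨ a = 3 := by omega
    rcases this with rfl | rfl
    · exact Or.inl ⟨σ, rfl, by omega⟩
    · exact Or.inr ⟨σ, rfl, by omega, by omega⟩

lemma Alive.even_of_lt_four (h : Alive (a :: ω)) (ha : a < 4) (hn : ev ω = 2 * n) (hn0 : n ≠ 0) :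
    ∃ σ, ω = 2 :: σ ∧ ev σ = n - 1 := by
  rcases h.tail.even hn hn0 with h' | ⟨σ, rfl, -⟩
  · exact h'
  · exact absurd (Dead.four σ ha) h.2

lemma Alive.ones_of_one_one (h : Alive (1 :: 1 :: ω)) (hn : ev ω = 2 ^ a - 1) :
    Padded (List.replicate a 1) ω := by
  induction a generalizing ω with
  | zero => exact padded_nil (by simpa using hn)
  | succ a ih =>
    have := Nat.one_le_two_pow (n := a)
    rcases h.tail.tail.odd (n := 2 ^ a - 1) (by rw [hn, pow_succ]; omega) with
      ⟨σ, rfl, hσ⟩ | ⟨σ, rfl, -⟩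
    · exact (ih h.tail hσ).cons 1
    · exact absurd (Dead.one_one_three σ) h.2

lemma Alive.ones_of_one (h : Alive (1 :: ω)) (hn : ev ω = 2 ^ (a + 3) - 1) :
    Padded (List.replicate (a + 3) 1) ω := by
  have := Nat.one_le_two_pow (n := a)
  rcases h.tail.odd (n := 2 ^ (a + 2) - 1) (by rw [hn, pow_add, pow_add]; omega) with
    ⟨σ, rfl, hσ⟩ | ⟨σ, rfl, hσ, -⟩
  · exact (h.ones_of_one_one hσ).cons 1
  · obtain ⟨σ, rfl, -⟩ := h.tail.even_of_lt_four (n := 2 ^ (a + 1) - 1) (by norm_num)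
      (by rw [hσ, pow_add, pow_add]; omega) (by rw [pow_add]; omega)
    exact absurd (Dead.one_three_two σ) h.2

lemma Alive.ones_of_two (h : Alive (2 :: ω)) (hn : ev ω = 2 ^ (a + 4) - 1) :
    Padded (List.replicate (a + 4) 1) ω := by
  have := Nat.one_le_two_pow (n := a)
  rcases h.tail.odd (n := 2 ^ (a + 3) - 1) (by rw [hn, pow_add, pow_add]; omega) with
    ⟨σ, rfl, hσ⟩ | ⟨σ, rfl, hσ, -⟩
  · exact (h.tail.ones_of_one hσ).cons 1
  · obtain ⟨σ, rfl, hσ'⟩ := h.tail.even_of_lt_four (n := 2 ^ (a + 2) - 1) (by norm_num)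
      (by rw [hσ, pow_add, pow_add]; omega) (by rw [pow_add]; omega)
    obtain ⟨σ, rfl, -⟩ := h.tail.tail.even_of_lt_four (n := 2 ^ (a + 1) - 1) (by norm_num)
      (by rw [hσ', pow_add, pow_add]; omega) (by rw [pow_add]; omega)
    exact absurd (Dead.two_three_two_two σ) h.2

lemma Alive.twos_ones (h : Alive (2 :: ω)) (hn : ev ω = 2 ^ (b + (a + 4)) + 2 ^ b - 2) :
    Padded (List.replicate b 2 ++ List.replicate (a + 4) 1) ω := by
  induction b generalizing ω with
  | zero => exact h.ones_of_two (by rw [hn, Nat.zero_add]; omega)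
  | succ b ih =>
    have := Nat.one_le_two_pow (n := b)
    have := Nat.one_le_two_pow (n := b + (a + 4))
    obtain ⟨σ, rfl, hσ⟩ := h.even_of_lt_four (n := 2 ^ (b + (a + 4)) + 2 ^ b - 1) (by norm_num)
      (by rw [hn, Nat.add_right_comm b 1, pow_succ, pow_succ 2 b]; omega) (by omega)
    exact (ih h.tail (by omega)).cons 2

lemma Alive.twos (h : Alive (a :: ω)) (ha : a < 4) (hn : ev ω = 2 ^ (b + 1) - 2) :
    Padded (List.replicate b 2) ω := by
  induction b generalizing ω a with
  | zero => exact padded_nil (by simpa using hn)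
  | succ b ih =>
    have := Nat.one_le_two_pow (n := b)
    obtain ⟨σ, rfl, hσ⟩ := h.even_of_lt_four (n := 2 ^ (b + 1) - 1) ha
      (by rw [hn, pow_succ, pow_succ]; omega) (by rw [pow_succ]; omega)
    exact (ih h.tail (by norm_num) (by omega)).cons 2

lemma Alive.threes_one (h : Alive ω) (hn : ev ω = 2 ^ (a + 2) - 3) :
    Padded (List.replicate a 3 ++ [1]) ω := by
  induction a generalizing ω with
  | zero =>
    rcases h.odd (n := 0) (by simpa using hn) with ⟨σ, rfl, hσ⟩ | ⟨σ, -, -, h1⟩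
    · exact (padded_nil hσ).cons 1
    · omega
  | succ a ih =>
    have := Nat.one_le_two_pow (n := a)
    rcases h.odd (n := 2 ^ (a + 2) - 2) (by rw [hn, pow_succ, pow_add]; omega) with
      ⟨σ, rfl, hσ⟩ | ⟨σ, rfl, hσ, -⟩
    · obtain ⟨σ, rfl, -⟩ := h.even_of_lt_four (n := 2 ^ (a + 1) - 1) (by norm_num)
        (by rw [hσ, pow_succ, pow_succ]; omega) (by rw [pow_succ]; omega)
      exact absurd (Dead.one_two σ) h.2
    · exact (ih h.tail (by omega)).cons 3

lemma Alive.threes_ones_or_twos (h : Alive ω)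
    (hn : ev ω = 2 ^ (b + 1 + (a + 3)) + 2 ^ (b + 1) - 3) :
    Padded (List.replicate b 3 ++ List.replicate (a + 4) 1) ω ∨
      Padded (List.replicate (b + 1) 3 ++ List.replicate (a + 2) 2) ω := by
  induction b generalizing ω with
  | zero =>
    have := Nat.one_le_two_pow (n := a)
    rcases h.odd (n := 2 ^ (a + 3) - 1)
        (by rw [hn, show 0 + 1 + (a + 3) = a + 4 by ring, pow_add, pow_add, pow_add]; omega) with
      ⟨σ, rfl, hσ⟩ | ⟨σ, rfl, hσ, -⟩
    · exact Or.inl ((h.ones_of_one hσ).cons 1)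
    · exact Or.inr ((h.twos (b := a + 2) (by norm_num) hσ).cons 3)
  | succ b ih =>
    have := Nat.one_le_two_pow (n := b)
    have h4 : 4 ≤ 2 ^ (b + 1 + (a + 3)) := by
      rw [show b + 1 + (a + 3) = b + a + 2 + 2 by ring, pow_add]
      have := Nat.one_le_two_pow (n := b + a + 2); omega
    rcases h.odd (n := 2 ^ (b + 1 + (a + 3)) + 2 ^ (b + 1) - 2)
        (by rw [hn, Nat.add_right_comm (b + 1) 1, pow_succ 2 (b + 1), pow_succ]; omega) with
      ⟨σ, rfl, hσ⟩ | ⟨σ, rfl, hσ, -⟩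
    · obtain ⟨σ, rfl, -⟩ := h.even_of_lt_four (n := 2 ^ (b + (a + 3)) + 2 ^ b - 1) (by norm_num)
        (by rw [hσ, Nat.add_right_comm b 1, pow_succ 2 b, pow_succ]; omega)
        (by have := Nat.one_le_two_pow (n := b + (a + 3)); omega)
      exact absurd (Dead.one_two σ) h.2
    · exact (ih h.tail (by omega)).imp (fun h => h.cons 3) (fun h => h.cons 3)

/-- The weights that survive in degree `2 ^ (s + t) + 2 ^ s - 2`, for `s = b + 1`, `t = a + 6`. -/
lemma Alive.classify (h : Alive ω) (hn : ev ω = 2 ^ (b + 1 + (a + 6)) + 2 ^ (b + 1) - 2) :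
    Padded (List.replicate (b + 1) 2 ++ List.replicate (a + 6) 1) ω ∨
    (∃ c, b = c + 1 ∧ Padded (4 :: (List.replicate c 3 ++ List.replicate (a + 7) 1)) ω) ∨
    Padded (4 :: (List.replicate b 3 ++ List.replicate (a + 5) 2)) ω ∨
    (b = 0 ∧ Padded (4 :: 4 :: (List.replicate (a + 3) 3 ++ [1])) ω) := by
  have := Nat.one_le_two_pow (n := b)
  have h4 : 4 ≤ 2 ^ (b + (a + 6)) := by
    rw [show b + (a + 6) = b + a + 4 + 2 by ring, pow_add]
    have := Nat.one_le_two_pow (n := b + a + 4); omega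
  rcases h.even (n := 2 ^ (b + (a + 6)) + 2 ^ b - 1)
      (by rw [hn, Nat.add_right_comm b 1, pow_succ 2 b, pow_succ]; omega) (by omega) with
    ⟨σ, rfl, hσ⟩ | ⟨σ, rfl, hσ, -⟩
  · exact Or.inl ((h.twos_ones (a := a + 2) (by omega)).cons 2)
  · refine Or.inr ?_
    cases b with
    | zero =>
      have := Nat.one_le_two_pow (n := a)
      rcases h.tail.even (n := 2 ^ (a + 5) - 1)
          (by rw [hσ, Nat.zero_add, pow_add, pow_add]; omega)
          (by rw [pow_add]; omega) with ⟨σ, rfl, hσ⟩ | ⟨σ, rfl, hσ, -⟩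
      · exact Or.inr (Or.inl (((h.tail.twos (b := a + 4) (by norm_num) (by omega)).cons 2).cons 4))
      · exact Or.inr (Or.inr ⟨rfl, ((h.tail.tail.threes_one (a := a + 3)
          (by omega)).cons 4).cons 4⟩)
    | succ c =>
      rcases h.tail.threes_ones_or_twos (a := a + 3) (b := c) (by omega) with h' | h'
      · exact Or.inl ⟨c, rfl, h'.cons 4⟩
      · exact Or.inr (Or.inl (h'.cons 4))

end Weights

section Words

variable {α R S : Type*} [DecidableEq α]

/-- A function on words of fixed length that is invariant under permutations and under
`xxy ↦ xyy` depends only on the set of letters. -/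
lemma eq_of_toFinset_eq {P : α → Prop} {n : ℕ} {f : List α → R}
    (hperm : ∀ l l', l.length = n → (∀ x ∈ l, P x) → l.Perm l' → f l = f l')
    (hidem : ∀ x y l, (x :: x :: y :: l).length = n → (∀ z ∈ x :: y :: l, P z) → x ≠ y →
      f (x :: x :: y :: l) = f (x :: y :: y :: l))
    {l l' : List α} (hl : l.length = n) (hl' : l'.length = n) (hP : ∀ x ∈ l, P x)
    (h : l.toFinset = l'.toFinset) : f l = f l' := by
  rcases l.eq_nil_or_concat with rfl | ⟨l₀, z, hz'⟩
  · simp only [List.length_nil] at hl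
    rw [← hl, List.length_eq_zero_iff] at hl'
    rw [hl']
  have hz : z ∈ l := by simp [hz']
  have norm : ∀ k, ∀ m : List α, m.length = n → (∀ x ∈ m, P x) → n - m.count z = k →
      m.toFinset = l.toFinset →
      f m = f (List.replicate (n - (l.toFinset.erase z).card) z ++ (l.toFinset.erase z).toList) := by
    intro k
    induction k using Nat.strong_induction_on with
    | _ k ih =>
      intro m hm hPm hk hml
      have hzm : z ∈ m := by rw [← List.mem_toFinset, hml, List.mem_toFinset]; exact hz
      by_cases hd : ∃ y, y ≠ z ∧ 2 ≤ m.count y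
      · obtain ⟨y, hyz, hy⟩ := hd
        have p1 := List.perm_cons_erase hzm
        have hy1 : y ∈ m.erase z := (List.mem_erase_of_ne hyz).mpr
          (List.count_pos_iff.mp (by omega))
        have p2 := List.perm_cons_erase hy1
        have hy2 : y ∈ (m.erase z).erase y := by
          rw [← List.count_pos_iff, List.count_erase_self, List.count_erase_of_ne hyz]
          omega
        have p3 := List.perm_cons_erase hy2
        set r := ((m.erase z).erase y).erase y
        have p : m.Perm (z :: y :: y :: r) := p1.trans ((p2.trans (p3.cons y)).cons z)
        have hlen : (z :: y :: y :: r).length = n := p.length_eq.symm.trans hm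
        have hP' : ∀ x ∈ z :: y :: r, P x := fun x hx => hPm x (p.mem_iff.mpr (by
          simp only [List.mem_cons] at hx ⊢; tauto))
        rw [hperm m _ hm hPm p, ← hidem z y r hlen hP' hyz.symm]
        have hc : m.count z = r.count z + 1 := by
          rw [p.count_eq, List.count_cons_self, List.count_cons_of_ne hyz,
            List.count_cons_of_ne hyz]
        have hle := List.count_le_length (a := z) (l := m)
        have hcz : m.count z < m.length := by
          rw [p.length_eq, hc]
          have := List.count_le_length (a := z) (l := r)
          simp only [List.length_cons]
          omega
        refine ih (n - (z :: z :: y :: r).count z) ?_ _ hlen (fun x hx => hP' x (by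
          simp only [List.mem_cons] at hx ⊢; tauto)) rfl ?_
        · rw [List.count_cons_self, List.count_cons_self, List.count_cons_of_ne hyz]
          omega
        · rw [← hml, List.toFinset_eq_of_perm _ _ p]
          ext x; simp
      · push Not at hd
        refine hperm _ _ hm hPm ?_
        have hperm' : (m.filter (· ≠ z)).Perm (l.toFinset.erase z).toList := by
          rw [List.perm_ext_iff_of_nodup _ (Finset.nodup_toList _)]
          · intro y
            rw [Finset.mem_toList, ← hml]
            simp [and_comm]
          · rw [List.nodup_iff_count_le_one]
            intro y
            by_cases hyz : y = z
            · subst hyz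
              rw [List.count_eq_zero_of_not_mem (by simp)]; omega
            · have := hd y hyz
              rw [List.count_filter (by simpa using hyz)]
              omega
        have hsplit := List.filter_append_perm (fun x => decide (x = z)) m
        have hrep : m.filter (fun x => decide (x = z)) = List.replicate (m.count z) z := by
          rw [← List.filter_beq]; congr 1
        have hnot : m.filter (fun x => !decide (x = z)) = m.filter (· ≠ z) := by
          congr 1; ext x; simp
        rw [hrep, hnot] at hsplit
        have hlen := (hsplit.trans (List.Perm.refl m)).length_eq
        rw [List.length_append, List.length_replicate, hperm'.length_eq, Finset.length_toList,
          hm] at hlen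
        rw [show n - (l.toFinset.erase z).card = m.count z by omega]
        exact hsplit.symm.trans (hperm'.append_left _)
  rw [norm _ l hl hP rfl rfl, norm _ l' hl' (fun x hx => hP x (by
    rwa [← List.mem_toFinset, h, List.mem_toFinset])) rfl h.symm]

/-- The nonempty words of length `j` realise exactly the sets with at most `j` letters. -/
lemma exists_word {j : ℕ} {T : Finset α} (h : j = 0 ↔ T = ∅) (hT : T.card ≤ j) :
    ∃ l : List α, l.length = j ∧ l.toFinset = T := by
  rcases T.eq_empty_or_nonempty with rfl | ⟨z, hz⟩
  · exact ⟨[], (h.mpr rfl).symm, rfl⟩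
  · refine ⟨List.replicate (j - T.card) z ++ T.toList, by simp; omega, ?_⟩
    ext x
    simp only [List.toFinset_append, Finset.toList_toFinset, Finset.mem_union, List.mem_toFinset,
      List.mem_replicate]
    constructor
    · rintro (⟨-, rfl⟩ | hx) <;> assumption
    · exact Or.inr

/-- Elimination: a family of functions on words, indexed by a ranked set, vanishes if
non-free letters can be traded for free ones modulo higher rank and all words in free
letters vanish. -/
lemma words_elim {X : List α → S → ZMod 2} {j B : ℕ} (rank : S → ℕ) (hB : ∀ s, rank s ≤ B)
    (free : S → α → Prop)
    (hperm : ∀ s l l', l.length = j → l.Perm l' → X l s = X l' s)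
    (hstep : ∀ s, (∀ s', rank s < rank s' → ∀ l, l.length = j → X l s' = 0) →
      ∀ c a, (c :: a).length = j → ¬ free s c → (∀ c', free s c' → X (c' :: a) s = 0) →
      X (c :: a) s = 0)
    (hfree : ∀ s, (∀ s', rank s < rank s' → ∀ l, l.length = j → X l s' = 0) →
      ∀ l, l.length = j → (∀ c ∈ l, free s c) → X l s = 0)
    (s : S) (l : List α) (hl : l.length = j) : X l s = 0 := by
  classical
  induction hk : B - rank s using Nat.strong_induction_on generalizing s l with
  | _ k ih =>
    have high : ∀ s', rank s < rank s' → ∀ l, l.length = j → X l s' = 0 := fun s' hs' l hl =>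
      ih (B - rank s') (by have := hB s'; omega) s' l hl rfl
    clear ih
    induction hm : l.countP (fun c => ¬ free s c) generalizing l with
    | zero =>
      refine hfree s high l hl fun c hc => ?_
      have := List.countP_eq_zero.mp hm c hc
      simpa using this
    | succ m ihm =>
      obtain ⟨c, hc, hcf⟩ := List.countP_pos_iff.mp (by omega : 0 < l.countP fun c => ¬ free s c)
      have p := List.perm_cons_erase hc
      rw [hperm s l _ hl p]
      refine hstep s high c _ (p.length_eq.symm.trans hl) (by simpa using hcf) fun c' hc' => ?_
      refine ihm _ ?_ ?_
      · rw [← hl, p.length_eq]; rfl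
      · rw [p.countP_eq] at hm
        simp only [List.countP_cons] at hm ⊢
        rw [if_pos hcf] at hm
        rw [if_neg (by simpa using hc')]
        omega

end Words

section Blocks

variable {ψ : Pol 4 →ₗ[ZMod 2] ZMod 2} {τ : List ℕ}

lemma wt_eq_replicate {w : List (Finset (Fin 4))} {n a : ℕ} (hl : w.length = n)
    (hw : ∀ c ∈ w, c.card = a) : wt w = List.replicate n a :=
  List.eq_replicate_iff.mpr ⟨by simpa [wt] using hl, by simpa [wt] using hw⟩

lemma Kills.perm {n a : ℕ} {w w' : List (Finset (Fin 4))} (p : w.Perm w') (hl : w.length = n)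
    (hw : ∀ c ∈ w, c.card = a) (h : Kills ψ (List.replicate n a)) (g : Pol 4) :
    ψ (cat w g) = ψ (cat w' g) := by
  induction p generalizing ψ n with
  | nil => rfl
  | cons x p ih =>
    subst hl
    exact ih (ψ := ψ ∘ₗ HitProblem.cons x) rfl (fun c hc => hw c (List.mem_cons_of_mem x hc))
      (Kills.comp_cons (hw x List.mem_cons_self) h)
  | swap x y l =>
    subst hl
    have hx := hw x (by simp)
    have hy := hw y (by simp)
    have := Kills.comm (c := y) (d := x) (by rw [hx, hy]) (Kills.of_append
      (σ := List.replicate l.length a) (by rw [hx, hy]; exact h)) (cat l g)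
    simpa only [cat_cons, cat_nil] using this
  | trans p q ih ih' =>
    rw [ih hl hw h, ih' (p.length_eq.symm.trans hl) (fun c hc => hw c (p.mem_iff.mpr hc)) h]

/-- Words in pairwise adjacent letters depend only on the set of letters. -/
lemma Kills.support {ι : Type*} [DecidableEq ι] {letter : ι → Finset (Fin 4)} {P : ι → Prop}
    {a n : ℕ} (hcard : ∀ x, P x → (letter x).card = a)
    (hadj : ∀ x y, P x → P y → x ≠ y → ∃ I u v, u ≠ v ∧ u ∉ I ∧ v ∉ I ∧
      letter x = insert u I ∧ letter y = insert v I)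
    (h : Kills ψ (List.replicate n a)) {l l' : List ι} (hl : l.length = n) (hl' : l'.length = n)
    (hP : ∀ x ∈ l, P x) (hll : l.toFinset = l'.toFinset) (g : Pol 4) :
    ψ (cat (l.map letter) g) = ψ (cat (l'.map letter) g) := by
  refine eq_of_toFinset_eq (f := fun l => ψ (cat (l.map letter) g)) (P := P) ?_ ?_ hl hl' hP hll
  · intro l l' hl hP p
    exact h.perm (p.map letter) (by simpa using hl) (by simpa using fun x hx => hcard x (hP x hx)) g
  · intro x y l hl hP hxy
    obtain ⟨I, u, v, huv, hu, hv, hx, hy⟩ := hadj x y (hP x (by simp)) (hP y (by simp)) hxy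
    have hI : I.card + 1 = a := by
      rw [← hcard x (hP x (by simp)), hx, Finset.card_insert_of_notMem hu]
    have := Kills.idem_adjacent huv hu hv (Kills.of_append (σ := List.replicate l.length a) (by
      subst hl; rw [hI]; exact h)) (cat (l.map letter) g)
    simpa only [List.map_cons, cat_cons, cat_nil, hx, hy] using this

lemma singleton_adjacent (x y : Fin 4) (hxy : x ≠ y) : ∃ (I : Finset (Fin 4)) (u v : Fin 4),
    u ≠ v ∧ u ∉ I ∧ v ∉ I ∧ ({x} : Finset (Fin 4)) = insert u I ∧
      ({y} : Finset (Fin 4)) = insert v I :=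
  ⟨∅, x, y, hxy, by simp, by simp, by simp, by simp⟩

lemma pair_adjacent (a x y : Fin 4) (hx : x ≠ a) (hy : y ≠ a) (hxy : x ≠ y) :
    ∃ (I : Finset (Fin 4)) (u v : Fin 4), u ≠ v ∧ u ∉ I ∧ v ∉ I ∧
      ({a, x} : Finset (Fin 4)) = insert u I ∧ ({a, y} : Finset (Fin 4)) = insert v I :=
  ⟨{a}, x, y, hxy, by simpa, by simpa, Finset.pair_comm _ _, Finset.pair_comm _ _⟩

lemma co_adjacent (x y : Fin 4) (hxy : x ≠ y) : ∃ (I : Finset (Fin 4)) (u v : Fin 4),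
    u ≠ v ∧ u ∉ I ∧ v ∉ I ∧ co x = insert u I ∧ co y = insert v I := by
  refine ⟨{x, y}ᶜ, y, x, hxy.symm, by simp, by simp, ?_, ?_⟩
  · revert x y; decide
  · revert x y; decide

/-- A nonempty word of length `m` with letter set `V`, if there is one. -/
noncomputable def word {α : Type*} [DecidableEq α] (m : ℕ) (V : Finset α) : List α := by
  classical
  exact if h : ∃ l : List α, l.length = m ∧ l.toFinset = V then h.choose else []

lemma word_spec {α : Type*} [DecidableEq α] {m : ℕ} {V : Finset α} (h : m = 0 ↔ V = ∅)
    (hV : V.card ≤ m) : (word m V).length = m ∧ (word m V).toFinset = V := by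
  have := exists_word h hV
  rw [word, dif_pos this]
  exact this.choose_spec

/-- `V` is the letter set of some word of length `m`. -/
def Valid {α : Type*} (m : ℕ) (V : Finset α) : Prop := (m = 0 ↔ V = ∅) ∧ V.card ≤ m

lemma valid_toFinset {α : Type*} [DecidableEq α] (l : List α) : Valid l.length l.toFinset :=
  ⟨by rw [List.length_eq_zero_iff, List.toFinset_eq_empty_iff], List.toFinset_card_le l⟩

lemma Valid.length_word {α : Type*} [DecidableEq α] {m : ℕ} {V : Finset α} (h : Valid m V) :
    (word m V).length = m := (word_spec h.1 h.2).1

lemma Valid.toFinset_word {α : Type*} [DecidableEq α] {m : ℕ} {V : Finset α} (h : Valid m V) :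
    (word m V).toFinset = V := (word_spec h.1 h.2).2

lemma Valid.mem_word {α : Type*} [DecidableEq α] {m : ℕ} {V : Finset α} (h : Valid m V) {x : α} :
    x ∈ word m V ↔ x ∈ V := by rw [← List.mem_toFinset, h.toFinset_word]

end Blocks

section SinglesBlock

variable {ψ : Pol 4 →ₗ[ZMod 2] ZMod 2}

/-- The least element of a nonempty subset of `Fin 4`. -/
def piv (V : Finset (Fin 4)) : Fin 4 :=
  if 0 ∈ V then 0 else if 1 ∈ V then 1 else if 2 ∈ V then 2 else 3

lemma piv_mem {V : Finset (Fin 4)} (h : V.Nonempty) : piv V ∈ V := by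
  have : ∀ V : Finset (Fin 4), V.Nonempty → piv V ∈ V := by decide
  exact this V h

lemma exists_map_of_forall {α β : Type*} {f : α → β} {P : α → Prop} {l : List β}
    (h : ∀ c ∈ l, ∃ x, P x ∧ f x = c) : ∃ l' : List α, l = l'.map f ∧ ∀ x ∈ l', P x := by
  induction l with
  | nil => exact ⟨[], rfl, by simp⟩
  | cons c l ih =>
    obtain ⟨x, hx, rfl⟩ := h c List.mem_cons_self
    obtain ⟨l', rfl, hl'⟩ := ih fun c hc => h c (List.mem_cons_of_mem _ hc)
    exact ⟨x :: l', rfl, by simpa using ⟨hx, hl'⟩⟩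

lemma Kills.suffix {A : List (Finset (Fin 4))} {j n : ℕ} {τ : List ℕ}
    (h : Kills ψ (List.replicate j n ++ τ)) (hA : A.length = j) (hc : ∀ c ∈ A, c.card = n) :
    Kills (ψ ∘ₗ cat A) τ :=
  Kills.comp_cat (by rwa [wt_eq_replicate hA hc])

/-- A functional on words `A ++ B`, where the letters of `B` are singletons, vanishes if it
vanishes on the generators in which the letters of `A` are the free ones for the pivot of the
support of `B`. -/
lemma Kills.singles_block {n j m : ℕ} (hm : 5 ≤ m) {fl : Fin 4 → Fin 4 → Finset (Fin 4)}
    (hcard : ∀ a x, x ≠ a → (fl a x).card = n)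
    (hadj : ∀ a x y, x ≠ a → y ≠ a → x ≠ y → ∃ I u v, u ≠ v ∧ u ∉ I ∧ v ∉ I ∧
      fl a x = insert u I ∧ fl a y = insert v I)
    (hstep : ∀ φ : Pol 4 →ₗ[ZMod 2] ZMod 2, Kills φ [n, 1] → ∀ (V : Finset (Fin 4)) (a : Fin 4)
      (c : Finset (Fin 4)) (g : Pol 4), c.card = n → (∀ x, x ≠ a → fl a x ≠ c) →
      (∀ d e, d.card = n → e ∉ V → φ (cat [d, {e}] g) = 0) →
      (∀ x e, x ≠ a → e ∈ V → φ (cat [fl a x, {e}] g) = 0) → φ (cat [c, {a}] g) = 0)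
    (h : Kills ψ (List.replicate j n ++ List.replicate m 1))
    (hgen : ∀ V T : Finset (Fin 4), V.Nonempty → Valid j T → piv V ∉ T →
      ψ (cat ((word j T).map (fl (piv V)) ++ (word m V).map singleton) 1) = 0)
    {A B : List (Finset (Fin 4))} (hA : A.length = j) (hB : B.length = m)
    (hAc : ∀ c ∈ A, c.card = n) (hBc : ∀ c ∈ B, c.card = 1) : ψ (cat (A ++ B) 1) = 0 := by
  have hV4 : ∀ V : Finset (Fin 4), V.card ≤ 4 := fun V => V.card_le_univ
  have hval : ∀ (V : Finset (Fin 4)) (m' : ℕ), V.Nonempty → 4 ≤ m' → Valid m' V :=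
    fun V m' hV hm' => ⟨⟨by omega, fun h0 => absurd h0 hV.ne_empty⟩, (hV4 V).trans hm'⟩
  let X : List {c : Finset (Fin 4) // c.card = n} → {V : Finset (Fin 4) // V.Nonempty} → ZMod 2 :=
    fun l V => ψ (cat (l.map Subtype.val) (cat ((word m V.1).map singleton) 1))
  have hlc : ∀ l : List {c : Finset (Fin 4) // c.card = n},
      ∀ c ∈ l.map Subtype.val, c.card = n := by
    intro l c hc
    obtain ⟨d, -, rfl⟩ := List.mem_map.mp hc
    exact d.2
  have hX : ∀ (l : List {c : Finset (Fin 4) // c.card = n}) (b : List (Fin 4))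
      (V : {V : Finset (Fin 4) // V.Nonempty}), l.length = j → b.length = m → b.toFinset = V.1 →
      ψ (cat (l.map Subtype.val) (cat (b.map singleton) 1)) = X l V := by
    intro l b V hl hb hbV
    refine Kills.support (ψ := ψ ∘ₗ cat (l.map Subtype.val)) (P := fun _ => True)
      (a := 1) (fun x _ => Finset.card_singleton x) (fun x y _ _ => singleton_adjacent x y)
      (h.suffix (by simpa using hl) (hlc l)) hb (hval V.1 m V.2 (by omega)).length_word
      (fun _ _ => trivial) ?_ 1
    rw [hbV, (hval V.1 m V.2 (by omega)).toFinset_word]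
  have key := words_elim (X := X) (j := j) (B := 4) (fun V => V.1.card) (fun V => hV4 V.1)
    (fun V c => ∃ x, x ≠ piv V.1 ∧ fl (piv V.1) x = c.1)
    (fun V l l' hl p => (Kills.of_append h).perm (p.map Subtype.val) (by simpa using hl) (hlc l) _)
    ?_ ?_
  · obtain ⟨b, rfl, -⟩ := exists_map_of_forall (f := singleton) (P := fun _ : Fin 4 => True) (l := B)
      (fun c hc => by
        obtain ⟨x, rfl⟩ := Finset.card_eq_one.mp (hBc c hc)
        exact ⟨x, trivial, rfl⟩)
    have hb : b.toFinset.Nonempty := by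
      rw [List.toFinset_nonempty_iff]
      rintro rfl
      simp at hB
      omega
    have := key ⟨_, hb⟩ (A.attachWith _ hAc) (by simpa using hA)
    rw [← hX _ b _ (by simpa using hA) (by simpa using hB) rfl] at this
    rw [cat_append]
    simpa using this
  · intro V high c a hl hc hfree
    have ha : a.length + 1 = j := hl
    have move : ∀ (d : {c : Finset (Fin 4) // c.card = n}) (g : Pol 4),
        ψ (cat ((d :: a).map Subtype.val) g) = (ψ ∘ₗ cat (a.map Subtype.val)) (cat [d.1] g) := by
      intro d g
      rw [List.map_cons, (Kills.of_append h).perm (List.perm_append_singleton d.1 (a.map Subtype.val)).symm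
        (by simpa using ha) (hlc (d :: a)), cat_append]
      rfl
    set φ := ψ ∘ₗ cat (a.map Subtype.val) with hφ
    have hk : Kills φ [n, 1] := by
      refine Kills.comp_cat (Kills.of_append (σ := List.replicate (m - 1) 1) ?_)
      rw [wt_eq_replicate (n := a.length) (by simp) (hlc a)]
      have e : List.replicate a.length n ++ [n, 1] ++ List.replicate (m - 1) 1 =
          List.replicate j n ++ List.replicate m 1 := by
        obtain ⟨m, rfl⟩ : ∃ k, m = k + 1 := ⟨m - 1, by omega⟩
        rw [← ha, List.replicate_succ', List.replicate_succ]
        simp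
      rwa [e]
    have hv : Valid (m - 1) V.1 := hval V.1 _ V.2 (by omega)
    have val : ∀ (d : {c : Finset (Fin 4) // c.card = n}) (e : Fin 4),
        φ (cat [d.1, {e}] (cat ((word (m - 1) V.1).map singleton) 1)) =
          X (d :: a) ⟨insert e V.1, Finset.insert_nonempty _ _⟩ := by
      intro d e
      rw [← hX (d :: a) (e :: word (m - 1) V.1) _ hl (by simp [hv.length_word]; omega)
        (by simp [hv.toFinset_word]), move]
      rfl
    have e1 : X (c :: a) V = φ (cat [c.1, {piv V.1}] (cat ((word (m - 1) V.1).map singleton) 1)) := by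
      rw [val]
      congr 1
      exact Subtype.ext (Finset.insert_eq_self.mpr (piv_mem V.2)).symm
    rw [e1]
    refine hstep φ hk V.1 (piv V.1) c.1 _ c.2 (fun x hx hxc => hc ⟨x, hx, hxc⟩) ?_ ?_
    · intro d e hd he
      rw [val ⟨d, hd⟩]
      refine high _ ?_ _ hl
      rw [Finset.card_insert_of_notMem he]
      omega
    · intro x e hx he
      rw [val ⟨fl (piv V.1) x, hcard _ _ hx⟩]
      convert hfree ⟨fl (piv V.1) x, hcard _ _ hx⟩ ⟨x, hx, rfl⟩ using 2
      exact Subtype.ext (Finset.insert_eq_self.mpr he)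
  · intro V _ l hl hfree
    obtain ⟨b, hb, hbp⟩ := exists_map_of_forall (f := fl (piv V.1)) (P := fun x => x ≠ piv V.1)
      (l := l.map Subtype.val) (fun c hc => by
        obtain ⟨d, hd, rfl⟩ := List.mem_map.mp hc
        exact hfree d hd)
    have hbl : b.length = j := by
      have := congrArg List.length hb
      simp only [List.length_map] at this
      omega
    have hT : Valid j b.toFinset := hbl ▸ valid_toFinset b
    have := hgen V.1 b.toFinset V.2 hT (by rw [List.mem_toFinset]; exact fun h0 => hbp _ h0 rfl)
    rw [cat_append] at this
    change ψ (cat (l.map Subtype.val) _) = 0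
    rw [hb, ← this]
    exact Kills.support (P := fun x => x ≠ piv V.1) (hcard (piv V.1)) (hadj (piv V.1))
      (Kills.of_append h) hbl hT.length_word hbp hT.toFinset_word.symm _

lemma Kills.twos_ones_block {j m : ℕ} (hm : 5 ≤ m)
    (h : Kills ψ (List.replicate j 2 ++ List.replicate m 1))
    (hgen : ∀ V T : Finset (Fin 4), V.Nonempty → Valid j T → piv V ∉ T →
      ψ (cat ((word j T).map (fun x => {piv V, x}) ++ (word m V).map singleton) 1) = 0)
    {A B : List (Finset (Fin 4))} (hA : A.length = j) (hB : B.length = m)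
    (hAc : ∀ c ∈ A, c.card = 2) (hBc : ∀ c ∈ B, c.card = 1) : ψ (cat (A ++ B) 1) = 0 := by
  refine h.singles_block hm (fl := fun a x => {a, x}) (fun a x hx => Finset.card_pair hx.symm)
    pair_adjacent ?_ hgen hA hB hAc hBc
  intro φ hφ V a c g hc hfree h1 h2
  obtain ⟨x, y, hxy, rfl⟩ := Finset.card_eq_two.mp hc
  have hxa : x ≠ a := by
    rintro rfl
    exact hfree y hxy.symm rfl
  have hya : y ≠ a := by
    rintro rfl
    exact hfree x hxy (Finset.pair_comm _ _)
  have r := hφ.incidence_two_one hxa.symm hya.symm hxy g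
  have z : ∀ u v, u ≠ a → φ (cat [{a, u}, {v}] g) = 0 := by
    intro u v hu
    by_cases hv : v ∈ V
    · exact h2 u v hu hv
    · exact h1 _ _ (Finset.card_pair hu.symm) hv
  rwa [z y x hya, z x y hxa, add_zero, add_zero] at r

lemma Kills.threes_ones_block {j m : ℕ} (hm : 5 ≤ m)
    (h : Kills ψ (List.replicate j 3 ++ List.replicate m 1))
    (hgen : ∀ V T : Finset (Fin 4), V.Nonempty → Valid j T → piv V ∉ T →
      ψ (cat ((word j T).map co ++ (word m V).map singleton) 1) = 0)
    {A B : List (Finset (Fin 4))} (hA : A.length = j) (hB : B.length = m)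
    (hAc : ∀ c ∈ A, c.card = 3) (hBc : ∀ c ∈ B, c.card = 1) : ψ (cat (A ++ B) 1) = 0 := by
  refine h.singles_block hm (fl := fun _ x => co x) (fun a x _ => card_co x)
    (fun a x y _ _ => co_adjacent x y) ?_ hgen hA hB hAc hBc
  intro φ hφ V a c g hc hfree h1 h2
  obtain ⟨x, rfl⟩ := eq_co_of_card c hc
  obtain rfl : x = a := by
    by_contra hx
    exact hfree x hx rfl
  have r := hφ.incidence_three_one g
  rwa [Finset.sum_eq_single_of_mem x (Finset.mem_univ x)] at r
  intro e _ he
  by_cases hv : e ∈ V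
  · exact h2 e e he hv
  · exact h1 _ _ (card_co e) hv

end SinglesBlock

section ThreesOne

variable {ψ : Pol 4 →ₗ[ZMod 2] ZMod 2}

/-- The greatest element of a nonempty subset of `Fin 4`. -/
def top (V : Finset (Fin 4)) : Fin 4 :=
  if 3 ∈ V then 3 else if 2 ∈ V then 2 else if 1 ∈ V then 1 else 0

lemma top_mem : ∀ V : Finset (Fin 4), V.Nonempty → top V ∈ V := by decide

lemma incidence_elim {Y : Finset (Fin 4) → Fin 4 → ZMod 2}
    (hR : ∀ M : Finset (Fin 4), M.Nonempty → M.card ≤ 2 → ∑ e, Y (insert e M) e = 0)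
    (hF : ∑ e, Y {e} e = 0)
    (h1 : ∀ S e, S.Nonempty → S.card ≤ 3 → e ≠ top S → Y S e = 0)
    (h2 : ∀ S, S.card = 3 → 0 ∈ S → ∑ e ∈ S, Y S e = 0)
    (S : Finset (Fin 4)) (e : Fin 4) (hS : S.Nonempty) (hS3 : S.card ≤ 3) : Y S e = 0 := by
  have h3 : ∀ S : Finset (Fin 4), S.card = 3 → 0 ∈ S → Y S (top S) = 0 := by
    intro S hS h0
    rw [← h2 S hS h0, Finset.sum_eq_single_of_mem _ (top_mem S ⟨0, h0⟩)]
    intro b hb hbt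
    exact h1 S b ⟨0, h0⟩ hS.le hbt
  have rel : ∀ M : Finset (Fin 4), M.Nonempty → M.card ≤ 2 →
      ∑ e ∈ Finset.univ.filter (fun e => top (insert e M) = e), Y (insert e M) e = 0 := by
    intro M hM hM2
    rw [← hR M hM hM2]
    refine Finset.sum_subset (Finset.filter_subset _ _) fun e _ he => h1 _ _
      (Finset.insert_nonempty _ _) ((Finset.card_insert_le _ _).trans (by omega)) ?_
    simpa [eq_comm] using he
  have h01 : Y {0, 1} 1 = 0 := by
    have := rel {0, 1} (by decide) (by decide)
    rw [show Finset.univ.filter (fun e => top (insert e {0, 1}) = e) = {1, 2, 3} by decide,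
      Finset.sum_insert (by decide), Finset.sum_pair (by decide)] at this
    have r2 : Y (insert 2 {0, 1}) 2 = 0 := h3 (insert 2 {0, 1}) (by decide) (by decide)
    have r3 : Y (insert 3 {0, 1}) 3 = 0 := h3 (insert 3 {0, 1}) (by decide) (by decide)
    rw [r2, r3] at this
    simpa using this
  have h02 : Y {0, 2} 2 = 0 := by
    have := rel {0, 2} (by decide) (by decide)
    rw [show Finset.univ.filter (fun e => top (insert e {0, 2}) = e) = {2, 3} by decide,
      Finset.sum_pair (by decide)] at this
    have r3 : Y (insert 3 {0, 2}) 3 = 0 := h3 (insert 3 {0, 2}) (by decide) (by decide)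
    rw [r3] at this
    simpa using this
  have h3' : ∀ x : Fin 4, Y {x, 3} 3 = 0 := by
    intro x
    have := rel {x, 3} (by simp) Finset.card_le_two
    have hf : ∀ x : Fin 4, Finset.univ.filter (fun e => top (insert e {x, 3}) = e) = {3} := by
      decide
    rw [hf, Finset.sum_singleton, Finset.insert_eq_self.mpr (by simp)] at this
    exact this
  have h12 : Y {1, 2} 2 = Y {1, 2, 3} 3 := by
    have := rel {1, 2} (by decide) (by decide)
    rw [show Finset.univ.filter (fun e => top (insert e {1, 2}) = e) = {2, 3} by decide,
      Finset.sum_pair (by decide), show (insert 2 {1, 2} : Finset (Fin 4)) = {1, 2} by decide,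
      show (insert 3 {1, 2} : Finset (Fin 4)) = {1, 2, 3} by decide] at this
    grind
  have s0 : Y {0} 0 = 0 := by
    have := rel {0} (by decide) (by decide)
    rw [show Finset.univ.filter (fun e => top (insert e {0}) = e) = {0, 1, 2, 3} by decide,
      Finset.sum_insert (by decide), Finset.sum_insert (by decide), Finset.sum_pair (by decide),
      Finset.pair_comm 1 0, Finset.pair_comm 2 0, Finset.pair_comm 3 0, h01, h02, h3'] at this
    simpa using this
  have s1 : Y {1} 1 = Y {1, 2, 3} 3 := by
    have := rel {1} (by decide) (by decide)
    rw [show Finset.univ.filter (fun e => top (insert e {1}) = e) = {1, 2, 3} by decide,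
      Finset.sum_insert (by decide), Finset.sum_pair (by decide),
      Finset.pair_comm 2 1, Finset.pair_comm 3 1, h12, h3', Finset.pair_eq_singleton] at this
    grind
  have s2 : Y {2} 2 = 0 := by
    have := rel {2} (by decide) (by decide)
    rw [show Finset.univ.filter (fun e => top (insert e {2}) = e) = {2, 3} by decide,
      Finset.sum_pair (by decide), Finset.pair_comm 3 2, h3'] at this
    simpa using this
  have s3 : Y {3} 3 = 0 := by simpa using h3' 3
  have hz : Y {1, 2, 3} 3 = 0 := by
    rw [Fin.sum_univ_four, s0, s1, s2, s3] at hF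
    simpa using hF
  rw [hz] at h12 s1
  by_cases he : e = top S
  · subst he
    have cases : ∀ S : Finset (Fin 4), S.Nonempty → S.card ≤ 3 → (S.card = 3 ∧ 0 ∈ S) ∨
        S ∈ [{1, 2, 3}, {0, 1}, {0, 2}, {1, 2}, {0}, {1}, {2}] ∨ ∃ x, S = {x, 3} := by decide
    have cases' := cases S hS hS3
    simp only [List.mem_cons, List.not_mem_nil, or_false, or_assoc] at cases'
    rcases cases' with ⟨h, h0⟩ | rfl | rfl | rfl | rfl | rfl | rfl | rfl | ⟨x, rfl⟩
    · exact h3 S h h0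
    all_goals first | assumption | skip
    rw [show top {x, 3} = 3 by revert x; decide]
    exact h3' x
  · exact h1 S e hS hS3 he

lemma Kills.threes_one_block {m : ℕ} (hm : 3 ≤ m) (h : Kills ψ (List.replicate m 3 ++ [1]))
    (hgen₁ : ∀ (S : Finset (Fin 4)) (e : Fin 4), S.Nonempty → S.card ≤ 3 → e ≠ top S →
      ψ (cat ((word m S).map co ++ [{e}]) 1) = 0)
    (hgen₂ : ∀ S : Finset (Fin 4), S.card = 3 → 0 ∈ S →
      ∑ e ∈ S, ψ (cat ((word m S).map co ++ [{e}]) 1) = 0)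
    {A B : List (Finset (Fin 4))} (hA : A.length = m) (hB : B.length = 1)
    (hAc : ∀ c ∈ A, c.card = 3) (hBc : ∀ c ∈ B, c.card = 1) : ψ (cat (A ++ B) 1) = 0 := by
  have hval : ∀ l : List (Fin 4), l.length = m → Valid m l.toFinset := by
    rintro l rfl; exact valid_toFinset l
  have hX : ∀ (l : List (Fin 4)) (e : Fin 4), l.length = m → ψ (cat (l.map co ++ [{e}]) 1) =
      ψ (cat ((word m l.toFinset).map co ++ [{e}]) 1) := by
    intro l e hl
    rw [cat_append, cat_append]
    exact Kills.support (P := fun _ => True) (fun x _ => card_co x)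
      (fun x y _ _ => co_adjacent x y) (Kills.of_append h) hl (hval l hl).length_word
      (fun _ _ => trivial) (hval l hl).toFinset_word.symm _
  have hR : ∀ M : Finset (Fin 4), Valid (m - 1) M →
      ∑ e, ψ (cat ((word m (insert e M)).map co ++ [{e}]) 1) = 0 := by
    intro M hM
    have hk : Kills (ψ ∘ₗ cat ((word (m - 1) M).map co)) [3, 1] := by
      refine Kills.comp_cat ?_
      rw [wt_eq_replicate (n := m - 1) (a := 3) (by simp [hM.length_word])
        (by simp [card_co])]
      obtain ⟨k, rfl⟩ : ∃ k, m = k + 1 := ⟨m - 1, by omega⟩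
      simpa [List.replicate_succ'] using h
    rw [← hk.incidence_three_one 1]
    refine Finset.sum_congr rfl fun e _ => ?_
    have hl : (word (m - 1) M ++ [e]).length = m := by simp [hM.length_word]; omega
    have := hX _ e hl
    rw [show (word (m - 1) M ++ [e]).toFinset = insert e M by
      ext x; simp [hM.mem_word]] at this
    rw [← this, List.map_append, List.append_assoc, cat_append]
    simp only [List.map_cons, List.map_nil, List.cons_append, List.nil_append, cat_cons, cat_nil,
      LinearMap.comp_apply]
  have hF : ∑ e, ψ (cat ((word m {e}).map co ++ [{e}]) 1) = 0 := by
    obtain ⟨k, rfl⟩ : ∃ k, m = k + 1 := ⟨m - 1, by omega⟩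
    have hmem := sq_one_mem (k := 4) k Finset.univ ∅ 1
    rw [Finset.card_univ, Fintype.card_fin, Finset.card_empty] at hmem
    have := h _ hmem
    rw [Finset.sdiff_empty, map_sum] at this
    rw [← this]
    refine Finset.sum_congr rfl fun e _ => ?_
    have := hX (List.replicate (k + 1) e) e (by simp)
    rw [show (List.replicate (k + 1) e).toFinset = {e} by ext x; simp] at this
    rw [← this, List.map_replicate, cat_append, insert_empty_eq]
    simp only [cat_cons, cat_nil, co]
  have hR' : ∀ M : Finset (Fin 4), M.Nonempty → M.card ≤ 2 →
      ∑ e, ψ (cat ((word m (insert e M)).map co ++ [{e}]) 1) = 0 := by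
    intro M hM hM2
    exact hR M ⟨⟨fun h0 => absurd h0 (by omega), fun h0 => absurd h0 hM.ne_empty⟩, by omega⟩
  have key : ∀ (S : Finset (Fin 4)) (e : Fin 4), S.Nonempty → S.card ≤ 3 →
      ψ (cat ((word m S).map co ++ [{e}]) 1) = 0 := by
    generalize hY : (fun (S : Finset (Fin 4)) (e : Fin 4) =>
      ψ (cat ((word m S).map co ++ [{e}]) 1)) = Y
    have hYe : ∀ S e, ψ (cat ((word m S).map co ++ [{e}]) 1) = Y S e := fun S e => by rw [← hY]
    simp only [hYe] at hR' hF hgen₁ hgen₂ ⊢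
    exact incidence_elim hR' hF hgen₁ hgen₂
  obtain ⟨l, rfl, -⟩ := exists_map_of_forall (f := co) (P := fun _ : Fin 4 => True) (l := A)
    (fun c hc => (eq_co_of_card c (hAc c hc)).imp fun a ha => ⟨trivial, ha.symm⟩)
  obtain ⟨b, rfl⟩ := List.length_eq_one_iff.mp hB
  obtain ⟨e, rfl⟩ := Finset.card_eq_one.mp (hBc b (by simp))
  rw [List.length_map] at hA
  rw [hX l e hA]
  have hne : l.toFinset.Nonempty := by
    rw [List.toFinset_nonempty_iff]
    rintro rfl
    simp at hA
    omega
  by_cases h3 : l.toFinset.card ≤ 3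
  · exact key _ e hne h3
  · have hm4 : 4 ≤ m := by
      have := (hval l hA).2
      omega
    have huniv : l.toFinset = Finset.univ :=
      Finset.eq_univ_of_card _ (by have := l.toFinset.card_le_univ; simp at this ⊢; omega)
    have hv : Valid (m - 1) (co e) := by
      refine ⟨⟨by omega, fun h0 => ?_⟩, by rw [card_co]; omega⟩
      have := card_co e
      simp [h0] at this
    have r := hR (co e) hv
    rw [← Finset.add_sum_erase _ _ (Finset.mem_univ e), Finset.sum_eq_zero, add_zero] at r
    · rwa [huniv, ← Finset.insert_erase (Finset.mem_univ e)]
    · intro x hx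
      rw [Finset.insert_eq_self.mpr (by simpa [co] using hx)]
      refine key _ x ?_ (card_co e).le
      exact ⟨x, by simpa [co] using hx⟩

end ThreesOne

section PairWords

/-- The two-element subsets of `Fin 4`; complementation is `Fin.rev`. -/
def pr : Fin 6 → Finset (Fin 4) := ![{0, 1}, {0, 2}, {0, 3}, {1, 2}, {1, 3}, {2, 3}]

lemma rev_ne_self (x : Fin 6) : x.rev ≠ x := by revert x; decide

/-- Idempotence for words in pairs, complementary letters included. -/
lemma pair_words_idem {n : ℕ} (hn : 5 ≤ n) {f : List (Fin 6) → ZMod 2}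
    (hperm : ∀ l l', l.length = n → l.Perm l' → f l = f l')
    (hadj : ∀ x y l, (x :: x :: y :: l).length = n → x ≠ y → y ≠ x.rev →
      f (x :: x :: y :: l) = f (x :: y :: y :: l))
    (hpl : ∀ l : List (Fin 6), l.length + 2 = n → f (0 :: 5 :: l) + f (1 :: 4 :: l) + f (2 :: 3 :: l) = 0)
    (x y : Fin 6) (l : List (Fin 6)) (hl : (x :: x :: y :: l).length = n) (hxy : x ≠ y) :
    f (x :: x :: y :: l) = f (x :: y :: y :: l) := by
  have hp : ∀ l l' : List (Fin 6), l.length = n → (∀ z, l.count z = l'.count z) → f l = f l' :=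
    fun l l' h h' => hperm l l' h (List.perm_iff_count.mpr h')
  have third : ∀ p z l, (p :: p :: p.rev :: l).length = n → z ∈ l → z ≠ p → z ≠ p.rev →
      f (p :: p :: p.rev :: l) = f (p :: p.rev :: p.rev :: l) := by
    intro p z l hl hz hzp hzr
    have pl := List.perm_cons_erase hz
    have hl' : (l.erase z).length + 4 = n := by
      have := pl.length_eq
      simp only [List.length_cons] at this hl
      omega
    generalize l.erase z = r at pl hl'
    have hc : ∀ w, l.count w = (z :: r).count w := fun w => pl.count_eq w
    rw [hp _ (p :: p :: z :: p.rev :: r) hl (by intro w; simp [List.count_cons, hc]; ring),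
      hadj _ _ _ (by simpa) hzp.symm hzr,
      hp _ (z :: z :: p.rev :: p :: r) (by simpa) (by intro w; simp [List.count_cons]; ring),
      hadj _ _ _ (by simpa) hzr (fun h => hzp (by rw [← Fin.rev_rev z, ← h, Fin.rev_rev])),
      hp _ (p :: p.rev :: p.rev :: l) (by simpa)
        (by intro w; simp [List.count_cons, hc]; ring)]
  by_cases hy : y ≠ x.rev
  · exact hadj x y l hl hxy hy
  push Not at hy
  subst hy
  obtain ⟨b, c, hb, hbr, hc, hcr, hpl⟩ : ∃ b c : Fin 6, b ≠ x ∧ b ≠ x.rev ∧ c ≠ x ∧ c ≠ x.rev ∧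
      ∀ l, l.length + 2 = n →
        f (x :: x.rev :: l) + f (b :: b.rev :: l) + f (c :: c.rev :: l) = 0 := by
    have e : ∀ u v l, l.length + 2 = n → f (u :: v :: l) = f (v :: u :: l) := fun u v l h =>
      hperm _ _ h (List.Perm.swap _ _ _)
    fin_cases x
    · exact ⟨1, 2, by decide, by decide, by decide, by decide, fun l h => hpl l h⟩
    · exact ⟨0, 2, by decide, by decide, by decide, by decide, fun l h => by
        change f (1 :: 4 :: l) + f (0 :: 5 :: l) + f (2 :: 3 :: l) = 0
        linear_combination hpl l h⟩
    · exact ⟨0, 1, by decide, by decide, by decide, by decide, fun l h => by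
        change f (2 :: 3 :: l) + f (0 :: 5 :: l) + f (1 :: 4 :: l) = 0
        linear_combination hpl l h⟩
    · exact ⟨0, 1, by decide, by decide, by decide, by decide, fun l h => by
        change f (3 :: 2 :: l) + f (0 :: 5 :: l) + f (1 :: 4 :: l) = 0
        rw [e 3 2 l h]; linear_combination hpl l h⟩
    · exact ⟨0, 2, by decide, by decide, by decide, by decide, fun l h => by
        change f (4 :: 1 :: l) + f (0 :: 5 :: l) + f (2 :: 3 :: l) = 0
        rw [e 4 1 l h]; linear_combination hpl l h⟩
    · exact ⟨1, 2, by decide, by decide, by decide, by decide, fun l h => by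
        change f (5 :: 0 :: l) + f (1 :: 4 :: l) + f (2 :: 3 :: l) = 0
        rw [e 5 0 l h]; linear_combination hpl l h⟩
  have hrr : ∀ u v : Fin 6, u ≠ v.rev → u.rev ≠ v := fun u v h h' => h (by rw [← h', Fin.rev_rev])
  have hrn : ∀ u v : Fin 6, u ≠ v → u.rev ≠ v.rev := fun u v h h' => h (Fin.rev_injective h')
  have hl3 : l.length + 3 = n := by simpa using hl
  by_cases hz : ∃ z ∈ l, z ≠ x ∧ z ≠ x.rev
  · obtain ⟨z, hz, h1, h2⟩ := hz
    exact third x z l hl hz h1 h2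
  push Not at hz
  have mixed : x ∈ l → x.rev ∈ l → f (x :: x :: x.rev :: l) = f (x :: x.rev :: x.rev :: l) := by
    intro hx hxr
    have p1 := List.perm_cons_erase hx
    have p2 := List.perm_cons_erase ((List.mem_erase_of_ne (rev_ne_self x)).mpr hxr)
    have p := p1.trans (p2.cons x)
    generalize (l.erase x).erase x.rev = r at p
    have hc' : ∀ w, l.count w = (x :: x.rev :: r).count w := fun w => p.count_eq w
    have hr : r.length + 5 = n := by
      have := p.length_eq
      simp only [List.length_cons] at this
      omega
    have side : ∀ u : Fin 6, u ≠ x → u ≠ x.rev →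
        f (u :: u.rev :: x :: l) = f (u :: u.rev :: x.rev :: l) := by
      intro u h1 h2
      rw [hp _ (x :: x :: x.rev :: u :: u.rev :: r) (by simpa using hl3)
          (by intro w; simp [List.count_cons, hc']; ring),
        third x u _ (by simpa using hr) (by simp) h1 h2]
      exact hp _ _ (by simpa using hr) (by intro w; simp [List.count_cons, hc']; ring)
    have r1 := hpl (x :: l) (by simpa using hl3)
    have r2 := hpl (x.rev :: l) (by simpa using hl3)
    rw [side b hb hbr, side c hc hcr,
      hp _ (x :: x :: x.rev :: l) (by simpa using hl3) (by intro w; simp [List.count_cons]; ring)]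
      at r1
    grind
  -- words in a single letter, apart from one complement
  have pure : ∀ x b c : Fin 6, b ≠ x → b ≠ x.rev → c ≠ x → c ≠ x.rev →
      (∀ l, l.length + 2 = n →
        f (x :: x.rev :: l) + f (b :: b.rev :: l) + f (c :: c.rev :: l) = 0) →
      ∀ k, k + 5 = n → f (x :: x :: x.rev :: List.replicate (k + 2) x) =
        f (x :: x.rev :: x.rev :: List.replicate (k + 2) x) := by
    intro x b c hb hbr hc hcr hpl k hk
    have side : ∀ u : Fin 6, u ≠ x → u ≠ x.rev →
        f (u :: u.rev :: u :: u.rev :: List.replicate (k + 1) x) =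
          f (u :: u.rev :: x :: List.replicate (k + 2) x) := by
      intro u h1 h2
      rw [hp _ (u :: u :: x :: u.rev :: u.rev :: List.replicate k x) (by simpa using hk)
          (by intro w; simp [List.count_cons, List.replicate_succ]; ring),
        hadj u x _ (by simpa using hk) h1 (fun h => h2 (by rw [h, Fin.rev_rev])),
        hp _ (u.rev :: u.rev :: x :: u :: x :: List.replicate k x) (by simpa using hk)
          (by intro w; simp [List.count_cons]; ring),
        hadj u.rev x _ (by simpa using hk) (hrr _ _ h2) (fun h => h1 (by rw [h, Fin.rev_rev]))]
      exact hp _ _ (by simpa using hk)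
        (by intro w; simp [List.count_cons, List.replicate_succ]; ring)
    have r1 := hpl (x :: List.replicate (k + 2) x) (by simpa using hk)
    have r2 := hpl (x.rev :: List.replicate (k + 2) x) (by simpa using hk)
    have r3 := hpl (b :: b.rev :: List.replicate (k + 1) x) (by simpa using hk)
    have r4 := hpl (c :: c.rev :: List.replicate (k + 1) x) (by simpa using hk)
    have e1 : ∀ u : Fin 6, f (u :: u.rev :: x.rev :: List.replicate (k + 2) x) =
        f (x :: x.rev :: u :: u.rev :: List.replicate (k + 1) x) := fun u =>
      hp _ _ (by simpa using hk) (by intro w; simp [List.count_cons, List.replicate_succ]; ring)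
    rw [hp _ (x :: x :: x.rev :: List.replicate (k + 2) x) (by simpa using hk)
      (by intro w; simp [List.count_cons]; ring)] at r1
    rw [e1 b, e1 c] at r2
    rw [side b hb hbr, hp (c :: c.rev :: b :: b.rev :: _)
      (b :: b.rev :: c :: c.rev :: List.replicate (k + 1) x) (by simpa using hk)
      (by intro w; simp [List.count_cons]; ring)] at r3
    rw [side c hc hcr] at r4
    grind
  obtain ⟨k, hk⟩ : ∃ k, k + 5 = n := ⟨n - 5, by omega⟩
  have hlk : l.length = k + 2 := by omega
  by_cases hxl : x ∈ l
  · by_cases hxr : x.rev ∈ l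
    · exact mixed hxl hxr
    · obtain rfl : l = List.replicate (k + 2) x := List.eq_replicate_iff.mpr ⟨hlk, fun z hzl => by
        by_contra h
        exact hxr (hz z hzl h ▸ hzl)⟩
      exact pure x b c hb hbr hc hcr hpl k hk
  · obtain rfl : l = List.replicate (k + 2) x.rev := List.eq_replicate_iff.mpr ⟨hlk, fun z hzl =>
      hz z hzl (fun h => hxl (h ▸ hzl))⟩
    have := pure x.rev b c hbr (by rwa [Fin.rev_rev]) hcr (by rwa [Fin.rev_rev]) (fun l hl => by
      rw [Fin.rev_rev, hperm _ _ (by simpa using hl) (List.Perm.swap x x.rev l)]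
      exact hpl l hl) k hk
    rw [Fin.rev_rev] at this
    rw [hp _ (x.rev :: x :: x :: List.replicate (k + 2) x.rev) (by simpa using hk)
      (by intro w; simp [List.count_cons]; ring), ← this]
    exact hp _ _ (by simpa using hk) (by intro w; simp [List.count_cons]; ring)

end PairWords

section PairSets

/-- The three complementary couples of pairs. -/
def pc : Fin 3 → Finset (Fin 6) := ![{0, 5}, {1, 4}, {2, 3}]

/-- The nonempty sets of pairs containing an even number of complementary couples. -/
def Good (S : Finset (Fin 6)) : Prop :=
  S.Nonempty ∧ Even (Finset.univ.filter fun i => pc i ⊆ S).card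

instance : DecidablePred Good := fun S => by unfold Good; infer_instance

/-- The least element of a nonempty set of pairs. -/
def pvp (S : Finset (Fin 6)) : Fin 6 :=
  if 0 ∈ S then 0 else if 1 ∈ S then 1 else if 2 ∈ S then 2 else if 3 ∈ S then 3 else
    if 4 ∈ S then 4 else 5

lemma pvp_mem : ∀ S : Finset (Fin 6), S.Nonempty → pvp S ∈ S := by decide +kernel

/-- The index of the pair `{e, i}`. -/
def ix (e i : Fin 4) : Fin 6 :=
  (![![0, 0, 1, 2], ![0, 0, 3, 4], ![1, 3, 0, 5], ![2, 4, 5, 0]] : Fin 4 → Fin 4 → Fin 6) e i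

lemma pr_ix : ∀ e i : Fin 4, e ≠ i → pr (ix e i) = {e, i} := by decide

lemma exists_ix_eq : ∀ (x : Fin 6) (c : Fin 4), c ∈ pr x → ∃ i, i ≠ c ∧ ix c i = x ∧ pr x = {c, i} := by
  decide

lemma sum_fin_three {X : Fin 3 → ZMod 2} {i j k : Fin 3} (h : i ≠ j ∧ i ≠ k ∧ j ≠ k) :
    ∑ l, X l = X i + X j + X k := by
  rw [show (Finset.univ : Finset (Fin 3)) = {i, j, k} by revert i j k; decide,
    Finset.sum_insert (by simp [h]), Finset.sum_pair h.2.2, add_assoc]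

lemma large_pair_set : ∀ M : Finset (Fin 6), 4 ≤ M.card →
    ∃ i j k : Fin 3, (i ≠ j ∧ i ≠ k ∧ j ≠ k) ∧
      (M ∪ pc i = M ∧ M ∪ pc j = M ∧ M ∪ pc k = Finset.univ ∨
      ∃ N : Finset (Fin 6), N.card = 2 ∧ N ∪ pc i = M ∧ (N ∪ pc j).card = 3 ∧
        (N ∪ pc k).card = 3 ∧ N ∪ pc j ∪ pc i = M ∪ pc j ∧ N ∪ pc j ∪ pc j = N ∪ pc j ∧
        N ∪ pc j ∪ pc k = N ∪ pc k ∪ pc j ∧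
        N ∪ pc k ∪ pc i = M ∪ pc k ∧ N ∪ pc k ∪ pc k = N ∪ pc k ∧ M ∪ pc i = M) := by
  decide +kernel

lemma plucker_extend {X : Finset (Fin 6) → ZMod 2} (hu : X Finset.univ = 0)
    (h : ∀ M : Finset (Fin 6), M.Nonempty → M.card ≤ 3 → ∑ i, X (M ∪ pc i) = 0)
    (M : Finset (Fin 6)) (hM : M.Nonempty) : ∑ i, X (M ∪ pc i) = 0 := by
  by_cases hc : M.card ≤ 3
  · exact h M hM hc
  obtain ⟨i, j, k, hijk, ⟨h1, h2, h3⟩ | ⟨N, hN, h1, h2, h3, h4, h5, h6, h7, h8, h9⟩⟩ :=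
    large_pair_set M (by omega)
  · rw [sum_fin_three hijk, h1, h2, h3, hu]
    grind
  · have r1 := h N (Finset.card_pos.mp (by omega)) (by omega)
    have r2 := h (N ∪ pc j) (Finset.card_pos.mp (by omega)) (by omega)
    have r3 := h (N ∪ pc k) (Finset.card_pos.mp (by omega)) (by omega)
    rw [sum_fin_three hijk] at r1 r2 r3 ⊢
    rw [h4, h5, h6] at r2
    rw [h7, h8] at r3
    rw [h1] at r1
    rw [h9]
    grind

lemma pair_set_not_good : ∀ S : Finset (Fin 6), S.Nonempty → ¬ Good S → S = Finset.univ ∨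
    ∃ i j k : Fin 3, (i ≠ j ∧ i ≠ k ∧ j ≠ k) ∧ S ∪ pc i = S ∧ Good (S ∪ pc j) ∧
      Good (S ∪ pc k) := by
  decide +kernel

lemma eq_zero_of_good {X : Finset (Fin 6) → ZMod 2} (hu : X Finset.univ = 0)
    (h : ∀ M : Finset (Fin 6), M.Nonempty → ∑ i, X (M ∪ pc i) = 0) {S : Finset (Fin 6)}
    (hS : S.Nonempty) {r : ℕ} (hr : r ≤ S.card) (hX : ∀ S', Good S' → r ≤ S'.card → X S' = 0) :
    X S = 0 := by
  by_cases hg : Good S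
  · exact hX S hg hr
  obtain rfl | ⟨i, j, k, hijk, h1, h2, h3⟩ := pair_set_not_good S hS hg
  · exact hu
  · have := h S hS
    rwa [sum_fin_three hijk, h1,
      hX _ h2 (hr.trans (Finset.card_le_card Finset.subset_union_left)),
      hX _ h3 (hr.trans (Finset.card_le_card Finset.subset_union_left)), add_zero, add_zero] at this

lemma pair_set_five : ∀ M : Finset (Fin 6), M.card = 5 →
    ∃ i j k : Fin 3, (i ≠ j ∧ i ≠ k ∧ j ≠ k) ∧ ∃ N : Finset (Fin 6), N.card = 3 ∧
      N ∪ pc i = N ∧ N ∪ pc j = M ∧ (N ∪ pc k).card = 4 := by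
  decide +kernel

lemma incidence_extend {X : Fin 4 → Finset (Fin 6) → ZMod 2}
    (hP : ∀ e (M : Finset (Fin 6)), M.Nonempty → ∑ i, X e (M ∪ pc i) = 0) (i : Fin 4)
    (hI : ∀ M : Finset (Fin 6), M.Nonempty → M.card ≤ 4 →
      ∑ e ∈ Finset.univ.erase i, X e (insert (ix e i) M) = 0)
    (M : Finset (Fin 6)) (hM : M.Nonempty) (hM5 : M.card ≤ 5) :
    ∑ e ∈ Finset.univ.erase i, X e (insert (ix e i) M) = 0 := by
  by_cases hc : M.card ≤ 4
  · exact hI M hM hc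
  obtain ⟨a, b, c, habc, N, hN, h1, h2, h3⟩ := pair_set_five M (by omega)
  have hN0 : N.Nonempty := Finset.card_pos.mp (by omega)
  have r : ∑ l, ∑ e ∈ Finset.univ.erase i, X e (insert (ix e i) (N ∪ pc l)) = 0 := by
    rw [Finset.sum_comm]
    refine Finset.sum_eq_zero fun e _ => ?_
    rw [← hP e (insert (ix e i) N) (Finset.insert_nonempty _ _)]
    simp only [Finset.insert_union]
  rw [sum_fin_three habc, h1, h2, hI N hN0 (by omega), hI _ (hN0.mono Finset.subset_union_left)
    (by omega), zero_add, add_zero] at r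
  exact r

lemma pair_step {X : Fin 4 → Finset (Fin 6) → ZMod 2} (hu : ∀ e, X e Finset.univ = 0)
    (hP : ∀ e (M : Finset (Fin 6)), M.Nonempty → ∑ i, X e (M ∪ pc i) = 0)
    (hI : ∀ (i : Fin 4) (M : Finset (Fin 6)), M.Nonempty → M.card ≤ 4 →
      ∑ e ∈ Finset.univ.erase i, X e (insert (ix e i) M) = 0)
    {p : Finset (Fin 6)} (hp : Good p) (high : ∀ e S, Good S → p.card < S.card → X e S = 0)
    (hfree : ∀ e, e ∉ pr (pvp p) → X e p = 0) {c : Fin 4} (hc : c ∈ pr (pvp p)) : X c p = 0 := by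
  obtain ⟨i, hic, hix, hpr⟩ := exists_ix_eq _ _ hc
  have hp5 : p.card ≤ 5 := by
    by_contra h
    have hpu : p = Finset.univ := Finset.eq_univ_of_card _ (by
      have := p.card_le_univ
      simp at this ⊢
      omega)
    rw [hpu] at hp
    revert hp
    decide
  have r := incidence_extend hP i (hI i) p hp.1 hp5
  rw [Finset.sum_eq_single_of_mem c (by simpa using hic.symm), hix,
    Finset.insert_eq_self.mpr (pvp_mem p hp.1)] at r
  · exact r
  · intro e he hec
    by_cases hep : ix e i ∈ p
    · rw [Finset.insert_eq_self.mpr hep]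
      refine hfree e ?_
      rw [hpr]
      simpa [hec] using he
    · exact eq_zero_of_good (hu e) (hP e) (Finset.insert_nonempty _ _)
        (Finset.card_insert_of_notMem hep).ge fun S hS h => high e S hS h

end PairSets

section ThreesTwos

variable {ψ : Pol 4 →ₗ[ZMod 2] ZMod 2}

lemma card_pr (x : Fin 6) : (pr x).card = 2 := by revert x; decide

lemma eq_pr_of_card : ∀ c : Finset (Fin 4), c.card = 2 → ∃ x, pr x = c := by decide +kernel

lemma pr_adjacent : ∀ x y : Fin 6, x ≠ y → y ≠ x.rev → ∃ (I : Finset (Fin 4)) (u v : Fin 4),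
    u ≠ v ∧ u ∉ I ∧ v ∉ I ∧ pr x = insert u I ∧ pr y = insert v I := by decide +kernel

lemma Kills.pair_pluecker {m : ℕ} (h : Kills ψ (List.replicate m 2)) {l : List (Fin 6)}
    (hl : l.length + 2 = m) : ψ (cat ((0 :: 5 :: l).map pr) 1) + ψ (cat ((1 :: 4 :: l).map pr) 1) +
      ψ (cat ((2 :: 3 :: l).map pr) 1) = 0 := by
  subst hl
  have := Kills.pluecker (ψ := ψ) (Kills.of_append (σ := List.replicate l.length 2) h)
    (cat (l.map pr) 1)
  rw [show ({0, 1} : Finset (Fin 4)) = pr 0 from rfl, show ({2, 3} : Finset (Fin 4)) = pr 5 from rfl,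
    show ({0, 2} : Finset (Fin 4)) = pr 1 from rfl, show ({1, 3} : Finset (Fin 4)) = pr 4 from rfl,
    show ({0, 3} : Finset (Fin 4)) = pr 2 from rfl,
    show ({1, 2} : Finset (Fin 4)) = pr 3 from rfl] at this
  simpa only [List.map_cons, cat_cons, cat_nil] using this

lemma Kills.pair_support {m : ℕ} (hm : 5 ≤ m) (h : Kills ψ (List.replicate m 2))
    {l l' : List (Fin 6)} (hl : l.length = m) (hl' : l'.length = m)
    (hll : l.toFinset = l'.toFinset) : ψ (cat (l.map pr) 1) = ψ (cat (l'.map pr) 1) := by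
  have hperm : ∀ l l' : List (Fin 6), l.length = m → l.Perm l' →
      ψ (cat (l.map pr) 1) = ψ (cat (l'.map pr) 1) := fun l l' hl p =>
    h.perm (p.map pr) (by simpa using hl) (by simp [card_pr]) 1
  refine eq_of_toFinset_eq (f := fun l => ψ (cat (l.map pr) 1)) (P := fun _ => True)
    (fun l l' hl _ p => hperm l l' hl p) ?_ hl hl' (fun _ _ => trivial) hll
  intro x y l hl _ hxy
  refine pair_words_idem (f := fun l => ψ (cat (l.map pr) 1)) hm hperm ?_
    (fun l hl => h.pair_pluecker hl) x y l hl hxy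
  intro x y l hl hxy hyx
  obtain ⟨I, u, v, huv, hu, hv, hx, hy⟩ := pr_adjacent x y hxy hyx
  have hI : I.card + 1 = 2 := by
    rw [← card_pr x, hx, Finset.card_insert_of_notMem hu]
  have := Kills.idem_adjacent huv hu hv (Kills.of_append (σ := List.replicate l.length 2) (by
    subst hl; rw [hI]; exact h)) (cat (l.map pr) 1)
  simpa only [List.map_cons, cat_cons, cat_nil, hx, hy] using this

/-- The value of a functional on the words in pairs with a given set of letters. -/
noncomputable def pairVal (ψ : Pol 4 →ₗ[ZMod 2] ZMod 2) (m : ℕ) (S : Finset (Fin 6)) : ZMod 2 :=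
  if S = Finset.univ then 0 else ψ (cat ((word m S).map pr) 1)

lemma Kills.pairVal_toFinset {m : ℕ} (hm : 5 ≤ m) (h : Kills ψ (List.replicate m 2))
    {l : List (Fin 6)} (hl : l.length = m) :
    ψ (cat (l.map pr) 1) = pairVal ψ m l.toFinset := by
  have hval : Valid m l.toFinset := by subst hl; exact valid_toFinset l
  unfold pairVal
  split_ifs with hu
  · have hm6 : 6 ≤ m := by
      have := hval.2
      rw [hu] at this
      simpa using this
    have hv : Valid (m - 2) ({1, 4, 2, 3} : Finset (Fin 6)) :=
      ⟨⟨fun h0 => absurd h0 (by omega), fun h0 => absurd h0 (by decide)⟩,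
        (show ({1, 4, 2, 3} : Finset (Fin 6)).card = 4 by decide).trans_le (by omega)⟩
    have hw := hv.length_word
    have r := h.pair_pluecker (l := word (m - 2) {1, 4, 2, 3}) (by omega)
    rw [h.pair_support hm (l := 0 :: 5 :: _) (l' := l) (by simp; omega) hl (by
        rw [hu, List.toFinset_cons, List.toFinset_cons, hv.toFinset_word]; decide),
      h.pair_support hm (l := 1 :: 4 :: _) (l' := 2 :: 3 :: word (m - 2) {1, 4, 2, 3})
        (by simp; omega) (by simp; omega) (by
        simp only [List.toFinset_cons, hv.toFinset_word]; decide)] at r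
    grind
  · exact h.pair_support hm hl hval.length_word hval.toFinset_word.symm

lemma valid_of_le {α : Type*} {m : ℕ} {M : Finset α} (hM : M.Nonempty) (h : M.card ≤ m) :
    Valid m M :=
  ⟨⟨by rintro rfl; exact absurd (Finset.card_pos.mpr hM) (by omega),
    fun h0 => absurd h0 hM.ne_empty⟩, h⟩

lemma Kills.pairVal_pluecker {m : ℕ} (hm : 5 ≤ m) (h : Kills ψ (List.replicate m 2))
    (M : Finset (Fin 6)) (hM : M.Nonempty) : ∑ i, pairVal ψ m (M ∪ pc i) = 0 := by
  refine plucker_extend (if_pos rfl) (fun M hM hM3 => ?_) M hM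
  have hv : Valid (m - 2) M := valid_of_le hM (by omega)
  have hw := hv.length_word
  have r := h.pair_pluecker (l := word (m - 2) M) (by omega)
  have key : ∀ (x y : Fin 6) (i : Fin 3), pc i = {x, y} →
      ψ (cat ((x :: y :: word (m - 2) M).map pr) 1) = pairVal ψ m (M ∪ pc i) := by
    intro x y i hi
    rw [h.pairVal_toFinset hm (by simp; omega), hi]
    congr 1
    simp only [List.toFinset_cons, hv.toFinset_word]
    ext; simp
  rw [key 0 5 0 rfl, key 1 4 1 rfl, key 2 3 2 rfl] at r
  rw [Fin.sum_univ_three]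
  exact r

lemma Kills.threes_twos_block {j m : ℕ} (hm : 5 ≤ m)
    (h : Kills ψ (List.replicate j 3 ++ List.replicate m 2))
    (hgen : ∀ (p : Finset (Fin 6)) (T : Finset (Fin 4)), Good p → Valid j T →
      (∀ e ∈ T, e ∉ pr (pvp p)) →
      ψ (cat ((word j T).map co ++ (word m p).map pr) 1) = 0)
    {A B : List (Finset (Fin 4))} (hA : A.length = j) (hB : B.length = m)
    (hAc : ∀ c ∈ A, c.card = 3) (hBc : ∀ c ∈ B, c.card = 2) : ψ (cat (A ++ B) 1) = 0 := by
  have hk : ∀ l : List (Fin 4), l.length = j → Kills (ψ ∘ₗ cat (l.map co)) (List.replicate m 2) :=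
    fun l hl => h.suffix (by simpa using hl) (by simp [card_co])
  have hperm : ∀ (l l' : List (Fin 4)), l.length = j → l.Perm l' → ∀ g,
      ψ (cat (l.map co) g) = ψ (cat (l'.map co) g) := fun l l' hl p g =>
    (Kills.of_append h).perm (p.map co) (by simpa using hl) (by simp [card_co]) g
  have hpermV : ∀ (l l' : List (Fin 4)) (S : Finset (Fin 6)), l.length = j → l.Perm l' →
      pairVal (ψ ∘ₗ cat (l.map co)) m S = pairVal (ψ ∘ₗ cat (l'.map co)) m S := by
    intro l l' S hl p
    unfold pairVal
    split_ifs
    · rfl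
    · exact hperm l l' hl p _
  have key := words_elim (S := {p // Good p}) (j := j) (B := 6)
    (X := fun (l : List (Fin 4)) p => pairVal (ψ ∘ₗ cat (l.map co)) m p.1)
    (fun p => p.1.card) (fun p => p.1.card_le_univ) (fun p c => c ∉ pr (pvp p.1))
    (fun p l l' hl q => hpermV l l' p.1 hl q) ?_ ?_
  · obtain ⟨a, rfl, -⟩ := exists_map_of_forall (f := co) (P := fun _ : Fin 4 => True) (l := A)
      (fun c hc => (eq_co_of_card c (hAc c hc)).imp fun a ha => ⟨trivial, ha.symm⟩)
    obtain ⟨b, rfl, -⟩ := exists_map_of_forall (f := pr) (P := fun _ : Fin 6 => True) (l := B)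
      (fun c hc => (eq_pr_of_card c (hBc c hc)).imp fun a ha => ⟨trivial, ha⟩)
    rw [List.length_map] at hA hB
    have hb : b.toFinset.Nonempty := by
      rw [List.toFinset_nonempty_iff]
      rintro rfl
      simp at hB
      omega
    have e := (hk a hA).pairVal_toFinset hm hB
    rw [cat_append]
    refine Eq.trans e ?_
    exact eq_zero_of_good (if_pos rfl) ((hk a hA).pairVal_pluecker hm) hb (Nat.zero_le _)
      fun S hS _ => key ⟨S, hS⟩ a hA
  · intro p high c a hl hc hfree
    have ha : a.length + 1 = j := hl
    refine pair_step (X := fun e S => pairVal (ψ ∘ₗ cat ((e :: a).map co)) m S)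
      (fun e => if_pos rfl) (fun e => (hk (e :: a) hl).pairVal_pluecker hm) ?_ p.2
      (fun e S hS hpS => high ⟨S, hS⟩ hpS (e :: a) hl) hfree (not_not.mp hc)
    intro i M hM hM4
    have hv : Valid (m - 1) M := valid_of_le hM (by omega)
    have hw := hv.length_word
    have hk' : Kills (ψ ∘ₗ cat (a.map co)) [3, 2] := by
      refine Kills.comp_cat (Kills.of_append (σ := List.replicate (m - 1) 2) ?_)
      rw [wt_eq_replicate (n := a.length) (a := 3) (by simp) (by simp [card_co])]
      have e : List.replicate a.length 3 ++ [3, 2] ++ List.replicate (m - 1) 2 =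
          List.replicate j 3 ++ List.replicate m 2 := by
        obtain ⟨m, rfl⟩ : ∃ k, m = k + 1 := ⟨m - 1, by omega⟩
        rw [← ha, List.replicate_succ', List.replicate_succ]
        simp
      rwa [e]
    rw [← hk'.incidence_three_two i (cat ((word (m - 1) M).map pr) 1)]
    refine Finset.sum_congr rfl fun e he => ?_
    have hei : e ≠ i := (Finset.mem_erase.mp he).1
    have e1 := (hk (e :: a) hl).pairVal_toFinset hm (l := ix e i :: word (m - 1) M)
      (by simp; omega)
    rw [List.toFinset_cons, hv.toFinset_word] at e1
    rw [← e1, LinearMap.comp_apply, hperm (e :: a) _ hl (List.perm_append_singleton e a).symm,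
      List.map_append, cat_append]
    simp only [List.map_cons, List.map_nil, cat_cons, cat_nil, LinearMap.comp_apply, pr_ix e i hei]
  · intro p _ l hl hfree
    have hT : Valid j l.toFinset := hl ▸ valid_toFinset l
    have := hgen p.1 l.toFinset p.2 hT (fun e he => hfree e (List.mem_toFinset.mp he))
    change pairVal _ m p.1 = 0
    unfold pairVal
    split_ifs
    · rfl
    · rw [← this, cat_append]
      exact Kills.support (P := fun _ => True) (fun x _ => card_co x)
        (fun x y _ _ => co_adjacent x y) (Kills.of_append h) hl hT.length_word
        (fun _ _ => trivial) hT.toFinset_word.symm _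

end ThreesTwos

section Contraction

variable {k r : ℕ}

/-- The linear map dividing by `x_1 ⋯ x_k` and taking a square root on the monomials with all
exponents odd, and killing all other monomials. -/
noncomputable def contr (k : ℕ) : Pol k →ₗ[ZMod 2] Pol k :=
  (basisMonomials (Fin k) (ZMod 2)).constr (ZMod 2)
    fun e => if oddPart e = Finset.univ then monomial (half e) 1 else 0

lemma contr_cons (c : Finset (Fin k)) (g : Pol k) :
    contr k (cons c g) = if c = Finset.univ then g else 0 := by
  refine monomial_induction (p := LinearMap.eqLocus (contr k ∘ₗ cons c)
    (if c = Finset.univ then LinearMap.id else 0)) (fun e => ?_) g |>.trans ?_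
  · rw [LinearMap.mem_eqLocus, LinearMap.comp_apply, cons_monomial]
    have := (basisMonomials (Fin k) (ZMod 2)).constr_basis (ZMod 2)
      (fun e => if oddPart e = Finset.univ then monomial (half e) (1 : ZMod 2) else 0)
      ((∑ j ∈ c, Finsupp.single j 1) + 2 • e)
    rw [coe_basisMonomials, oddPart_cons, half_cons] at this
    refine this.trans ?_
    split_ifs <;> rfl
  · split_ifs <;> rfl

lemma cons_induction {p : Submodule (ZMod 2) (Pol k)} (h : ∀ c g, cons c g ∈ p) (f : Pol k) :
    f ∈ p := by
  refine monomial_induction (fun e => ?_) f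
  rw [← cons_oddPart_half e, ← cons_monomial]
  exact h _ _

lemma cons_mul_sq (c : Finset (Fin k)) (f g : Pol k) : cons c f * g ^ 2 = cons c (f * g) := by
  rw [cons_apply, cons_apply]
  ring

lemma contr_mul_sq (h g : Pol k) : contr k (h * g ^ 2) = contr k h * g := by
  have := cons_induction (p := LinearMap.eqLocus
    (contr k ∘ₗ LinearMap.mulRight (ZMod 2) (g ^ 2))
    (LinearMap.mulRight (ZMod 2) g ∘ₗ contr k)) (fun c f => by
      rw [LinearMap.mem_eqLocus, LinearMap.comp_apply, LinearMap.comp_apply,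
        LinearMap.mulRight_apply, LinearMap.mulRight_apply, cons_mul_sq, contr_cons, contr_cons]
      split_ifs <;> simp) h
  rwa [LinearMap.mem_eqLocus, LinearMap.comp_apply, LinearMap.comp_apply,
    LinearMap.mulRight_apply, LinearMap.mulRight_apply] at this

lemma contr_hit : hitSubmodule k ≤ (hitSubmodule k).comap (contr k) := by
  refine hit_induction fun n f hn => ?_
  refine cons_induction (p := (hitSubmodule k).comap (contr k ∘ₗ sq n)) (fun c g => ?_) f
  rw [Submodule.mem_comap, LinearMap.comp_apply, cons_apply, sq_sqfree_mul, map_sum]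
  refine Submodule.sum_mem _ fun T hT => ?_
  have e : sqfree (c \ T) * sqfree T ^ 2 *
      (if T.card ≤ n ∧ 2 ∣ n - T.card then sq ((n - T.card) / 2) g ^ 2 else 0) =
      cons (c \ T) (sqfree T *
        if T.card ≤ n ∧ 2 ∣ n - T.card then sq ((n - T.card) / 2) g else 0) := by
    rw [cons_apply]
    split_ifs <;> ring
  rw [e, contr_cons]
  split_ifs with h1 h2
  · obtain rfl : T = ∅ := by
      rw [Finset.eq_univ_iff_forall] at h1
      refine Finset.eq_empty_of_forall_notMem fun x hx => ?_
      exact (Finset.mem_sdiff.mp (h1 x)).2 hx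
    rw [sqfree, Finset.prod_empty, one_mul]
    refine sq_mem_hit ?_ g
    simp only [Finset.card_empty] at h2 ⊢
    omega
  · simp
  · simp

/-- The linear substitution `x_i ↦ ∑ j, N i j x_j`. -/
noncomputable def subst (N : Fin k → Fin r → ZMod 2) : Pol k →ₐ[ZMod 2] Pol r :=
  aeval fun i => ∑ j, C (N i j) * X j

lemma subst_X (N : Fin k → Fin r → ZMod 2) (i : Fin k) :
    subst N (X i) = ∑ j, C (N i j) * X j :=
  aeval_X _ _

lemma sqSeries_linear (a : Fin r → ZMod 2) :
    sqSeries r (∑ j, C (a j) * X j) =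
      Polynomial.C (∑ j, C (a j) * X j) +
        Polynomial.C ((∑ j, C (a j) * X j) ^ 2) * Polynomial.X := by
  have hC : ∀ a : ZMod 2, sqSeries r (C a) = Polynomial.C (C a) := fun a =>
    (sqSeries r).commutes a
  have hsq : ∀ a : ZMod 2, (C a : Pol r) ^ 2 = C a := fun a => by
    rw [← map_pow, ZMod.pow_card]
  rw [CharTwo.sum_sq, map_sum, map_sum, map_sum, Finset.sum_mul, ← Finset.sum_add_distrib]
  refine Finset.sum_congr rfl fun j _ => ?_
  rw [mul_pow, hsq, map_mul, hC, sqSeries_X, map_mul, map_mul]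
  ring

lemma sqSeries_subst (N : Fin k → Fin r → ZMod 2) (f : Pol k) :
    sqSeries r (subst N f) = (sqSeries k f).map (subst N).toRingHom := by
  have h : (sqSeries r).comp (subst N) = (Polynomial.mapAlgHom (subst N)).comp (sqSeries k) := by
    refine MvPolynomial.algHom_ext fun i => ?_
    rw [AlgHom.comp_apply, AlgHom.comp_apply, subst_X, sqSeries_linear, sqSeries_X, ← subst_X,
      Polynomial.coe_mapAlgHom]
    simp
  exact congrArg (fun F => F f) h

lemma sq_subst (N : Fin k → Fin r → ZMod 2) (i : ℕ) (f : Pol k) :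
    sq i (subst N f) = subst N (sq i f) := by
  rw [sq_apply, sqSeries_subst, Polynomial.coeff_map]
  rfl

lemma subst_hit (N : Fin k → Fin r → ZMod 2) :
    hitSubmodule k ≤ (hitSubmodule r).comap (subst N).toLinearMap :=
  hit_induction fun i f hi => by
    rw [Submodule.mem_comap, AlgHom.toLinearMap_apply, ← sq_subst]
    exact sq_mem_hit hi _

lemma constantCoeff_hit {f : Pol k} (hf : f ∈ hitSubmodule k) : constantCoeff f = 0 := by
  let L : Pol k →ₗ[ZMod 2] ZMod 2 := lcoeff (ZMod 2) 0
  refine hit_induction (p := LinearMap.ker L) (fun i f hi => ?_) hf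
  refine monomial_induction (p := LinearMap.ker (L ∘ₗ sq i)) (fun e => ?_) f
  have := sq_isHomogeneous (isHomogeneous_monomial (1 : ZMod 2) (n := e.degree) rfl) i
  exact this.coeff_eq_zero (by simp; omega)

/-- The sum over all surjections `c → Fin r` of the products of the corresponding entries; for
`c.card = r` this is the minor of `N` with rows `c`. -/
def minor (N : Fin k → Fin r → ZMod 2) (c : Finset (Fin k)) : ZMod 2 :=
  ∑ f : c → Fin r, if Function.Surjective f then ∏ i : c, N i (f i) else 0

lemma contr_subst_sqfree (N : Fin k → Fin r → ZMod 2) {c : Finset (Fin k)} (hc : c.card ≤ r) :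
    contr r (subst N (sqfree c)) = C (minor N c) := by
  have h : subst N (sqfree c) = ∑ f : c → Fin r, C (∏ i : c, N i (f i)) * ∏ i : c, X (f i) := by
    rw [sqfree, map_prod, ← Finset.prod_coe_sort]
    simp only [subst, aeval_X]
    rw [Finset.prod_univ_sum, Fintype.piFinset_univ]
    refine Finset.sum_congr rfl fun f _ => ?_
    rw [Finset.prod_mul_distrib, map_prod]
  rw [h, map_sum, minor, map_sum]
  refine Finset.sum_congr rfl fun f _ => ?_
  rw [← smul_eq_C_mul, map_smul]
  split_ifs with hf
  · have hb : Function.Bijective f := by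
      refine ⟨?_, hf⟩
      have e : Fintype.card c = Fintype.card (Fin r) :=
        le_antisymm (by simpa using hc) (Fintype.card_le_of_surjective f hf)
      exact ((Fintype.bijective_iff_surjective_and_card f).mpr ⟨hf, e⟩).1
    have : (∏ i : c, X (f i) : Pol r) = cons Finset.univ 1 := by
      rw [cons_apply, one_pow, mul_one, sqfree]
      exact Fintype.prod_bijective f hb _ _ fun _ => rfl
    rw [this, contr_cons, if_pos rfl, smul_eq_C_mul, mul_one]
  · have hm : (∏ i : c, X (f i) : Pol r) = monomial (∑ i, Finsupp.single (f i) 1) (1 : ZMod 2) := by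
      rw [monomial_sum_one]
      rfl
    rw [hm, ← cons_oddPart_half (∑ i, Finsupp.single (f i) 1), ← cons_monomial, contr_cons,
      if_neg, smul_zero, map_zero]
    intro ho
    refine hf fun y => ?_
    by_contra hy
    push Not at hy
    have := Finset.mem_univ y
    rw [← ho, oddPart, Finset.mem_filter, Finsupp.finsetSum_apply, Finset.sum_eq_zero] at this
    · exact absurd this.2 (by decide)
    · intro i _
      exact Finsupp.single_eq_of_ne (hy i).symm

end Contraction

section Dual

variable {k r r₁ r₂ : ℕ}

lemma minor_of_card_lt (N : Fin k → Fin r → ZMod 2) {c : Finset (Fin k)} (hc : c.card < r) :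
    minor N c = 0 := by
  refine Finset.sum_eq_zero fun f _ => if_neg fun hf => ?_
  have := Fintype.card_le_of_surjective f hf
  rw [Fintype.card_fin, Fintype.card_coe] at this
  omega

lemma contr_subst_cons (N : Fin k → Fin r → ZMod 2) {c : Finset (Fin k)} (hc : c.card ≤ r)
    (g : Pol k) : contr r (subst N (cons c g)) = minor N c • subst N g := by
  rw [cons_apply, map_mul, map_pow, contr_mul_sq, contr_subst_sqfree N hc, smul_eq_C_mul]

lemma contr_pow_subst_cat (N : Fin k → Fin r → ZMod 2) (l : List (Finset (Fin k)))
    (hl : ∀ c ∈ l, c.card ≤ r) (g : Pol k) :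
    (contr r ^ l.length) (subst N (cat l g)) = (l.map (minor N)).prod • subst N g := by
  induction l with
  | nil => simp
  | cons c l ih =>
    rw [List.length_cons, pow_succ, Module.End.mul_apply, cat_cons,
      contr_subst_cons N (hl c List.mem_cons_self), map_smul,
      ih fun c hc => hl c (List.mem_cons_of_mem _ hc), smul_smul, List.map_cons, List.prod_cons]

lemma contr_pow_subst_eq_zero (N : Fin k → Fin r → ZMod 2) {j : ℕ} (l : List (Finset (Fin k)))
    (hl : ∀ c ∈ l, c.card ≤ r) (hj : l.length < j) {c : Finset (Fin k)} (hc : c.card < r)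
    (g : Pol k) : (contr r ^ j) (subst N (cat l (cons c g))) = 0 := by
  obtain ⟨i, rfl⟩ : ∃ i, j = i + (l.length + 1) := ⟨j - (l.length + 1), by omega⟩
  have := contr_pow_subst_cat N (l ++ [c]) (fun x hx => by
    rcases List.mem_append.mp hx with h | h
    · exact hl x h
    · rw [List.mem_singleton.mp h]
      exact hc.le) g
  rw [List.length_append, List.length_singleton, cat_append, cat_cons, cat_nil] at this
  rw [pow_add, Module.End.mul_apply, this, List.map_append, List.prod_append, List.map_singleton,
    List.prod_singleton, minor_of_card_lt N hc, mul_zero, zero_smul, map_zero]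

lemma contr_pow_cat_univ (m : ℕ) (g : Pol k) :
    (contr k ^ m) (cat (List.replicate m Finset.univ) g) = g := by
  induction m with
  | zero => simp
  | succ m ih =>
    rw [pow_succ, Module.End.mul_apply, List.replicate_succ, cat_cons, contr_cons, if_pos rfl, ih]

lemma contr_pow_cat_eq_zero {i m : ℕ} (him : i < m) {c : Finset (Fin k)} (hc : c ≠ Finset.univ)
    (g : Pol k) : (contr k ^ m) (cat (List.replicate i Finset.univ) (cons c g)) = 0 := by
  obtain ⟨j, rfl⟩ : ∃ j, m = j + (1 + i) := ⟨m - (1 + i), by omega⟩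
  rw [pow_add, pow_add, pow_one, Module.End.mul_apply, Module.End.mul_apply, contr_pow_cat_univ,
    contr_cons, if_neg hc, map_zero]

lemma contr_pow_hit {f : Pol k} (m : ℕ) (hf : f ∈ hitSubmodule k) :
    (contr k ^ m) f ∈ hitSubmodule k := by
  induction m with
  | zero => simpa
  | succ m ih =>
    rw [pow_succ', Module.End.mul_apply]
    exact contr_hit ih

lemma subst_subst (N₁ : Fin k → Fin r₁ → ZMod 2) (N₂ : Fin r₁ → Fin r₂ → ZMod 2) (f : Pol k) :
    subst N₂ (subst N₁ f) = subst (fun i j => ∑ l, N₁ i l * N₂ l j) f := by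
  have h : (subst N₂).comp (subst N₁) = subst fun i j => ∑ l, N₁ i l * N₂ l j := by
    refine MvPolynomial.algHom_ext fun i => ?_
    have hC : ∀ a : ZMod 2, subst N₂ (C a) = C a := fun a => (subst N₂).commutes a
    rw [AlgHom.comp_apply, subst_X, subst_X, map_sum]
    simp only [map_mul, hC, subst_X, Finset.mul_sum, map_sum, Finset.sum_mul]
    rw [Finset.sum_comm]
    refine Finset.sum_congr rfl fun j _ => Finset.sum_congr rfl fun l _ => ?_
    ring
  exact congrArg (fun F => F f) h

/-- The functional presenting a polynomial through letters of sizes `k` (`m₀` times), `r₁`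
(`m₁` times) and `r₂` (`m₂` times), with substitutions `N₁` and `N₂` in between. -/
noncomputable def dual (m₀ m₁ m₂ : ℕ) (N₁ : Fin k → Fin r₁ → ZMod 2)
    (N₂ : Fin r₁ → Fin r₂ → ZMod 2) : Pol k →ₗ[ZMod 2] ZMod 2 :=
  lcoeff (ZMod 2) 0 ∘ₗ (contr r₂ ^ m₂) ∘ₗ (subst N₂).toLinearMap ∘ₗ (contr r₁ ^ m₁) ∘ₗ
    (subst N₁).toLinearMap ∘ₗ (contr k ^ m₀)

lemma dual_apply (m₀ m₁ m₂ : ℕ) (N₁ : Fin k → Fin r₁ → ZMod 2) (N₂ : Fin r₁ → Fin r₂ → ZMod 2)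
    (f : Pol k) : dual m₀ m₁ m₂ N₁ N₂ f = constantCoeff ((contr r₂ ^ m₂)
      (subst N₂ ((contr r₁ ^ m₁) (subst N₁ ((contr k ^ m₀) f))))) := rfl

lemma dual_hit (m₀ m₁ m₂ : ℕ) (N₁ : Fin k → Fin r₁ → ZMod 2) (N₂ : Fin r₁ → Fin r₂ → ZMod 2)
    {f : Pol k} (hf : f ∈ hitSubmodule k) : dual m₀ m₁ m₂ N₁ N₂ f = 0 := by
  rw [dual_apply]
  exact constantCoeff_hit (contr_pow_hit _ (subst_hit _ (contr_pow_hit _ (subst_hit _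
    (contr_pow_hit _ hf)))))

lemma dual_cat (m₀ : ℕ) (N₁ : Fin k → Fin r₁ → ZMod 2) (N₂ : Fin r₁ → Fin r₂ → ZMod 2)
    (a b : List (Finset (Fin k))) (ha : ∀ c ∈ a, c.card ≤ r₁) (hb : ∀ c ∈ b, c.card ≤ r₂) :
    dual m₀ a.length b.length N₁ N₂ (cat (List.replicate m₀ Finset.univ ++ (a ++ b)) 1) =
      (a.map (minor N₁)).prod * (b.map (minor fun i j => ∑ l, N₁ i l * N₂ l j)).prod := by
  rw [dual_apply, cat_append, contr_pow_cat_univ, cat_append, contr_pow_subst_cat N₁ a ha,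
    map_smul, map_smul, subst_subst, contr_pow_subst_cat _ b hb, map_one, smul_smul,
    smul_eq_C_mul, mul_one, constantCoeff_C]

lemma dual_eq_zero_of_ne_univ {i m₀ m₁ m₂ : ℕ} (N₁ : Fin k → Fin r₁ → ZMod 2)
    (N₂ : Fin r₁ → Fin r₂ → ZMod 2) (hi : i < m₀) {c : Finset (Fin k)} (hc : c ≠ Finset.univ)
    (w : List (Finset (Fin k))) :
    dual m₀ m₁ m₂ N₁ N₂ (cat (List.replicate i Finset.univ ++ c :: w) 1) = 0 := by
  rw [dual_apply, cat_append, cat_cons, contr_pow_cat_eq_zero hi hc]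
  simp only [map_zero]

lemma dual_eq_zero_of_card_lt {m₀ m₁ m₂ : ℕ} (N₁ : Fin k → Fin r₁ → ZMod 2)
    (N₂ : Fin r₁ → Fin r₂ → ZMod 2) (a : List (Finset (Fin k))) (ha : ∀ c ∈ a, c.card ≤ r₁)
    (hl : a.length < m₁) {c : Finset (Fin k)} (hc : c.card < r₁) (w : List (Finset (Fin k))) :
    dual m₀ m₁ m₂ N₁ N₂ (cat (List.replicate m₀ Finset.univ ++ (a ++ c :: w)) 1) = 0 := by
  rw [dual_apply, cat_append, contr_pow_cat_univ, cat_append, cat_cons,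
    contr_pow_subst_eq_zero N₁ a ha hl hc]
  simp only [map_zero]

end Dual

section Minors

lemma minor_singleton : ∀ (N : Fin 4 → Fin 1 → ZMod 2) (e : Fin 4), minor N {e} = N e 0 := by
  decide +kernel

lemma minor_pair : ∀ (N : Fin 4 → Fin 2 → ZMod 2) (x y : Fin 4), x ≠ y →
    minor N {x, y} = N x 0 * N y 1 + N x 1 * N y 0 := by
  decide +kernel

/-- A matrix whose columns span the orthogonal complement of a vector `n` with `n b ≠ 0`. -/
def normalBasis (n : Fin 4 → ZMod 2) (b : Fin 4) (e : Fin 4) (l : Fin 3) : ZMod 2 :=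
  if e = b then n (b.succAbove l) else if e = b.succAbove l then 1 else 0

lemma minor_normalBasis : ∀ (n : Fin 4 → ZMod 2) (b : Fin 4), n b ≠ 0 → ∀ e : Fin 4,
    minor (normalBasis n b) (co e) = n e := by
  decide +kernel

lemma normalBasis_mul : ∀ (n : Fin 4 → ZMod 2) (b : Fin 4), n b ≠ 0 → ∀ v : Fin 4 → ZMod 2,
    ∑ i, n i * v i = 0 → ∀ e, ∑ l, normalBasis n b e l * v (b.succAbove l) = v e := by
  decide +kernel

end Minors

section Functionals

/-- A linear functional vanishing on hit polynomials. -/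
def HitFree (φ : Pol 4 →ₗ[ZMod 2] ZMod 2) : Prop := ∀ f ∈ hitSubmodule 4, φ f = 0

lemma list_prod_ne_zero_iff {α : Type*} (f : α → ZMod 2) (l : List α) :
    (l.map f).prod ≠ 0 ↔ ∀ x ∈ l, f x ≠ 0 := by
  rw [Ne, List.prod_eq_zero_iff, List.mem_map]
  push Not
  rfl

theorem exists_functional {r : ℕ} (m₀ m₁ m₂ : ℕ) (n : Fin 4 → ZMod 2) (hn : ∃ b, n b ≠ 0)
    (V : Fin 4 → Fin r → ZMod 2) (hV : ∀ j, ∑ i, n i * V i j = 0) :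
    ∃ φ, HitFree φ ∧
      (∀ (l : List (Fin 4)) (b : List (Finset (Fin 4))), l.length = m₁ → b.length = m₂ →
        (∀ c ∈ b, c.card ≤ r) →
        φ (cat (List.replicate m₀ Finset.univ ++ (l.map co ++ b)) 1) =
          (l.map n).prod * (b.map (minor V)).prod) ∧
      (∀ i < m₀, ∀ c : Finset (Fin 4), c ≠ Finset.univ → ∀ w,
        φ (cat (List.replicate i Finset.univ ++ c :: w) 1) = 0) ∧
      (∀ l : List (Fin 4), l.length < m₁ → ∀ c : Finset (Fin 4), c.card < 3 → ∀ w,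
        φ (cat (List.replicate m₀ Finset.univ ++ (l.map co ++ c :: w)) 1) = 0) := by
  obtain ⟨b, hb⟩ := hn
  have hco : ∀ l : List (Fin 4), ∀ c ∈ l.map co, c.card ≤ 3 := by
    intro l c hc
    obtain ⟨e, -, rfl⟩ := List.mem_map.mp hc
    rw [card_co]
  have hmul : (fun i j => ∑ l, normalBasis n b i l * V (b.succAbove l) j) = V := by
    funext i j
    exact normalBasis_mul n b hb (fun i => V i j) (hV j) i
  refine ⟨dual m₀ m₁ m₂ (normalBasis n b) fun l j => V (b.succAbove l) j,
    fun f hf => dual_hit _ _ _ _ _ hf, ?_, fun i hi c hc w => dual_eq_zero_of_ne_univ _ _ hi hc w,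
    fun l hl c hc w => dual_eq_zero_of_card_lt _ _ _ (hco l) (by rwa [List.length_map]) hc w⟩
  rintro l b' rfl rfl hb'
  have := dual_cat m₀ (normalBasis n b) (fun l j => V (b.succAbove l) j) (l.map co) b' (hco l) hb'
  rw [hmul, List.length_map, List.map_map] at this
  rw [this]
  congr 2
  exact List.map_congr_left fun e _ => minor_normalBasis n b hb e

theorem exists_functional_pairs (m₁ m₂ : ℕ) (u v : Fin 4 → ZMod 2) :
    ∃ φ, HitFree φ ∧
      ∀ (p : Fin 4) (l q : List (Fin 4)), p ∉ l → l.length = m₁ → q.length = m₂ →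
        φ (cat (l.map (fun x => {p, x}) ++ q.map singleton) 1) =
          (l.map fun x => u p * v x + v p * u x).prod * (q.map u).prod := by
  refine ⟨dual 0 m₁ m₂ (fun i => ![u i, v i]) fun l (_ : Fin 1) => ![1, 0] l,
    fun f hf => dual_hit _ _ _ _ _ hf, ?_⟩
  rintro p l q hp rfl rfl
  have := dual_cat 0 (fun i => ![u i, v i]) (fun l (_ : Fin 1) => ![(1 : ZMod 2), 0] l)
    (l.map fun x => {p, x}) (q.map singleton) (fun c hc => by
      obtain ⟨x, -, rfl⟩ := List.mem_map.mp hc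
      exact Finset.card_le_two) (fun c hc => by
      obtain ⟨x, -, rfl⟩ := List.mem_map.mp hc
      simp)
  rw [List.length_map, List.length_map, List.map_map, List.map_map, List.replicate_zero,
    List.nil_append] at this
  rw [this]
  congr 2
  · refine List.map_congr_left fun x hx => ?_
    have hpx : p ≠ x := fun h => hp (h ▸ hx)
    simp [minor_pair _ p x hpx]
  · refine List.map_congr_left fun x _ => ?_
    simp [minor_singleton]

end Functionals

section Separation

/-- The family `φ` separates the linear combinations of the family `g`. -/
def Sep {ι : Type*} [Fintype ι] (g : ι → Pol 4) (φ : ι → Pol 4 →ₗ[ZMod 2] ZMod 2) : Prop :=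
  ∀ c : ι → ZMod 2, (∀ i, ∑ j, c j * φ i (g j) = 0) → c = 0

variable {ι κ : Type*} [Fintype ι] [Fintype κ]

lemma Sep.of_rank {g : ι → Pol 4} {φ : ι → Pol 4 →ₗ[ZMod 2] ZMod 2} (r : ι → ℕ)
    (hd : ∀ i, φ i (g i) ≠ 0) (h : ∀ i j, φ i (g j) ≠ 0 → j = i ∨ r j < r i) : Sep g φ := by
  classical
  intro c hc
  have key : ∀ n i, r i = n → c i = 0 := by
    intro n
    induction n using Nat.strong_induction_on with
    | _ n ih =>
      rintro i rfl
      have := hc i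
      rw [Finset.sum_eq_single i] at this
      · exact (mul_eq_zero.mp this).resolve_right (hd i)
      · intro j _ hj
        by_contra hne
        exact left_ne_zero_of_mul hne
          (ih _ ((h i j (right_ne_zero_of_mul hne)).resolve_left hj) j rfl)
      · exact fun hi => absurd (Finset.mem_univ i) hi
  exact funext fun i => key _ i rfl

lemma Sep.sum {g : ι → Pol 4} {φ : ι → Pol 4 →ₗ[ZMod 2] ZMod 2} {g' : κ → Pol 4}
    {φ' : κ → Pol 4 →ₗ[ZMod 2] ZMod 2} (h : Sep g φ) (h' : Sep g' φ')
    (hz : ∀ i j, φ' i (g j) = 0) : Sep (Sum.elim g g') (Sum.elim φ φ') := by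
  intro c hc
  have hr : (fun i => c (Sum.inr i)) = 0 := h' _ fun i => by
    have := hc (Sum.inr i)
    rw [Fintype.sum_sum_type] at this
    simpa [hz] using this
  have hl : (fun i => c (Sum.inl i)) = 0 := h _ fun i => by
    have := hc (Sum.inl i)
    rw [Fintype.sum_sum_type] at this
    simpa [fun i => congrFun hr i] using this
  funext x
  cases x with
  | inl i => exact congrFun hl i
  | inr i => exact congrFun hr i

theorem finrank_QP_eq {n : ℕ} {g : ι → Pol 4} {φ : ι → Pol 4 →ₗ[ZMod 2] ZMod 2}
    (hg : ∀ i, (g i).IsHomogeneous n) (hφ : ∀ i, HitFree (φ i)) (hs : Sep g φ)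
    (hspan : ∀ f : Pol 4, f.IsHomogeneous n →
      f ∈ hitSubmodule 4 ⊔ Submodule.span (ZMod 2) (Set.range g)) :
    Module.finrank (ZMod 2) (QP 4 n) = Fintype.card ι := by
  classical
  set H := homogeneousSubmodule (Fin 4) (ZMod 2) n
  set K := (hitSubmodule 4).comap H.subtype
  let x : ι → H := fun i => ⟨g i, hg i⟩
  have hli : LinearIndependent (ZMod 2) fun i => K.mkQ (x i) := by
    rw [Fintype.linearIndependent_iff]
    intro c hc
    have hmem : ∑ i, c i • g i ∈ hitSubmodule 4 := by
      have : K.mkQ (∑ i, c i • x i) = 0 := by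
        rw [map_sum, ← hc]
        simp only [map_smul]
      rw [Submodule.mkQ_apply, Submodule.Quotient.mk_eq_zero, Submodule.mem_comap, map_sum] at this
      exact this
    have := hs c fun i => by
      have := hφ i _ hmem
      rw [map_sum] at this
      simpa only [map_smul, smul_eq_mul] using this
    exact fun i => congrFun this i
  have hsp : ⊤ ≤ Submodule.span (ZMod 2) (Set.range fun i => K.mkQ (x i)) := by
    rintro y -
    obtain ⟨⟨f, hf⟩, rfl⟩ := K.mkQ_surjective y
    obtain ⟨a, ha, b, hb, hab⟩ := Submodule.mem_sup.mp (hspan f hf)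
    obtain ⟨c, rfl⟩ := (Submodule.mem_span_range_iff_exists_fun _).mp hb
    have e : K.mkQ ⟨f, hf⟩ = ∑ i, c i • K.mkQ (x i) := by
      have : (⟨f, hf⟩ : H) - ∑ i, c i • x i ∈ K := by
        rw [Submodule.mem_comap, map_sub, map_sum]
        refine (congrArg (· ∈ hitSubmodule 4) ?_).mpr ha
        exact sub_eq_of_eq_add hab.symm
      rw [← sub_eq_zero]
      have h2 := (Submodule.Quotient.mk_eq_zero K).mpr this
      rw [← Submodule.mkQ_apply, map_sub, map_sum] at h2
      simpa only [map_smul] using h2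
    rw [e]
    exact Submodule.sum_mem _ fun i _ =>
      Submodule.smul_mem _ _ (Submodule.subset_span (Set.mem_range_self i))
  exact Module.finrank_eq_card_basis (Module.Basis.mk hli hsp)

end Separation

section Indices

instance {α : Type*} [DecidableEq α] (m : ℕ) (V : Finset α) : Decidable (Valid m V) := by
  unfold Valid
  infer_instance

/-- The index set of the blocks ending in one-element letters. -/
def idxOne (j : ℕ) : Finset (Finset (Fin 4) × Finset (Fin 4)) :=
  Finset.univ.filter fun i => i.1.Nonempty ∧ piv i.1 ∉ i.2 ∧ Valid j i.2

/-- The index set of the blocks ending in two-element letters. -/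
def idxTwo (j : ℕ) : Finset (Finset (Fin 6) × Finset (Fin 4)) :=
  Finset.univ.filter fun i => Good i.1 ∧ (∀ e ∈ i.2, e ∉ pr (pvp i.1)) ∧ Valid j i.2

/-- The index set of the block of weight `(3, …, 3, 1)`. -/
def idxLast : Finset (Finset (Fin 4) × Fin 4) :=
  Finset.univ.filter fun i => i.1.Nonempty ∧ i.1.card ≤ 3 ∧ (i.2 = top i.1 → i.1.card = 3 ∧ 0 ∈ i.1)

lemma mem_idxOne {j : ℕ} {i : Finset (Fin 4) × Finset (Fin 4)} :
    i ∈ idxOne j ↔ i.1.Nonempty ∧ piv i.1 ∉ i.2 ∧ Valid j i.2 := by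
  simp [idxOne]

lemma mem_idxTwo {j : ℕ} {i : Finset (Fin 6) × Finset (Fin 4)} :
    i ∈ idxTwo j ↔ Good i.1 ∧ (∀ e ∈ i.2, e ∉ pr (pvp i.1)) ∧ Valid j i.2 := by
  simp [idxTwo]

attribute [irreducible] idxTwo

lemma mem_idxLast {i : Finset (Fin 4) × Fin 4} : i ∈ idxLast ↔
    i.1.Nonempty ∧ i.1.card ≤ 3 ∧ (i.2 = top i.1 → i.1.card = 3 ∧ 0 ∈ i.1) := by
  simp [idxLast]

lemma card_idxOne_zero : (idxOne 0).card = 15 := by decide +kernel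

lemma card_idxOne_one : (idxOne 1).card = 45 := by decide +kernel

lemma card_idxOne_two : (idxOne 2).card = 90 := by decide +kernel

lemma valid_iff_of_le {α : Type*} {V : Finset α} {m j : ℕ} (hm : 0 < m) (hV : V.card ≤ m)
    (h : m ≤ j) : Valid j V ↔ Valid m V := by
  have h1 : m ≠ 0 := by omega
  have h2 : j ≠ 0 := by omega
  simp [Valid, h1, h2, hV, hV.trans h]

lemma card_idxOne {j : ℕ} (hj : 3 ≤ j) : (idxOne j).card = 105 := by
  have : idxOne j = idxOne 3 := by
    ext i
    rw [mem_idxOne, mem_idxOne]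
    refine and_congr_right fun _ => and_congr_right fun hp => ?_
    refine valid_iff_of_le (by omega) ?_ hj
    have := Finset.card_lt_univ_of_notMem hp
    rw [Fintype.card_fin] at this
    omega
  rw [this]
  decide +kernel

lemma card_idxTwo_zero : (idxTwo 0).card = 35 := by decide +kernel

lemma card_idxTwo_one : (idxTwo 1).card = 70 := by decide +kernel

lemma card_idxTwo {j : ℕ} (hj : 2 ≤ j) : (idxTwo j).card = 105 := by
  have : idxTwo j = idxTwo 2 := by
    ext i
    rw [mem_idxTwo, mem_idxTwo]
    refine and_congr_right fun _ => and_congr_right fun hp => ?_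
    refine valid_iff_of_le (by omega) ?_ hj
    have h1 : i.2.card ≤ (pr (pvp i.1))ᶜ.card :=
      Finset.card_le_card fun e he => Finset.mem_compl.mpr (hp e he)
    rwa [Finset.card_compl, card_pr, Fintype.card_fin] at h1
  rw [this]
  decide +kernel

lemma card_idxLast : idxLast.card = 45 := by decide +kernel

end Indices

section Pivots

lemma exists_normal_one : ∀ V T : Finset (Fin 4), V.Nonempty → piv V ∉ T →
    ∃ n : Fin 4 → ZMod 2, (∃ b, n b ≠ 0) ∧ (∑ i, n i * if i ∈ V then 1 else 0) = 0 ∧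
      (T.Nonempty → ∀ e, e ≠ piv V → n e = if e ∈ T then 1 else 0) := by
  decide +kernel

/-- Two columns whose minors are the indicators of a good set of pairs. -/
def frame (p : Finset (Fin 6)) (i : Fin 4) (l : Fin 2) : ZMod 2 :=
  ![if i ≠ (![1, 2, 3, 2, 3, 3] : Fin 6 → Fin 4) (pvp p) ∧
      ix ((![1, 2, 3, 2, 3, 3] : Fin 6 → Fin 4) (pvp p)) i ∈ p then 1 else 0,
    if i ≠ (![0, 0, 0, 1, 1, 2] : Fin 6 → Fin 4) (pvp p) ∧
      ix ((![0, 0, 0, 1, 1, 2] : Fin 6 → Fin 4) (pvp p)) i ∈ p then 1 else 0] l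

lemma frame_minor : ∀ p : Finset (Fin 6), Good p → ∀ x,
    minor (frame p) (pr x) = if x ∈ p then 1 else 0 := by
  decide +kernel

lemma Good.card_le {p : Finset (Fin 6)} (hp : Good p) : p.card ≤ 5 := by
  revert p
  decide +kernel

lemma exists_normal_two : ∀ (p : Finset (Fin 6)), Good p → ∀ T : Finset (Fin 4),
    (∀ e ∈ T, e ∉ pr (pvp p)) →
    ∃ n : Fin 4 → ZMod 2, (∃ b, n b ≠ 0) ∧ (∀ l, ∑ i, n i * frame p i l = 0) ∧
      (T.Nonempty → ∀ e, e ∉ pr (pvp p) → n e = if e ∈ T then 1 else 0) := by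
  decide +kernel

end Pivots

section Families

lemma Sep.of_subset {α : Type*} {J : Finset (Finset α × Finset (Fin 4))} {g : J → Pol 4}
    {φ : J → Pol 4 →ₗ[ZMod 2] ZMod 2} (hd : ∀ i, φ i (g i) ≠ 0)
    (h : ∀ i j, φ i (g j) ≠ 0 → j.1.1 ⊆ i.1.1 ∧ (j.1.1 = i.1.1 → j.1.2 ⊆ i.1.2)) : Sep g φ := by
  refine Sep.of_rank (fun i => 5 * i.1.1.card + i.1.2.card) hd fun i j hij => ?_
  obtain ⟨h1, h2⟩ := h i j hij
  have hT : ∀ i : J, i.1.2.card ≤ 4 := fun i => by simpa using Finset.card_le_univ i.1.2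
  have := hT j
  rcases h1.eq_or_ssubset with he | hlt
  · rcases (h2 he).eq_or_ssubset with he' | hlt
    · exact Or.inl (Subtype.ext (Prod.ext he he'))
    · have := Finset.card_lt_card hlt
      rw [he]
      omega
  · have := Finset.card_lt_card hlt
    omega

/-- The representatives of the block of weight `(2, …, 2, 1, …, 1)`. -/
noncomputable def genTwosOnes (s t : ℕ) (i : idxOne s) : Pol 4 :=
  cat ((word s i.1.2).map (fun x => {piv i.1.1, x}) ++ (word t i.1.1).map singleton) 1

/-- The representatives of the block of weight `(4, 3, …, 3, 1, …, 1)`. -/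
noncomputable def genThreesOnes (j m : ℕ) (i : idxOne j) : Pol 4 :=
  cat (List.replicate 1 Finset.univ ++
    ((word j i.1.2).map co ++ (word m i.1.1).map singleton)) 1

/-- The representatives of the block of weight `(4, 3, …, 3, 2, …, 2)`. -/
noncomputable def genThreesTwos (j m : ℕ) (i : idxTwo j) : Pol 4 :=
  cat (List.replicate 1 Finset.univ ++ ((word j i.1.2).map co ++ (word m i.1.1).map pr)) 1

/-- The words of weight `(4, 4, 3, …, 3, 1)`. -/
noncomputable def wordLast (m : ℕ) (S : Finset (Fin 4)) (e : Fin 4) : Pol 4 :=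
  cat (List.replicate 2 Finset.univ ++ ((word m S).map co ++ [{e}])) 1

/-- The representatives of the block of weight `(4, 4, 3, …, 3, 1)`. -/
noncomputable def genLast (m : ℕ) (i : idxLast) : Pol 4 :=
  if i.1.2 = top i.1.1 then ∑ e ∈ i.1.1, wordLast m i.1.1 e else wordLast m i.1.1 i.1.2

theorem exists_family_twos_ones (s : ℕ) {t : ℕ} (ht : 4 ≤ t) :
    ∃ φ : idxOne s → Pol 4 →ₗ[ZMod 2] ZMod 2,
      (∀ i, HitFree (φ i)) ∧ Sep (genTwosOnes s t) φ := by
  choose φ hφ hv using fun i : idxOne s => exists_functional_pairs s t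
    (fun e => if e ∈ i.1.1 then 1 else 0) (fun e => if e ∈ i.1.2 then 1 else 0)
  have hm : ∀ i : idxOne s, Valid t i.1.1 := fun i =>
    valid_of_le (mem_idxOne.mp i.2).1 ((Finset.card_le_univ _).trans ht)
  have hval : ∀ i j, φ i (genTwosOnes s t j) ≠ 0 ↔
      (∀ x ∈ j.1.2, ¬ (if piv j.1.1 ∈ i.1.1 then (1 : ZMod 2) else 0) *
        (if x ∈ i.1.2 then 1 else 0) + (if piv j.1.1 ∈ i.1.2 then 1 else 0) *
        (if x ∈ i.1.1 then 1 else 0) = 0) ∧ j.1.1 ⊆ i.1.1 := by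
    intro i j
    obtain ⟨-, hp, hT⟩ := mem_idxOne.mp j.2
    rw [genTwosOnes, hv i _ _ _ (fun h => hp (hT.mem_word.mp h)) hT.length_word
      (hm j).length_word, mul_ne_zero_iff, list_prod_ne_zero_iff, list_prod_ne_zero_iff]
    simp only [hT.mem_word, (hm j).mem_word, Finset.subset_iff]
    simp
  refine ⟨φ, hφ, Sep.of_subset (fun i => ?_) fun i j h => ?_⟩
  · obtain ⟨hne, hp, -⟩ := mem_idxOne.mp i.2
    rw [hval]
    refine ⟨fun x hx => ?_, Finset.Subset.refl _⟩
    simp [piv_mem hne, hp, hx]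
  · rw [hval] at h
    refine ⟨h.2, fun he x hx => ?_⟩
    obtain ⟨-, hp, -⟩ := mem_idxOne.mp i.2
    have := h.1 x hx
    rw [he] at this
    by_contra hn
    simp [hp, hn] at this

theorem exists_family_threes_ones (j : ℕ) {m : ℕ} (hm : 4 ≤ m) :
    ∃ φ : idxOne j → Pol 4 →ₗ[ZMod 2] ZMod 2,
      (∀ i, HitFree (φ i)) ∧ Sep (genThreesOnes j m) φ ∧
      ∀ i, ∀ c : Finset (Fin 4), c ≠ Finset.univ → ∀ w, φ i (cat (c :: w) 1) = 0 := by
  choose n hn horth hnT using fun i : idxOne j =>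
    exists_normal_one i.1.1 i.1.2 (mem_idxOne.mp i.2).1 (mem_idxOne.mp i.2).2.1
  choose φ hφ hv hz _ using fun i : idxOne j => exists_functional 1 j m (n i) (hn i)
    (fun e (_ : Fin 1) => if e ∈ i.1.1 then 1 else 0) fun _ => horth i
  have hM : ∀ i : idxOne j, Valid m i.1.1 := fun i =>
    valid_of_le (mem_idxOne.mp i.2).1 ((Finset.card_le_univ _).trans hm)
  have hval : ∀ i k, φ i (genThreesOnes j m k) ≠ 0 ↔
      (∀ x ∈ k.1.2, n i x ≠ 0) ∧ k.1.1 ⊆ i.1.1 := by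
    intro i k
    obtain ⟨-, hp, hT⟩ := mem_idxOne.mp k.2
    rw [genThreesOnes, hv i _ _ hT.length_word (by rw [List.length_map, (hM k).length_word])
      (fun c hc => by
        obtain ⟨e, -, rfl⟩ := List.mem_map.mp hc
        simp), mul_ne_zero_iff, list_prod_ne_zero_iff, list_prod_ne_zero_iff]
    simp only [hT.mem_word, List.forall_mem_map, (hM k).mem_word, Finset.subset_iff,
      minor_singleton]
    simp
  refine ⟨φ, hφ, Sep.of_subset (fun i => ?_) fun i k h => ?_, fun i c hc w =>
    hz i 0 one_pos c hc w⟩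
  · obtain ⟨hne, hp, -⟩ := mem_idxOne.mp i.2
    rw [hval]
    refine ⟨fun x hx => ?_, Finset.Subset.refl _⟩
    rw [hnT i ⟨x, hx⟩ x (fun h => hp (h ▸ hx)), if_pos hx]
    exact one_ne_zero
  · rw [hval] at h
    refine ⟨h.2, fun he x hx => ?_⟩
    have hp := (mem_idxOne.mp k.2).2.1
    have hT : i.1.2.Nonempty := by
      rw [Finset.nonempty_iff_ne_empty]
      intro h0
      have h1 := (mem_idxOne.mp i.2).2.2.1.mpr h0
      rw [(mem_idxOne.mp k.2).2.2.1.mp h1] at hx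
      simp at hx
    have := h.1 x hx
    rw [hnT i hT x (fun h => hp (he ▸ h ▸ hx))] at this
    by_contra hxn
    exact this (if_neg hxn)

theorem exists_family_threes_twos (j : ℕ) {m : ℕ} (hm : 5 ≤ m) :
    ∃ φ : idxTwo j → Pol 4 →ₗ[ZMod 2] ZMod 2,
      (∀ i, HitFree (φ i)) ∧ Sep (genThreesTwos j m) φ ∧
      (∀ i, ∀ c : Finset (Fin 4), c ≠ Finset.univ → ∀ w, φ i (cat (c :: w) 1) = 0) ∧
      ∀ i, ∀ l : List (Fin 4), l.length < j → ∀ c : Finset (Fin 4), c.card < 3 → ∀ w,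
        φ i (cat (List.replicate 1 Finset.univ ++ (l.map co ++ c :: w)) 1) = 0 := by
  have hidx : ∀ i : idxTwo j, Good i.1.1 ∧ (∀ e ∈ i.1.2, e ∉ pr (pvp i.1.1)) ∧ Valid j i.1.2 :=
    fun i => mem_idxTwo.mp i.2
  choose n hn horth hnT using fun i : idxTwo j =>
    exists_normal_two i.1.1 (hidx i).1 i.1.2 (hidx i).2.1
  choose φ hφ hv hz hz' using fun i : idxTwo j => exists_functional 1 j m (n i) (hn i)
    (frame i.1.1) (horth i)
  have hM : ∀ i : idxTwo j, Valid m i.1.1 := fun i =>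
    valid_of_le (hidx i).1.1 ((hidx i).1.card_le.trans hm)
  have hval : ∀ i k, φ i (genThreesTwos j m k) ≠ 0 ↔
      (∀ x ∈ k.1.2, n i x ≠ 0) ∧ k.1.1 ⊆ i.1.1 := by
    intro i k
    obtain ⟨-, hp, hT⟩ := hidx k
    rw [genThreesTwos, hv i _ _ hT.length_word (by rw [List.length_map, (hM k).length_word])
      (fun c hc => by
        obtain ⟨e, -, rfl⟩ := List.mem_map.mp hc
        rw [card_pr]), mul_ne_zero_iff, list_prod_ne_zero_iff, list_prod_ne_zero_iff]
    simp only [hT.mem_word, List.forall_mem_map, (hM k).mem_word, Finset.subset_iff,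
      frame_minor _ (hidx i).1]
    simp
  refine ⟨φ, hφ, Sep.of_subset (fun i => ?_) fun i k h => ?_, fun i c hc w =>
    hz i 0 one_pos c hc w, hz'⟩
  · obtain ⟨-, hp, -⟩ := hidx i
    rw [hval]
    refine ⟨fun x hx => ?_, Finset.Subset.refl _⟩
    rw [hnT i ⟨x, hx⟩ x (hp x hx), if_pos hx]
    exact one_ne_zero
  · rw [hval] at h
    refine ⟨h.2, fun he x hx => ?_⟩
    have hp := (hidx k).2.1
    have hT : i.1.2.Nonempty := by
      rw [Finset.nonempty_iff_ne_empty]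
      intro h0
      have h1 := (hidx i).2.2.1.mpr h0
      rw [(hidx k).2.2.1.mp h1] at hx
      simp at hx
    have := h.1 x hx
    rw [hnT i hT x (he ▸ hp x hx)] at this
    by_contra hxn
    exact this (if_neg hxn)

/-- The pair of sets defining the functional dual to the representative indexed by `(S, e)`. -/
def lastDual (i : Finset (Fin 4) × Fin 4) : Finset (Fin 4) × Finset (Fin 4) :=
  if i.1.card = 3 ∧ i.2 ∈ i.1 then
    if i.2 = top i.1 then (Finset.univ, {0} ∪ i.1ᶜ) else (i.1, {i.2, top i.1})
  else if i.2 ∈ i.1 ∧ i.1.card = 2 then (i.1, i.1) else (i.1, {i.2})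

lemma lastDual_orthogonal : ∀ i ∈ idxLast,
    (∃ b, (if b ∈ (lastDual i).1 then (1 : ZMod 2) else 0) ≠ 0) ∧
    (∑ e, (if e ∈ (lastDual i).1 then (1 : ZMod 2) else 0) *
      if e ∈ (lastDual i).2 then 1 else 0) = 0 := by
  decide +kernel

/-- The value of the functional dual to `i` on the representative indexed by `k`. -/
def lastVal (i k : Finset (Fin 4) × Fin 4) : ZMod 2 :=
  if k.1 ⊆ (lastDual i).1 then
    if k.2 = top k.1 then ∑ e ∈ k.1, if e ∈ (lastDual i).2 then 1 else 0
    else if k.2 ∈ (lastDual i).2 then 1 else 0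
  else 0

/-- A rank function making the matrix `lastVal` triangular. -/
def lastRank (i : Finset (Fin 4) × Fin 4) : ℕ := if i.2 = top i.1 then 4 else i.1.card

lemma lastVal_self : ∀ i ∈ idxLast, lastVal i i ≠ 0 := by
  decide +kernel

lemma lastRank_lt : ∀ i ∈ idxLast, ∀ k ∈ idxLast, lastVal i k ≠ 0 →
    k = i ∨ lastRank k < lastRank i := by
  decide +kernel

theorem exists_family_last {m : ℕ} (hm : 3 ≤ m) :
    ∃ φ : idxLast → Pol 4 →ₗ[ZMod 2] ZMod 2,
      (∀ i, HitFree (φ i)) ∧ Sep (genLast m) φ ∧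
      ∀ i, ∀ k < 2, ∀ c : Finset (Fin 4), c ≠ Finset.univ → ∀ w,
        φ i (cat (List.replicate k Finset.univ ++ c :: w) 1) = 0 := by
  choose φ hφ hv hz _ using fun i : idxLast => exists_functional 2 m 1
    (fun e => if e ∈ (lastDual i.1).1 then (1 : ZMod 2) else 0) (lastDual_orthogonal i.1 i.2).1
    (fun e (_ : Fin 1) => if e ∈ (lastDual i.1).2 then 1 else 0)
    fun _ => (lastDual_orthogonal i.1 i.2).2
  have hword : ∀ i k : idxLast, ∀ e, φ i (wordLast m k.1.1 e) =
      if k.1.1 ⊆ (lastDual i.1).1 then if e ∈ (lastDual i.1).2 then 1 else 0 else 0 := by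
    intro i k e
    obtain ⟨hne, hc, -⟩ := mem_idxLast.mp k.2
    have hT : Valid m k.1.1 := valid_of_le hne (hc.trans hm)
    rw [wordLast, hv i _ _ hT.length_word rfl (by simp), List.map_singleton, List.prod_singleton,
      minor_singleton]
    by_cases h1 : k.1.1 ⊆ (lastDual i.1).1
    · rw [if_pos h1, List.prod_eq_one, one_mul]
      intro y hy
      obtain ⟨x, hx, rfl⟩ := List.mem_map.mp hy
      exact if_pos (h1 (hT.mem_word.mp hx))
    · obtain ⟨x, hx, hxn⟩ := Finset.not_subset.mp h1
      rw [if_neg h1, List.prod_eq_zero, zero_mul]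
      exact List.mem_map.mpr ⟨x, hT.mem_word.mpr hx, if_neg hxn⟩
  have hval : ∀ i k, φ i (genLast m k) = lastVal i.1 k.1 := by
    intro i k
    rw [genLast, lastVal]
    by_cases h : k.1.2 = top k.1.1
    · rw [if_pos h, if_pos h, map_sum, Finset.sum_congr rfl fun e _ => hword i k e]
      split_ifs
      · rfl
      · exact Finset.sum_const_zero
    · rw [if_neg h, if_neg h, hword]
  refine ⟨φ, hφ, Sep.of_rank (fun i => lastRank i.1) (fun i => ?_) (fun i k h => ?_), hz⟩
  · rw [hval]
    exact lastVal_self i.1 i.2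
  · rw [hval] at h
    exact (lastRank_lt i.1 i.2 k.1 k.2 h).imp_left Subtype.ext

end Families

section Spanning

variable {ψ : Pol 4 →ₗ[ZMod 2] ZMod 2}

lemma wt_eq_append {w : List (Finset (Fin 4))} {σ τ : List ℕ} (h : wt w = σ ++ τ) :
    ∃ A B, w = A ++ B ∧ wt A = σ ∧ wt B = τ := by
  obtain ⟨A, B, rfl, hA, hB⟩ := List.map_eq_append_iff.mp h
  exact ⟨A, B, rfl, hA, hB⟩

lemma of_wt_eq_replicate {A : List (Finset (Fin 4))} {j a : ℕ} (h : wt A = List.replicate j a) :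
    A.length = j ∧ ∀ c ∈ A, c.card = a := by
  simpa [wt] using List.eq_replicate_iff.mp h

lemma exists_blocks {w : List (Finset (Fin 4))} {i j a b : ℕ}
    (h : wt w = List.replicate i a ++ List.replicate j b) :
    ∃ A B, w = A ++ B ∧ A.length = i ∧ B.length = j ∧ (∀ c ∈ A, c.card = a) ∧
      ∀ c ∈ B, c.card = b := by
  obtain ⟨A, B, rfl, hA, hB⟩ := wt_eq_append h
  exact ⟨A, B, rfl, (of_wt_eq_replicate hA).1, (of_wt_eq_replicate hB).1,
    (of_wt_eq_replicate hA).2, (of_wt_eq_replicate hB).2⟩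

lemma exists_univ_cons {w : List (Finset (Fin 4))} {τ : List ℕ} (h : wt w = 4 :: τ) :
    ∃ v, w = Finset.univ :: v ∧ wt v = τ := by
  obtain ⟨c, v, rfl, hc, hv⟩ := wt_eq_cons h
  obtain rfl := (Finset.card_eq_iff_eq_univ c).mp hc
  exact ⟨v, rfl, hv⟩

lemma cat_replicate_empty (k : ℕ) : cat (List.replicate k ∅) (1 : Pol 4) = 1 := by
  induction k with
  | zero => rfl
  | succ k ih => rw [List.replicate_succ, cat_cons, ih, cons_apply, sqfree, Finset.prod_empty,
      one_pow, mul_one]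

lemma Kills.of_padded {τ ω : List ℕ} (hp : Padded τ ω)
    (hτ : ∀ v, wt v = τ → Kills ψ τ → ψ (cat v 1) = 0) {w : List (Finset (Fin 4))}
    (hw : wt w = ω) (h : Kills ψ ω) : ψ (cat w 1) = 0 := by
  obtain ⟨k, rfl⟩ := hp
  obtain ⟨A, B, rfl, hA, hB⟩ := wt_eq_append hw
  obtain ⟨hl, hc⟩ := of_wt_eq_replicate hB
  obtain rfl : B = List.replicate k ∅ :=
    List.eq_replicate_iff.mpr ⟨hl, fun c h => Finset.card_eq_zero.mp (hc c h)⟩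
  rw [cat_append, cat_replicate_empty]
  exact hτ A hA (Kills.of_append h)

lemma Kills.twos_ones_span {s t : ℕ} (ht : 5 ≤ t) (hg : ∀ i, ψ (genTwosOnes s t i) = 0)
    (v : List (Finset (Fin 4))) (hv : wt v = List.replicate s 2 ++ List.replicate t 1)
    (h : Kills ψ (List.replicate s 2 ++ List.replicate t 1)) : ψ (cat v 1) = 0 := by
  obtain ⟨A, B, rfl, hA, hB, hAc, hBc⟩ := exists_blocks hv
  exact h.twos_ones_block ht (fun V T hV hT hp => hg ⟨(V, T), mem_idxOne.mpr ⟨hV, hp, hT⟩⟩)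
    hA hB hAc hBc

lemma comp_cat_replicate (i : ℕ) (w : List (Finset (Fin 4))) :
    (ψ ∘ₗ cat (List.replicate i Finset.univ)) (cat w 1) =
      ψ (cat (List.replicate i Finset.univ ++ w) 1) := by
  rw [LinearMap.comp_apply, cat_append]

lemma Kills.comp_cat_replicate {i : ℕ} {τ : List ℕ} (h : Kills ψ (List.replicate i 4 ++ τ)) :
    Kills (ψ ∘ₗ cat (List.replicate i Finset.univ)) τ := by
  refine Kills.comp_cat (w := List.replicate i Finset.univ) ?_
  rwa [wt, List.map_replicate, Finset.card_univ, Fintype.card_fin]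

lemma Kills.threes_ones_span {j m : ℕ} (hm : 5 ≤ m) (hg : ∀ i, ψ (genThreesOnes j m i) = 0)
    (v : List (Finset (Fin 4))) (hv : wt v = 4 :: (List.replicate j 3 ++ List.replicate m 1))
    (h : Kills ψ (4 :: (List.replicate j 3 ++ List.replicate m 1))) : ψ (cat v 1) = 0 := by
  obtain ⟨v, rfl, hv'⟩ := exists_univ_cons hv
  obtain ⟨A, B, rfl, hA, hB, hAc, hBc⟩ := exists_blocks hv'
  have := (Kills.comp_cat_replicate (i := 1) h).threes_ones_block hm (fun V T hV hT hp => by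
    rw [HitProblem.comp_cat_replicate]
    exact hg ⟨(V, T), mem_idxOne.mpr ⟨hV, hp, hT⟩⟩) hA hB hAc hBc
  rwa [HitProblem.comp_cat_replicate] at this

lemma Kills.threes_twos_span {j m : ℕ} (hm : 5 ≤ m) (hg : ∀ i, ψ (genThreesTwos j m i) = 0)
    (v : List (Finset (Fin 4))) (hv : wt v = 4 :: (List.replicate j 3 ++ List.replicate m 2))
    (h : Kills ψ (4 :: (List.replicate j 3 ++ List.replicate m 2))) : ψ (cat v 1) = 0 := by
  obtain ⟨v, rfl, hv'⟩ := exists_univ_cons hv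
  obtain ⟨A, B, rfl, hA, hB, hAc, hBc⟩ := exists_blocks hv'
  have := (Kills.comp_cat_replicate (i := 1) h).threes_twos_block hm (fun p T hp hT hpT => by
    rw [HitProblem.comp_cat_replicate]
    exact hg ⟨(p, T), mem_idxTwo.mpr ⟨hp, hpT, hT⟩⟩) hA hB hAc hBc
  rwa [HitProblem.comp_cat_replicate] at this

lemma Kills.threes_one_span {m : ℕ} (hm : 3 ≤ m) (hg : ∀ i, ψ (genLast m i) = 0)
    (v : List (Finset (Fin 4))) (hv : wt v = 4 :: 4 :: (List.replicate m 3 ++ [1]))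
    (h : Kills ψ (4 :: 4 :: (List.replicate m 3 ++ [1]))) : ψ (cat v 1) = 0 := by
  obtain ⟨v, rfl, hv'⟩ := exists_univ_cons hv
  obtain ⟨v, rfl, hv''⟩ := exists_univ_cons hv'
  obtain ⟨A, B, rfl, hA, hB, hAc, hBc⟩ := exists_blocks (j := 1) hv''
  have := (Kills.comp_cat_replicate (i := 2) h).threes_one_block hm (fun S e hS hc he => by
    rw [HitProblem.comp_cat_replicate]
    have := hg ⟨(S, e), mem_idxLast.mpr ⟨hS, hc, fun h => absurd h he⟩⟩
    rwa [genLast, if_neg he] at this) (fun S hc h0 => by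
    have := hg ⟨(S, top S), mem_idxLast.mpr ⟨⟨0, h0⟩, hc.le, fun _ => ⟨hc, h0⟩⟩⟩
    rw [genLast, if_pos rfl, map_sum] at this
    refine (Finset.sum_congr rfl fun e _ => ?_).trans this
    exact HitProblem.comp_cat_replicate _ _) hA hB hAc hBc
  rwa [HitProblem.comp_cat_replicate] at this

theorem mem_hit_sup_span {ι : Type*} {a b n : ℕ} (hn : n = 2 ^ (b + 1 + (a + 6)) + 2 ^ (b + 1) - 2)
    {g : ι → Pol 4} (hg : ∀ i, (g i).IsHomogeneous n)
    (h : ∀ ψ : Pol 4 →ₗ[ZMod 2] ZMod 2, (∀ i, ψ (g i) = 0) →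
      (∀ i, ψ (genTwosOnes (b + 1) (a + 6) i) = 0) ∧
      (∀ c, b = c + 1 → ∀ i, ψ (genThreesOnes c (a + 7) i) = 0) ∧
      (∀ i, ψ (genThreesTwos b (a + 5) i) = 0) ∧
      (b = 0 → ∀ i, ψ (genLast (a + 3) i) = 0))
    (f : Pol 4) (hf : f.IsHomogeneous n) :
    f ∈ hitSubmodule 4 ⊔ Submodule.span (ZMod 2) (Set.range g) := by
  refine mem_of_words (L := b + 1 + (a + 6) + 1) ?_ ?_ (fun w _ hw => ?_) hf
  · have : 2 ^ (b + 1) ≤ 2 ^ (b + 1 + (a + 6)) := Nat.pow_le_pow_right two_pos (by omega)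
    have := Nat.one_le_two_pow (n := b)
    rw [hn, pow_succ 2 (b + 1 + (a + 6))]
    omega
  · rw [Submodule.span_le]
    rintro _ ⟨i, rfl⟩
    exact hg i
  · refine mem_of_functional fun ψ hψ => ?_
    have hk : Kills ψ (wt w) := fun f hf => hψ f (Submodule.mem_sup_left hf)
    obtain ⟨h1, h2, h3, h4⟩ := h ψ fun i =>
      hψ _ (Submodule.mem_sup_right (Submodule.subset_span (Set.mem_range_self i)))
    by_cases hd : Dead (wt w)
    · exact hd.eq_zero rfl hk
    have ha : Alive (wt w) := by
      refine ⟨fun x hx => ?_, hd⟩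
      obtain ⟨c, -, rfl⟩ := List.mem_map.mp hx
      exact card_finset_fin_le c
    rcases ha.classify (hw.trans hn) with hp | ⟨c, hc, hp⟩ | hp | ⟨hb, hp⟩
    · exact Kills.of_padded hp (Kills.twos_ones_span (by omega) h1) rfl hk
    · exact Kills.of_padded hp (Kills.threes_ones_span (by omega) (h2 c hc)) rfl hk
    · exact Kills.of_padded hp (Kills.threes_twos_span (by omega) h3) rfl hk
    · exact Kills.of_padded hp (Kills.threes_one_span (by omega) (h4 hb)) rfl hk

end Spanning

section Degrees

lemma ev_append (σ τ : List ℕ) : ev (σ ++ τ) = ev σ + 2 ^ σ.length * ev τ := by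
  induction σ with
  | nil => simp [ev]
  | cons a σ ih =>
    rw [List.cons_append, ev, ev, ih, List.length_cons, pow_succ]
    ring

lemma ev_replicate_add (j a : ℕ) : ev (List.replicate j a) + a = a * 2 ^ j := by
  induction j with
  | zero => simp [ev]
  | succ j ih =>
    rw [List.replicate_succ, ev, pow_succ, ← mul_assoc, ← ih]
    ring

lemma wt_map_of_card {α : Type*} (f : α → Finset (Fin 4)) {a : ℕ} (l : List α)
    (h : ∀ x ∈ l, (f x).card = a) : wt (l.map f) = List.replicate l.length a := by
  rw [wt, List.map_map, List.eq_replicate_iff]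
  simpa using h

lemma isHomogeneous_blocks {i j m a b n : ℕ} {A B : List (Finset (Fin 4))}
    (hA : wt A = List.replicate j a) (hB : wt B = List.replicate m b)
    (hn : n + 4 + 2 ^ i * a + 2 ^ (i + j) * b = 2 ^ i * 4 + 2 ^ (i + j) * a + 2 ^ (i + j + m) * b) :
    (cat (List.replicate i Finset.univ ++ (A ++ B)) 1).IsHomogeneous n := by
  convert cat_isHomogeneous (List.replicate i Finset.univ ++ (A ++ B)) using 1
  rw [wt_append, wt_append, hA, hB, wt, List.map_replicate, Finset.card_univ, Fintype.card_fin,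
    ev_append, ev_append, List.length_replicate, List.length_replicate]
  have h1 := ev_replicate_add i 4
  have h2 := ev_replicate_add j a
  have h3 := ev_replicate_add m b
  generalize ev (List.replicate i 4) = x at *
  generalize ev (List.replicate j a) = y at *
  generalize ev (List.replicate m b) = z at *
  rw [pow_add, pow_add, pow_add] at hn
  linear_combination (exp := 1) hn - h1 - 2 ^ i * h2 - 2 ^ i * 2 ^ j * h3

lemma genTwosOnes_isHomogeneous {s t : ℕ} (ht : 4 ≤ t) (i : idxOne s) :
    (genTwosOnes s t i).IsHomogeneous (2 ^ (s + t) + 2 ^ s - 2) := by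
  obtain ⟨hne, hp, hT⟩ := mem_idxOne.mp i.2
  have hV : Valid t i.1.1 := valid_of_le hne ((card_finset_fin_le i.1.1).trans ht)
  refine isHomogeneous_blocks (i := 0) (a := 2) (b := 1) (wt_map_of_card _ _ fun x hx => ?_)
    (wt_map_of_card _ _ fun x _ => Finset.card_singleton x) ?_
  · refine Finset.card_pair ?_
    rintro rfl
    exact hp (hT.mem_word.mp hx)
  · rw [hT.length_word, hV.length_word, zero_add]
    have := Nat.one_le_two_pow (n := s)
    have := Nat.one_le_two_pow (n := s + t)
    omega

lemma genThreesOnes_isHomogeneous {j m : ℕ} (hm : 4 ≤ m) (i : idxOne j) :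
    (genThreesOnes j m i).IsHomogeneous (2 ^ (j + m + 1) + 2 ^ (j + 2) - 2) := by
  obtain ⟨hne, hp, hT⟩ := mem_idxOne.mp i.2
  have hV : Valid m i.1.1 := valid_of_le hne ((card_finset_fin_le i.1.1).trans hm)
  refine isHomogeneous_blocks (i := 1) (a := 3) (b := 1) (wt_map_of_card _ _ fun x _ => card_co x)
    (wt_map_of_card _ _ fun x _ => Finset.card_singleton x) ?_
  rw [hT.length_word, hV.length_word, show 1 + j + m = j + m + 1 by ring, add_comm 1 j,
    pow_succ 2 (j + 1)]
  have := Nat.one_le_two_pow (n := j + 1)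
  omega

lemma genThreesTwos_isHomogeneous {j m : ℕ} (hm : 5 ≤ m) (i : idxTwo j) :
    (genThreesTwos j m i).IsHomogeneous (2 ^ (j + m + 2) + 2 ^ (j + 1) - 2) := by
  obtain ⟨hp, -, hT⟩ := mem_idxTwo.mp i.2
  have hV : Valid m i.1.1 := valid_of_le hp.1 (hp.card_le.trans hm)
  refine isHomogeneous_blocks (i := 1) (a := 3) (b := 2) (wt_map_of_card _ _ fun x _ => card_co x)
    (wt_map_of_card _ _ fun x _ => card_pr x) ?_
  rw [hT.length_word, hV.length_word, show 1 + j + m = j + m + 1 by ring, add_comm 1 j,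
    pow_succ 2 (j + m + 1)]
  have := Nat.one_le_two_pow (n := j + 1)
  omega

lemma wordLast_isHomogeneous {m : ℕ} {S : Finset (Fin 4)} (hS : Valid m S) (e : Fin 4) :
    (wordLast m S e).IsHomogeneous (2 ^ (m + 4)) := by
  refine isHomogeneous_blocks (i := 2) (m := 1) (a := 3) (b := 1)
    (wt_map_of_card _ _ fun x _ => card_co x) rfl ?_
  rw [hS.length_word, show 2 + m + 1 = m + 3 by ring, pow_succ 2 (m + 3), pow_succ 2 (m + 2),
    add_comm 2 m]
  omega

lemma genLast_isHomogeneous {m : ℕ} (hm : 3 ≤ m) (i : idxLast) :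
    (genLast m i).IsHomogeneous (2 ^ (m + 4)) := by
  obtain ⟨hne, hc, -⟩ := mem_idxLast.mp i.2
  have hS : Valid m i.1.1 := valid_of_le hne (hc.trans hm)
  rw [genLast]
  split_ifs
  · exact IsHomogeneous.sum _ _ _ fun e _ => wordLast_isHomogeneous hS e
  · exact wordLast_isHomogeneous hS _

end Degrees

section Dimension

lemma exists_cons_word {α : Type*} [DecidableEq α] {m : ℕ} {V : Finset α} (h : Valid m V)
    (hm : m ≠ 0) : ∃ x l, word m V = x :: l :=
  List.exists_cons_of_length_pos (by rw [h.length_word]; omega)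

lemma exists_genTwosOnes_eq {s t : ℕ} (hs : s ≠ 0) (i : idxOne s) :
    ∃ c ≠ Finset.univ, ∃ w, genTwosOnes s t i = cat (c :: w) 1 := by
  obtain ⟨-, -, hT⟩ := mem_idxOne.mp i.2
  obtain ⟨x, l, hl⟩ := exists_cons_word hT hs
  refine ⟨{piv i.1.1, x}, fun h => ?_, _, by rw [genTwosOnes, hl, List.map_cons, List.cons_append]⟩
  have := h ▸ Finset.card_le_two (a := piv i.1.1) (b := x)
  simp at this

lemma genThreesOnes_eq {j m : ℕ} (hm : 4 ≤ m) (i : idxOne j) :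
    ∃ l : List (Fin 4), l.length = j ∧ ∃ c : Finset (Fin 4), c.card < 3 ∧ ∃ w,
      genThreesOnes j m i = cat (List.replicate 1 Finset.univ ++ (l.map co ++ c :: w)) 1 := by
  obtain ⟨hne, -, hT⟩ := mem_idxOne.mp i.2
  obtain ⟨x, l, hl⟩ := exists_cons_word
    (valid_of_le hne ((card_finset_fin_le i.1.1).trans hm)) (show m ≠ 0 by omega)
  exact ⟨word j i.1.2, hT.length_word, {x}, by simp, _, by rw [genThreesOnes, hl, List.map_cons]⟩

lemma genThreesTwos_zero_eq {m : ℕ} (hm : 5 ≤ m) (i : idxTwo 0) :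
    ∃ c ≠ Finset.univ, ∃ w,
      genThreesTwos 0 m i = cat (List.replicate 1 Finset.univ ++ c :: w) 1 := by
  obtain ⟨hp, -, hT⟩ := mem_idxTwo.mp i.2
  obtain ⟨x, l, hl⟩ := exists_cons_word (valid_of_le hp.1 (hp.card_le.trans hm))
    (show m ≠ 0 by omega)
  refine ⟨pr x, fun h => ?_, _, by
    rw [genThreesTwos, hl, List.map_cons, List.length_eq_zero_iff.mp hT.length_word, List.map_nil,
      List.nil_append]⟩
  have := card_pr x
  rw [h] at this
  simp at this

theorem finrank_QP_one (a : ℕ) : Module.finrank (ZMod 2) (QP 4 (2 ^ (1 + (a + 6)) + 2 ^ 1 - 2)) =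
    (idxOne 1).card + ((idxTwo 0).card + idxLast.card) := by
  obtain ⟨φ₁, hφ₁, hs₁⟩ := exists_family_twos_ones 1 (t := a + 6) (by omega)
  obtain ⟨φ₂, hφ₂, hs₂, hz₂, -⟩ := exists_family_threes_twos 0 (m := a + 5) (by omega)
  obtain ⟨φ₃, hφ₃, hs₃, hz₃⟩ := exists_family_last (m := a + 3) (by omega)
  have hs := hs₁.sum (hs₂.sum hs₃ fun j i => by
    obtain ⟨c, hc, w, e⟩ := genThreesTwos_zero_eq (m := a + 5) (by omega) i
    rw [e]
    exact hz₃ j 1 one_lt_two c hc w) fun j i => by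
      obtain ⟨c, hc, w, e⟩ := exists_genTwosOnes_eq (t := a + 6) one_ne_zero i
      rw [e]
      cases j with
      | inl j => exact hz₂ j c hc w
      | inr j => exact hz₃ j 0 two_pos c hc w
  have hg : ∀ i, (Sum.elim (genTwosOnes 1 (a + 6))
      (Sum.elim (genThreesTwos 0 (a + 5)) (genLast (a + 3))) i).IsHomogeneous
      (2 ^ (1 + (a + 6)) + 2 ^ 1 - 2) := by
    rintro (i | i | i)
    · exact genTwosOnes_isHomogeneous (by omega) i
    · rw [show 1 + (a + 6) = 0 + (a + 5) + 2 by ring]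
      exact genThreesTwos_isHomogeneous (by omega) i
    · rw [pow_one, Nat.add_sub_cancel, show 1 + (a + 6) = a + 3 + 4 by ring]
      exact genLast_isHomogeneous (by omega) i
  rw [finrank_QP_eq hg (by rintro (i | i | i) <;> simp [hφ₁, hφ₂, hφ₃]) hs
    (mem_hit_sup_span (b := 0) (a := a) (by rw [zero_add]) hg fun ψ h =>
      ⟨fun i => h (Sum.inl i), fun c hc => by omega, fun i => h (Sum.inr (Sum.inl i)),
        fun _ i => h (Sum.inr (Sum.inr i))⟩)]
  simp only [Fintype.card_sum, Fintype.card_coe]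

theorem finrank_QP_add_two (c a : ℕ) :
    Module.finrank (ZMod 2) (QP 4 (2 ^ (c + 2 + (a + 6)) + 2 ^ (c + 2) - 2)) =
      (idxOne (c + 2)).card + ((idxOne c).card + (idxTwo (c + 1)).card) := by
  obtain ⟨φ₁, hφ₁, hs₁⟩ := exists_family_twos_ones (c + 2) (t := a + 6) (by omega)
  obtain ⟨φ₂, hφ₂, hs₂, hz₂⟩ := exists_family_threes_ones c (m := a + 7) (by omega)
  obtain ⟨φ₃, hφ₃, hs₃, hz₃, hz₃'⟩ := exists_family_threes_twos (c + 1) (m := a + 5) (by omega)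
  have hs := hs₁.sum (hs₂.sum hs₃ fun j i => by
    obtain ⟨l, hl, d, hd, w, e⟩ := genThreesOnes_eq (m := a + 7) (by omega) i
    rw [e]
    exact hz₃' j l (by omega) d hd w) fun j i => by
      obtain ⟨d, hd, w, e⟩ := exists_genTwosOnes_eq (t := a + 6) (show c + 2 ≠ 0 by omega) i
      rw [e]
      cases j with
      | inl j => exact hz₂ j d hd w
      | inr j => exact hz₃ j d hd w
  have hg : ∀ i, (Sum.elim (genTwosOnes (c + 2) (a + 6))
      (Sum.elim (genThreesOnes c (a + 7)) (genThreesTwos (c + 1) (a + 5))) i).IsHomogeneous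
      (2 ^ (c + 2 + (a + 6)) + 2 ^ (c + 2) - 2) := by
    rintro (i | i | i)
    · exact genTwosOnes_isHomogeneous (by omega) i
    · rw [show c + 2 + (a + 6) = c + (a + 7) + 1 by ring]
      exact genThreesOnes_isHomogeneous (by omega) i
    · rw [show c + 2 + (a + 6) = c + 1 + (a + 5) + 2 by ring]
      exact genThreesTwos_isHomogeneous (by omega) i
  rw [finrank_QP_eq hg (by rintro (i | i | i) <;> simp [hφ₁, hφ₂, hφ₃]) hs
    (mem_hit_sup_span (b := c + 1) (a := a) rfl hg fun ψ h =>
      ⟨fun i => h (Sum.inl i), fun d hd => by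
        obtain rfl : c = d := by omega
        exact fun i => h (Sum.inr (Sum.inl i)), fun i => h (Sum.inr (Sum.inr i)),
        fun h0 => by omega⟩)]
  simp only [Fintype.card_sum, Fintype.card_coe]

end Dimension

end HitProblem

open HitProblem

/-- For `t ≥ 6`, `dim (QP_4)_{2^{s+t} + 2^s - 2}` equals `125, 175, 255, 300, 315`
for `s = 1, 2, 3, 4` and `s ≥ 5`. -/
theorem stmt12 (s t : ℕ) (hs : 1 ≤ s) (ht : 6 ≤ t) :
    (s = 1 → Module.finrank (ZMod 2) (QP 4 (2 ^ (s + t) + 2 ^ s - 2)) = 125) ∧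
    (s = 2 → Module.finrank (ZMod 2) (QP 4 (2 ^ (s + t) + 2 ^ s - 2)) = 175) ∧
    (s = 3 → Module.finrank (ZMod 2) (QP 4 (2 ^ (s + t) + 2 ^ s - 2)) = 255) ∧
    (s = 4 → Module.finrank (ZMod 2) (QP 4 (2 ^ (s + t) + 2 ^ s - 2)) = 300) ∧
    (5 ≤ s → Module.finrank (ZMod 2) (QP 4 (2 ^ (s + t) + 2 ^ s - 2)) = 315) := by
  obtain ⟨a, rfl⟩ := Nat.exists_eq_add_of_le' ht
  refine ⟨?_, ?_, ?_, ?_, fun h5 => ?_⟩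
  · rintro rfl
    rw [finrank_QP_one, card_idxOne_one, card_idxTwo_zero, card_idxLast]
  · rintro rfl
    rw [finrank_QP_add_two 0 a, card_idxOne_two, card_idxOne_zero, card_idxTwo_one]
  · rintro rfl
    rw [finrank_QP_add_two 1 a, card_idxOne (by omega), card_idxOne_one, card_idxTwo (by omega)]
  · rintro rfl
    rw [finrank_QP_add_two 2 a, card_idxOne (by omega), card_idxOne_two, card_idxTwo (by omega)]
  · obtain ⟨c, rfl⟩ := Nat.exists_eq_add_of_le' (show 2 ≤ s by omega)
    rw [finrank_QP_add_two c a, card_idxOne (by omega), card_idxOne (by omega),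
      card_idxTwo (by omega)]
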